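/- Let n ≥ 2, α ∈ (1,2), and let D ⊂ ℝⁿ be a bounded open set of class C^{1,1}. Let g_α be the α-Green kernel on D, let F ⊂ D be relatively closed in D with cp_*F > 0, set Δ := D∖F, and let ω be a nonzero positive Radon measure concentrated on Δ such that either ω(Δ) < ∞ or the α-Green energy ∫ g_α(x,y) d(ω⊗ω)(x,y) < ∞. Then the balayage ω^F_{g_α} of ω onto F with respect to g_α satisfies the strict inequality ω^F_{g_α}(F) < ω(Δ). -/

import Mathlib

open MeasureTheory Filter Set Topology ENNReal CompactlySupported UniformConvergence

namespace Balayage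
open scoped Classical

variable {X : Type*} [TopologicalSpace X] [MeasurableSpace X]

/-- A kernel: symmetric, lower semicontinuous, `[0,∞]`-valued. -/
structure IsKernel (κ : X → X → ℝ≥0∞) : Prop where
  symm : ∀ x y, κ x y = κ y x
  lsc : LowerSemicontinuous fun p : X × X => κ p.1 p.2

/-- The potential `U^μ(x) = ∫ κ(x,y) dμ(y)`. -/
noncomputable def potential (κ : X → X → ℝ≥0∞) (μ : Measure X) (x : X) : ℝ≥0∞ :=
  ∫⁻ y, κ x y ∂μ

/-- The mutual energy `I(μ,ν) = ∫∫ κ(x,y) dν(y) dμ(x)` of two positive measures. -/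
noncomputable def energy (κ : X → X → ℝ≥0∞) (μ ν : Measure X) : ℝ≥0∞ :=
  ∫⁻ x, potential κ ν x ∂μ

/-- A positive Radon measure (regular Borel measure, finite on compacts). -/
def IsRadon (μ : Measure X) : Prop := μ.Regular

/-- Finite energy: `I(μ) < ∞`. -/
def FiniteEnergy (κ : X → X → ℝ≥0∞) (μ : Measure X) : Prop := energy κ μ μ < ⊤

/-- Membership in the cone `E⁺` of positive Radon measures of finite energy. -/
def memE (κ : X → X → ℝ≥0∞) (μ : Measure X) : Prop := IsRadon μ ∧ FiniteEnergy κ μ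

/-- Membership in `E⁺(A)`: measures of `E⁺` concentrated on `A`
(i.e. the complement of `A` is negligible). -/
def memEOn (κ : X → X → ℝ≥0∞) (A : Set X) (μ : Measure X) : Prop :=
  memE κ μ ∧ μ Aᶜ = 0

/-- The strong (energy) distance `‖μ-ν‖ = √(I(μ)+I(ν)-2I(μ,ν))`. -/
noncomputable def sDist (κ : X → X → ℝ≥0∞) (μ ν : Measure X) : ℝ :=
  Real.sqrt ((energy κ μ μ).toReal + (energy κ ν ν).toReal - 2 * (energy κ μ ν).toReal)

/-- Membership in `E'(A)`, the strong closure of `E⁺(A)` in `E⁺`. -/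
def memEClos (κ : X → X → ℝ≥0∞) (A : Set X) (μ : Measure X) : Prop :=
  memE κ μ ∧ ∀ ε : ℝ, 0 < ε → ∃ ν, memEOn κ A ν ∧ sDist κ μ ν < ε

/-- The capacity of a compact set: the inverse of the minimal energy of
probability measures concentrated on it. -/
noncomputable def capC (κ : X → X → ℝ≥0∞) (K : Set X) : ℝ≥0∞ :=
  (⨅ (μ : Measure X) (_ : IsProbabilityMeasure μ) (_ : μ Kᶜ = 0), energy κ μ μ)⁻¹

/-- The inner capacity `cp_* A`: supremum of capacities of compact subsets. -/
noncomputable def innerCap (κ : X → X → ℝ≥0∞) (A : Set X) : ℝ≥0∞ :=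
  ⨆ (K : Set X) (_ : IsCompact K) (_ : K ⊆ A), capC κ K

/-- The outer capacity `cp^* A`: infimum of inner capacities of open supersets. -/
noncomputable def outerCap (κ : X → X → ℝ≥0∞) (A : Set X) : ℝ≥0∞ :=
  ⨅ (D : Set X) (_ : IsOpen D) (_ : A ⊆ D), innerCap κ D

/-- Strict positive definiteness (energy principle), stated for pairs of positive
measures of finite energy: `I(μ-ν) ≥ 0`, with equality only for `μ = ν`. -/
def StrictlyPosDef (κ : X → X → ℝ≥0∞) : Prop :=
  ∀ μ ν : Measure X, IsRadon μ → IsRadon ν → FiniteEnergy κ μ → FiniteEnergy κ ν →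
    (2 * energy κ μ ν ≤ energy κ μ μ + energy κ ν ν) ∧
    (2 * energy κ μ ν = energy κ μ μ + energy κ ν ν → μ = ν)

/-- Vague convergence of a sequence of measures: convergence of integrals of
continuous compactly supported functions. -/
def VagueTendsto (μ : ℕ → Measure X) (μ₀ : Measure X) : Prop :=
  ∀ f : X → ℝ, Continuous f → HasCompactSupport f →
    Tendsto (fun j => ∫ x, f x ∂(μ j)) atTop (nhds (∫ x, f x ∂μ₀))

/-- A perfect kernel: strictly positive definite, `E⁺` strongly complete, and the strong
topology on `E⁺` finer than the vague topology (sequential formulation; sequences suffice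
on second-countable spaces). -/
structure Perfect (κ : X → X → ℝ≥0∞) : Prop where
  posdef : StrictlyPosDef κ
  complete : ∀ μ : ℕ → Measure X, (∀ j, memE κ (μ j)) →
    (∀ ε : ℝ, 0 < ε → ∃ N, ∀ m ≥ N, ∀ n ≥ N, sDist κ (μ m) (μ n) < ε) →
    ∃ μ₀, memE κ μ₀ ∧ Tendsto (fun j => sDist κ (μ j) μ₀) atTop (nhds 0)
  finerThanVague : ∀ (μ : ℕ → Measure X) (μ₀ : Measure X), (∀ j, memE κ (μ j)) →
    memE κ μ₀ → Tendsto (fun j => sDist κ (μ j) μ₀) atTop (nhds 0) → VagueTendsto μ μ₀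

/-- The domination principle. -/
def Domination (κ : X → X → ℝ≥0∞) : Prop :=
  ∀ μ ν : Measure X, memE κ μ → IsRadon ν →
    (∀ᵐ x ∂μ, potential κ μ x ≤ potential κ ν x) → ∀ x, potential κ μ x ≤ potential κ ν x

/-- `h`-Ugaheri's maximum principle; for `h = 1` this is Frostman's maximum principle. -/
def Ugaheri (κ : X → X → ℝ≥0∞) (h : ℝ) : Prop :=
  ∀ μ : Measure X, memE κ μ → ∀ c : ℝ, 0 < c →
    (∀ᵐ x ∂μ, potential κ μ x ≤ ENNReal.ofReal c) →
    ∀ x, potential κ μ x ≤ ENNReal.ofReal (h * c)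

/-- Condition (R1): the kernel is perfect and satisfies the domination and
`h`-Ugaheri maximum principles for some `h ∈ [1, ∞)`. -/
structure R1 (κ : X → X → ℝ≥0∞) : Prop where
  perfect : Perfect κ
  domination : Domination κ
  ugaheri : ∃ h : ℝ, 1 ≤ h ∧ Ugaheri κ h

/-- Condition (R2): `κ(x,y)` is continuous and finite off the diagonal. -/
def R2 (κ : X → X → ℝ≥0∞) : Prop :=
  ContinuousOn (fun p : X × X => κ p.1 p.2) {p : X × X | p.1 ≠ p.2} ∧
    ∀ x y : X, x ≠ y → κ x y ≠ ⊤

/-- Condition (R3): `κ(·,y) → 0` uniformly on compact sets as `y` tends to the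
Alexandroff point of `X`. -/
def R3 (κ : X → X → ℝ≥0∞) : Prop :=
  ∀ K : Set X, IsCompact K → ∀ ε : ℝ≥0∞, 0 < ε →
    ∃ K' : Set X, IsCompact K' ∧ ∀ y ∉ K', ∀ x ∈ K, κ x y < ε

/-- `μA` is the inner balayage of `ω` onto `A`: it belongs to `E'(A)` and its potential
coincides with that of `ω` nearly everywhere on `A` (up to a set of inner capacity zero). -/
def IsInnerBalayage (κ : X → X → ℝ≥0∞) (A : Set X) (ω μA : Measure X) : Prop :=
  memEClos κ A μA ∧ innerCap κ {x ∈ A | potential κ μA x ≠ potential κ ω x} = 0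

/-- `μA` is the outer balayage of `ω` onto `A`: it belongs to `E'(A)` and its potential
coincides with that of `ω` quasi-everywhere on `A` (up to a set of outer capacity zero). -/
def IsOuterBalayage (κ : X → X → ℝ≥0∞) (A : Set X) (ω μA : Measure X) : Prop :=
  memEClos κ A μA ∧ outerCap κ {x ∈ A | potential κ μA x ≠ potential κ ω x} = 0

/-- Membership in the class `Γ_{A,ω}` of positive finite-energy Radon measures whose
potential dominates that of `ω` nearly everywhere on `A`. -/
def memGamma (κ : X → X → ℝ≥0∞) (A : Set X) (ω ν : Measure X) : Prop :=
  memE κ ν ∧ innerCap κ {x ∈ A | ¬ potential κ ω x ≤ potential κ ν x} = 0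

/-- Euclidean space `ℝⁿ`. -/
abbrev Rn (n : ℕ) := EuclideanSpace ℝ (Fin n)

/-- The α-Riesz kernel `|x-y|^{α-n}` on `ℝⁿ` (with value `∞` on the diagonal). -/
noncomputable def riesz (n : ℕ) (α : ℝ) (x y : Rn n) : ℝ≥0∞ :=
  if x = y then ⊤ else ENNReal.ofReal (‖x - y‖ ^ (α - (n : ℝ)))

/-- `Q ⊆ ℝⁿ` is inner α-thin at infinity:
`Σ_j cp_*(Q_j)/q^{j(n-α)} < ∞` where `Q_j = Q ∩ {q^j ≤ |x| < q^{j+1}}`. -/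
def InnerThinAtInfinity (n : ℕ) (α : ℝ) (Q : Set (Rn n)) : Prop :=
  ∃ q : ℝ, 1 < q ∧
    (∑' j : ℕ, innerCap (riesz n α) (Q ∩ {x : Rn n | q ^ j ≤ ‖x‖ ∧ ‖x‖ < q ^ (j + 1)}) /
      ENNReal.ofReal (q ^ ((j : ℝ) * ((n : ℝ) - α)))) < ⊤

/-- An open set `D ⊆ ℝⁿ` is of class `C^{1,1}`: at each boundary point `y` there are two
open balls of a common radius `r > 0`, one inside `D` and one inside `Dᶜ`, tangent at `y`. -/
def C11 (n : ℕ) (D : Set (Rn n)) : Prop :=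
  ∀ y ∈ frontier D, ∃ (x x' : Rn n) (r : ℝ), 0 < r ∧
    Metric.ball x r ⊆ D ∧ Metric.ball x' r ⊆ Dᶜ ∧ dist y x = r ∧ dist y x' = r

/-- The α-Green kernel of `D`:
`g_α(x,y) = |x-y|^{α-n} - ∫ |x-z|^{α-n} d(ε_y)^{Dᶜ}(z)` for `x,y ∈ D` (extended by `0`
off `D × D`), where `εDc y` is the α-Riesz balayage of the Dirac measure `ε_y` onto `Dᶜ`. -/
noncomputable def green (n : ℕ) (α : ℝ) (D : Set (Rn n)) (εDc : Rn n → Measure (Rn n))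
    (x y : Rn n) : ℝ≥0∞ :=
  if x ∈ D ∧ y ∈ D then riesz n α x y - ∫⁻ z, riesz n α x z ∂(εDc y) else 0



/-- Gaussian semigroup density. -/
noncomputable def gs (n : ℕ) (t : ℝ) (x : Rn n) : ℝ≥0∞ :=
  ENNReal.ofReal ((Real.pi * t) ^ (-(n : ℝ) / 2) * Real.exp (-‖x‖ ^ 2 / t))

lemma gs_meas (n : ℕ) : Measurable (fun p : ℝ × Rn n => gs n p.1 p.2) := by
  unfold gs; fun_prop

lemma gs_meas2 (n : ℕ) {Y : Type*} [MeasurableSpace Y] {f : Y → ℝ} {g : Y → Rn n}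
    (hf : Measurable f) (hg : Measurable g) : Measurable (fun y => gs n (f y) (g y)) :=
  (gs_meas n).comp (hf.prodMk hg)

lemma gs_neg (n : ℕ) (t : ℝ) (x : Rn n) : gs n t (-x) = gs n t x := by
  simp [gs]

lemma gs_sub_comm (n : ℕ) (t : ℝ) (x y : Rn n) : gs n t (x - y) = gs n t (y - x) := by
  rw [← gs_neg, neg_sub]

lemma gs_pos (n : ℕ) {t : ℝ} (ht : 0 < t) (x : Rn n) : 0 < gs n t x := by
  unfold gs
  rw [ENNReal.ofReal_pos]
  have := Real.pi_pos
  positivity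

lemma lintegral_gs (n : ℕ) {t : ℝ} (ht : 0 < t) : ∫⁻ x : Rn n, gs n t x = 1 := by
  have hpi := Real.pi_pos
  have h := GaussianFourier.integral_rexp_neg_mul_sq_norm (V := Rn n) (b := 1 / t) (by positivity)
  have h2 : ∫ x : Rn n, ((Real.pi * t) ^ (-(n : ℝ) / 2) * Real.exp (-‖x‖ ^ 2 / t)) = 1 := by
    rw [integral_const_mul]
    have : (fun x : Rn n => Real.exp (-‖x‖ ^ 2 / t)) = fun x => Real.exp (-(1 / t) * ‖x‖ ^ 2) := by
      funext x; congr 1; ring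
    rw [this, h, finrank_euclideanSpace, Fintype.card_fin]
    rw [show Real.pi / (1 / t) = Real.pi * t by field_simp, ← Real.rpow_add (by positivity)]
    ring_nf; simp
  unfold gs
  rw [← ofReal_integral_eq_lintegral_ofReal, h2, ENNReal.ofReal_one]
  · by_contra hc
    rw [integral_undef hc] at h2
    norm_num at h2
  · exact Eventually.of_forall fun x => by positivity

lemma gs_semigroup (n : ℕ) {s t : ℝ} (hs : 0 < s) (ht : 0 < t) (x y : Rn n) :
    ∫⁻ z : Rn n, gs n s (x - z) * gs n t (z - y) = gs n (s + t) (x - y) := by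
  have hpi := Real.pi_pos
  have key : ∀ z : Rn n, gs n s (x - z) * gs n t (z - y) =
      gs n (s + t) (x - y) * gs n (s * t / (s + t))
        (z - ((t / (s + t)) • x + (s / (s + t)) • y)) := by
    intro z
    unfold gs
    rw [← ENNReal.ofReal_mul (by positivity), ← ENNReal.ofReal_mul (by positivity)]
    congr 1
    rw [mul_mul_mul_comm, mul_mul_mul_comm ((Real.pi * (s + t)) ^ (-(n:ℝ) / 2)), ← Real.exp_add, ← Real.exp_add,
      ← Real.mul_rpow (by positivity) (by positivity),
      ← Real.mul_rpow (by positivity) (by positivity)]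
    congr 2
    · field_simp
    · obtain ⟨a, ha⟩ : ∃ a, a = x - z := ⟨_, rfl⟩
      obtain ⟨b, hb⟩ : ∃ b, b = z - y := ⟨_, rfl⟩
      rw [← ha, ← hb]
      have e1 : x - y = a + b := by rw [ha, hb]; abel
      have e2 : z - ((t / (s + t)) • x + (s / (s + t)) • y) =
          (s / (s + t)) • b - (t / (s + t)) • a := by
        have h1 : (s / (s + t) + t / (s + t)) = 1 := by field_simp
        calc z - ((t / (s + t)) • x + (s / (s + t)) • y)
            = (s / (s + t) + t / (s + t)) • z - ((t / (s + t)) • x + (s / (s + t)) • y) := by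
              rw [h1, one_smul]
          _ = _ := by rw [ha, hb]; simp only [smul_sub, add_smul]; abel
      rw [e1, e2, @norm_add_sq_real, @norm_sub_sq_real]
      simp only [norm_smul, inner_smul_left, inner_smul_right, Real.norm_eq_abs, mul_pow, sq_abs,
        real_inner_comm b a]
      rw [conj_trivial]
      field_simp
      ring
  simp_rw [key]
  rw [lintegral_const_mul]
  · rw [lintegral_sub_right_eq_self (fun z => gs n (s * t / (s + t)) z),
      lintegral_gs n (by positivity), mul_one]
  · exact gs_meas2 n measurable_const (by fun_prop)

/-- time scaling -/
lemma lintegral_Ioi_scale {a : ℝ} (ha : 0 < a) (F : ℝ → ℝ≥0∞) (hF : Measurable F) :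
    ∫⁻ t in Ioi (0:ℝ), F t = ENNReal.ofReal a * ∫⁻ t in Ioi (0:ℝ), F (a * t) := by
  rw [← lintegral_indicator measurableSet_Ioi, ← lintegral_indicator measurableSet_Ioi]
  have h := Real.smul_map_volume_mul_left ha.ne'
  conv_lhs => rw [← h]
  rw [lintegral_smul_measure, abs_of_pos ha, smul_eq_mul, lintegral_map]
  · congr 1
    apply lintegral_congr
    intro t
    simp only [indicator, mem_Ioi, mul_pos_iff_of_pos_left ha]
  · exact hF.indicator measurableSet_Ioi
  · fun_prop

lemma pow_exp_bound {a y : ℝ} (ha : 0 < a) (hy : 0 < y) : y ^ a * Real.exp (-y) ≤ a ^ a := by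
  have h1 : y / a ≤ Real.exp (y / a) := by linarith [Real.add_one_le_exp (y / a)]
  have h2 : (y / a) ^ a ≤ Real.exp y := by
    calc (y / a) ^ a ≤ (Real.exp (y / a)) ^ a := Real.rpow_le_rpow (by positivity) h1 ha.le
      _ = Real.exp y := by rw [← Real.exp_mul]; congr 1; field_simp
  rw [Real.div_rpow hy.le ha.le, div_le_iff₀ (by positivity)] at h2
  rw [Real.exp_neg, ← div_eq_mul_inv, div_le_iff₀ (Real.exp_pos _)]
  linarith

lemma lint_Ioc_rpow {r : ℝ} (h : -1 < r) : ∫⁻ t in Ioc (0:ℝ) 1, ENNReal.ofReal (t ^ r) < ⊤ := by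
  have := (intervalIntegral.intervalIntegrable_rpow' h (a := 0) (b := 1))
  rw [intervalIntegrable_iff_integrableOn_Ioc_of_le zero_le_one] at this
  exact this.lintegral_lt_top

lemma lint_Ioi_rpow {r : ℝ} (h : r < -1) : ∫⁻ t in Ioi (1:ℝ), ENNReal.ofReal (t ^ r) < ⊤ :=
  (integrableOn_Ioi_rpow_of_lt h one_pos).lintegral_lt_top

lemma lint_two {r s : ℝ} (hr : -1 < r) (hs : s < -1) (C : ℝ) (F : ℝ → ℝ≥0∞)
    (h1 : ∀ t, 0 < t → t ≤ 1 → F t ≤ ENNReal.ofReal C * ENNReal.ofReal (t ^ r))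
    (h2 : ∀ t, 1 < t → F t ≤ ENNReal.ofReal C * ENNReal.ofReal (t ^ s)) :
    ∫⁻ t in Ioi (0:ℝ), F t < ⊤ := by
  rw [← Ioc_union_Ioi_eq_Ioi zero_le_one]
  refine (lintegral_union_le _ _ _).trans_lt (ENNReal.add_lt_top.2 ⟨?_, ?_⟩)
  · calc _ ≤ ∫⁻ t in Ioc (0:ℝ) 1, ENNReal.ofReal C * ENNReal.ofReal (t ^ r) :=
          setLIntegral_mono (by fun_prop) (fun t ht => h1 t ht.1 ht.2)
      _ < ⊤ := by
        rw [lintegral_const_mul _ (by fun_prop)]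
        exact ENNReal.mul_lt_top ENNReal.ofReal_lt_top (lint_Ioc_rpow hr)
  · calc _ ≤ ∫⁻ t in Ioi (1:ℝ), ENNReal.ofReal C * ENNReal.ofReal (t ^ s) :=
          setLIntegral_mono (by fun_prop) (fun t ht => h2 t ht)
      _ < ⊤ := by
        rw [lintegral_const_mul _ (by fun_prop)]
        exact ENNReal.mul_lt_top ENNReal.ofReal_lt_top (lint_Ioi_rpow hs)

/-- the constant in the subordination formula -/
noncomputable def cG (n : ℕ) (γ : ℝ) : ℝ≥0∞ :=
  ∫⁻ t in Ioi (0:ℝ), ENNReal.ofReal (t ^ (γ - 1)) *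
    ENNReal.ofReal ((Real.pi * t) ^ (-(n : ℝ) / 2) * Real.exp (-1 / t))

lemma cG_lt_top (n : ℕ) {γ : ℝ} (h : γ < n / 2) : cG n γ < ⊤ := by
  have hpi := Real.pi_pos
  set a : ℝ := (n:ℝ)/2 - γ with ha
  have ha0 : 0 < a := by rw [ha]; linarith
  set C : ℝ := Real.pi ^ (-(n : ℝ) / 2) * max 1 ((a+1) ^ (a+1)) with hC
  refine lint_two (r := 0) (s := γ - 1 - n / 2) (by norm_num) (by linarith) C _ ?_ ?_
  · intro t ht ht1
    rw [← ENNReal.ofReal_mul (by positivity), ← ENNReal.ofReal_mul (by positivity)]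
    apply ENNReal.ofReal_le_ofReal
    rw [Real.mul_rpow hpi.le ht.le, Real.rpow_zero, mul_one, hC]
    have h1 := pow_exp_bound (a := a + 1) (y := 1 / t) (by positivity) (by positivity)
    rw [Real.div_rpow zero_le_one ht.le, Real.one_rpow, one_div, ← Real.rpow_neg ht.le] at h1
    calc t ^ (γ - 1) * (Real.pi ^ (-(n:ℝ) / 2) * t ^ (-(n:ℝ) / 2) * Real.exp (-1 / t))
        = Real.pi ^ (-(n:ℝ) / 2) * (t ^ (γ - 1) * t ^ (-(n:ℝ) / 2) * Real.exp (-1 / t)) := by ring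
      _ = Real.pi ^ (-(n:ℝ) / 2) * (t ^ (-(a+1)) * Real.exp (-1 / t)) := by
          rw [← Real.rpow_add ht]; congr 3; rw [ha]; ring_nf
      _ ≤ _ := by
          apply mul_le_mul_of_nonneg_left _ (by positivity)
          refine le_trans ?_ (le_max_right _ _)
          rw [show -1 / t = -(1 / t) by ring]
          exact h1
  · intro t ht
    have ht0 : 0 < t := by linarith
    rw [← ENNReal.ofReal_mul (by positivity), ← ENNReal.ofReal_mul (by positivity)]
    apply ENNReal.ofReal_le_ofReal
    rw [Real.mul_rpow hpi.le ht0.le, hC]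
    have h1 : Real.exp (-1 / t) ≤ 1 := by
      rw [Real.exp_le_one_iff]; apply div_nonpos_of_nonpos_of_nonneg <;> linarith
    calc t ^ (γ - 1) * (Real.pi ^ (-(n:ℝ) / 2) * t ^ (-(n:ℝ) / 2) * Real.exp (-1 / t))
        = Real.pi ^ (-(n:ℝ) / 2) * Real.exp (-1 / t) * (t ^ (γ - 1) * t ^ (-(n:ℝ) / 2)) := by ring
      _ = Real.pi ^ (-(n:ℝ) / 2) * Real.exp (-1 / t) * t ^ (γ - 1 - n / 2) := by
          rw [← Real.rpow_add ht0]; congr 2; ring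
      _ ≤ _ := by
          gcongr
          exact h1.trans (le_max_left _ _)

lemma cG_pos (n : ℕ) (γ : ℝ) : 0 < cG n γ := by
  have hpi := Real.pi_pos
  unfold cG
  rw [setLIntegral_pos_iff (by fun_prop)]
  have : (Function.support fun t : ℝ => ENNReal.ofReal (t ^ (γ - 1)) *
    ENNReal.ofReal ((Real.pi * t) ^ (-(n : ℝ) / 2) * Real.exp (-1 / t))) ∩ Ioi 0 = Ioi 0 := by
    apply inter_eq_right.2
    intro t ht
    have ht : 0 < t := ht
    rw [Function.mem_support, ← ENNReal.ofReal_mul (by positivity)]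
    apply ne_of_gt
    rw [ENNReal.ofReal_pos]
    positivity
  rw [this]; simp

lemma subordination (n : ℕ) (γ : ℝ) {x : Rn n} (hx : x ≠ 0) :
    ∫⁻ t in Ioi (0:ℝ), ENNReal.ofReal (t ^ (γ - 1)) * gs n t x =
      cG n γ * ENNReal.ofReal (‖x‖ ^ (2 * γ - n)) := by
  have hpi := Real.pi_pos
  have hx' : 0 < ‖x‖ := norm_pos_iff.2 hx
  rw [lintegral_Ioi_scale (a := ‖x‖ ^ 2) (by positivity) _
    (by have := gs_meas2 n measurable_id (measurable_const (a := x)); simp only [id] at this; fun_prop)]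
  unfold cG
  rw [mul_comm, ← lintegral_mul_const' _ _ ENNReal.ofReal_ne_top,
    ← lintegral_mul_const' _ _ ENNReal.ofReal_ne_top]
  apply setLIntegral_congr_fun measurableSet_Ioi
  intro t ht
  have ht : 0 < t := ht
  simp only [gs]
  rw [← ENNReal.ofReal_mul (by positivity), ← ENNReal.ofReal_mul (by positivity),
    ← ENNReal.ofReal_mul (by positivity), ← ENNReal.ofReal_mul (by positivity)]
  congr 1
  have e1 : -‖x‖ ^ 2 / (‖x‖ ^ 2 * t) = -1 / t := by field_simp
  rw [e1, Real.mul_rpow (by positivity) ht.le, show Real.pi * (‖x‖ ^ 2 * t) = ‖x‖ ^ 2 * (Real.pi * t) by ring,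
    Real.mul_rpow (by positivity) (by positivity)]
  have e2 : ‖x‖ ^ (2 * γ - n) = (‖x‖ ^ 2) ^ (γ - 1) * (‖x‖ ^ 2) ^ (-(n:ℝ) / 2) * ‖x‖ ^ 2 := by
    rw [← Real.rpow_natCast ‖x‖ 2, ← Real.rpow_mul hx'.le, ← Real.rpow_mul hx'.le,
      ← Real.rpow_add hx', ← Real.rpow_add hx']
    congr 1; push_cast; ring
  rw [e2]; ring

lemma subordination_zero (n : ℕ) (γ : ℝ)  :
    ∫⁻ t in Ioi (0:ℝ), ENNReal.ofReal (t ^ (γ - 1)) * gs n t 0 = ⊤ := by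
  have hpi := Real.pi_pos
  by_contra hc
  have h1 : IntegrableOn (fun t : ℝ => t ^ (γ - 1 - n / 2)) (Ioi 0) := by
    have hm : AEStronglyMeasurable (fun t : ℝ => t ^ (γ - 1 - n / 2)) (volume.restrict (Ioi 0)) := by
      have : Measurable (fun t : ℝ => t ^ (γ - 1 - n / 2)) := by fun_prop
      exact this.aestronglyMeasurable
    refine (lintegral_ofReal_ne_top_iff_integrable hm ?_).1 ?_
    · filter_upwards [ae_restrict_mem measurableSet_Ioi] with t ht
      have ht : 0 < t := ht
      simp only [Pi.zero_apply]
      positivity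
    · have : ∫⁻ t in Ioi (0:ℝ), ENNReal.ofReal (t ^ (γ - 1 - n / 2)) =
        ENNReal.ofReal (Real.pi ^ ((n:ℝ) / 2)) *
          ∫⁻ t in Ioi (0:ℝ), ENNReal.ofReal (t ^ (γ - 1)) * gs n t 0 := by
        rw [← lintegral_const_mul' _ _ ENNReal.ofReal_ne_top]
        apply setLIntegral_congr_fun measurableSet_Ioi
        intro t ht
        have ht : 0 < t := ht
        simp only [gs]
        rw [← ENNReal.ofReal_mul (by positivity), ← ENNReal.ofReal_mul (by positivity)]
        congr 1
        rw [Real.mul_rpow hpi.le ht.le]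
        simp only [norm_zero]
        rw [show γ - 1 - (n:ℝ)/2 = (γ - 1) + (-(n:ℝ)/2) by ring, Real.rpow_add ht]
        have : Real.pi ^ ((n:ℝ) / 2) * Real.pi ^ (-(n:ℝ) / 2) = 1 := by
          rw [← Real.rpow_add hpi]; ring_nf; simp
        simp
        linear_combination (- t ^ (γ - 1) * t ^ (-(n:ℝ) / 2)) * this
      rw [this]
      exact ENNReal.mul_ne_top ENNReal.ofReal_ne_top hc
  exact not_integrableOn_Ioi_rpow _ h1

/-- mixture of Gaussians -/
noncomputable def Pm (n : ℕ) (f : ℝ → ℝ≥0∞) (x : Rn n) : ℝ≥0∞ := ∫⁻ t, f t * gs n t x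

lemma Pm_meas (n : ℕ) {f : ℝ → ℝ≥0∞} (hf : Measurable f) : Measurable (Pm n f) := by
  unfold Pm
  apply Measurable.lintegral_prod_right' (f := fun p : Rn n × ℝ => f p.2 * gs n p.2 p.1)
  exact (hf.comp measurable_snd).mul (gs_meas2 n measurable_snd measurable_fst)

lemma Pm_neg (n : ℕ) (f : ℝ → ℝ≥0∞) (x : Rn n) : Pm n f (-x) = Pm n f x := by
  simp [Pm, gs_neg]

lemma lintegral_Pm (n : ℕ) {f : ℝ → ℝ≥0∞} (hf : Measurable f) (h0 : ∀ t ≤ 0, f t = 0) :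
    ∫⁻ x, Pm n f x = ∫⁻ t, f t := by
  unfold Pm
  rw [lintegral_lintegral_swap]
  · apply lintegral_congr
    intro t
    rw [lintegral_const_mul _ (show Measurable fun x : Rn n => gs n t x from
      gs_meas2 n measurable_const measurable_id)]
    rcases le_or_gt t 0 with ht | ht
    · rw [h0 t ht, zero_mul]
    · have := lintegral_gs n ht
      rw [this, mul_one]
  · exact ((hf.comp measurable_snd).mul (gs_meas2 n measurable_snd measurable_fst)).aemeasurable

lemma Pm_conv (n : ℕ) {f g : ℝ → ℝ≥0∞} (hf : Measurable f) (hg : Measurable g)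
    (hf0 : ∀ t ≤ 0, f t = 0) (hg0 : ∀ t ≤ 0, g t = 0) (x y : Rn n) :
    ∫⁻ z, Pm n f (x - z) * Pm n g (z - y) = ∫⁻ s, f s * ∫⁻ r, g r * gs n (s + r) (x - y) := by
  have mg : ∀ c : Rn n, Measurable fun t : ℝ => gs n t c := fun c =>
    gs_meas2 n measurable_id measurable_const
  have h1 : ∀ z, Pm n f (x - z) * Pm n g (z - y) =
      ∫⁻ s, f s * gs n s (x - z) * ∫⁻ r, g r * gs n r (z - y) := by
    intro z
    rw [lintegral_mul_const _ (show Measurable fun s => f s * gs n s (x - z) from hf.mul (mg _))]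
    rfl
  simp_rw [h1]
  rw [lintegral_lintegral_swap]
  · apply lintegral_congr
    intro s
    have h2 : ∀ z, f s * gs n s (x - z) * ∫⁻ r, g r * gs n r (z - y) =
        f s * ∫⁻ r, gs n s (x - z) * (g r * gs n r (z - y)) := by
      intro z
      rw [lintegral_const_mul _ (show Measurable fun r => g r * gs n r (z - y) from hg.mul (mg _)),
        mul_assoc]
    simp_rw [h2]
    rw [lintegral_const_mul]
    · rcases le_or_gt s 0 with hs | hs
      · rw [hf0 s hs, zero_mul, zero_mul]
      congr 1
      rw [lintegral_lintegral_swap]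
      · apply lintegral_congr
        intro r
        have h3 : ∀ z, gs n s (x - z) * (g r * gs n r (z - y)) =
          g r * (gs n s (x - z) * gs n r (z - y)) := fun z => by ring
        simp_rw [h3]
        rw [lintegral_const_mul]
        · rcases le_or_gt r 0 with hr | hr
          · rw [hg0 r hr, zero_mul, zero_mul]
          · rw [gs_semigroup n hs hr]
        · exact (gs_meas2 n measurable_const (by fun_prop)).mul
            (gs_meas2 n measurable_const (by fun_prop))
      · exact ((gs_meas2 n measurable_const (by fun_prop)).mul
          ((hg.comp measurable_snd).mul (gs_meas2 n measurable_snd (by fun_prop)))).aemeasurable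
    · apply Measurable.lintegral_prod_right'
        (f := fun p : Rn n × ℝ => gs n s (x - p.1) * (g p.2 * gs n p.2 (p.1 - y)))
      exact ((gs_meas2 n measurable_const (by fun_prop)).mul
          ((hg.comp measurable_snd).mul (gs_meas2 n measurable_snd (by fun_prop))))
  · apply Measurable.aemeasurable
    apply Measurable.mul
    · exact (hf.comp measurable_snd).mul (gs_meas2 n measurable_snd (by fun_prop))
    · have : Measurable fun z : Rn n => ∫⁻ r, g r * gs n r (z - y) :=
        (Pm_meas n hg).comp (measurable_id.sub_const y)
      exact this.comp measurable_fst

lemma Pm_conv' (n : ℕ) {f g : ℝ → ℝ≥0∞} (hf : Measurable f) (hg : Measurable g)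
    (hf0 : ∀ t ≤ 0, f t = 0) (hg0 : ∀ t ≤ 0, g t = 0) (x y : Rn n) :
    ∫⁻ z, Pm n f (x - z) * Pm n g (z - y) =
      Pm n (fun τ => ∫⁻ s, f s * g (τ - s)) (x - y) := by
  rw [Pm_conv n hf hg hf0 hg0]
  unfold Pm
  have mg : ∀ c : Rn n, Measurable fun t : ℝ => gs n t c := fun c =>
    gs_meas2 n measurable_id measurable_const
  have h1 : ∀ s, f s * ∫⁻ r, g r * gs n (s + r) (x - y) =
      ∫⁻ τ, f s * g (τ - s) * gs n τ (x - y) := by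
    intro s
    rw [← lintegral_sub_right_eq_self (fun r => g r * gs n (s + r) (x - y)) s]
    rw [← lintegral_const_mul]
    · apply lintegral_congr; intro τ
      rw [add_sub_cancel, mul_assoc]
    · exact (hg.comp (by fun_prop)).mul ((mg _).comp (by fun_prop))
  simp_rw [h1]
  rw [lintegral_lintegral_swap]
  · apply lintegral_congr; intro τ
    rw [lintegral_mul_const]
    exact hf.mul (hg.comp (by fun_prop))
  · apply Measurable.aemeasurable
    exact ((hf.comp measurable_fst).mul (hg.comp (by fun_prop))).mul
      (gs_meas2 n measurable_snd (by fun_prop))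

lemma lintegral_scale {a : ℝ} (ha : 0 < a) (F : ℝ → ℝ≥0∞) (hF : Measurable F) :
    ∫⁻ t, F t = ENNReal.ofReal a * ∫⁻ t, F (a * t) := by
  have h := Real.smul_map_volume_mul_left ha.ne'
  conv_lhs => rw [← h]
  rw [lintegral_smul_measure, abs_of_pos ha, smul_eq_mul, lintegral_map hF (by fun_prop)]

lemma lintegral_scale_Rn (n : ℕ) {a : ℝ} (ha : 0 < a) (F : Rn n → ℝ≥0∞) (hF : Measurable F) :
    ∫⁻ t, F t = ENNReal.ofReal (a ^ n) * ∫⁻ t, F (a • t) := by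
  have h := Measure.map_addHaar_smul (volume : Measure (Rn n)) ha.ne'
  rw [finrank_euclideanSpace, Fintype.card_fin] at h
  rw [← lintegral_map hF (g := fun t => a • t) (by fun_prop), h, lintegral_smul_measure, smul_eq_mul,
    ← mul_assoc, ← ENNReal.ofReal_mul (by positivity), abs_of_pos (by positivity),
    mul_inv_cancel₀ (by positivity), ENNReal.ofReal_one, one_mul]

lemma gs_scale (n : ℕ) {a t : ℝ} (ha : 0 < a) (ht : 0 < t) (x : Rn n) :
    ENNReal.ofReal (a ^ n) * gs n (a ^ 2 * t) (a • x) = gs n t x := by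
  have hpi := Real.pi_pos
  unfold gs
  rw [← ENNReal.ofReal_mul (by positivity)]
  congr 1
  rw [show Real.pi * (a ^ 2 * t) = a ^ 2 * (Real.pi * t) by ring,
    Real.mul_rpow (by positivity) (by positivity), norm_smul, Real.norm_eq_abs, mul_pow, sq_abs]
  have e1 : -(a ^ 2 * ‖x‖ ^ 2) / (a ^ 2 * t) = -‖x‖ ^ 2 / t := by field_simp
  have e2 : a ^ n * (a ^ 2) ^ (-(n:ℝ) / 2) = 1 := by
    rw [← Real.rpow_natCast a n, ← Real.rpow_natCast a 2, ← Real.rpow_mul ha.le,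
      ← Real.rpow_add ha]
    rw [show (n:ℝ) + ((2:ℕ):ℝ) * (-n / 2) = 0 by push_cast; ring, Real.rpow_zero]
  rw [e1]
  linear_combination ((Real.pi * t) ^ (-(n:ℝ) / 2) * Real.exp (-‖x‖ ^ 2 / t)) * e2

/-- the time functions -/
noncomputable def vv (β : ℝ) (t : ℝ) : ℝ≥0∞ := if 0 < t then ENNReal.ofReal (t ^ (β - 1)) else 0
noncomputable def jj (β ε : ℝ) (t : ℝ) : ℝ≥0∞ := if ε < t then ENNReal.ofReal (t ^ (-1 - β)) else 0
noncomputable def hr (β ε : ℝ) (t : ℝ) : ℝ := ε ^ (-β) / (β * t) * (t ^ β - (max (t - ε) 0) ^ β)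
noncomputable def hh (β ε : ℝ) (t : ℝ) : ℝ≥0∞ := if 0 < t then ENNReal.ofReal (hr β ε t) else 0

lemma vv_meas (β : ℝ) : Measurable (vv β) :=
  Measurable.ite measurableSet_Ioi (by fun_prop) measurable_const
lemma jj_meas (β ε : ℝ) : Measurable (jj β ε) :=
  Measurable.ite measurableSet_Ioi (by fun_prop) measurable_const
lemma hh_meas (β ε : ℝ) : Measurable (hh β ε) :=
  Measurable.ite measurableSet_Ioi (by unfold hr; fun_prop) measurable_const
lemma vv_zero (β : ℝ) : ∀ t ≤ 0, vv β t = 0 := fun t ht => if_neg (not_lt.2 ht)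
lemma jj_zero (β : ℝ) {ε : ℝ} (hε : 0 < ε) : ∀ t ≤ 0, jj β ε t = 0 := fun t ht =>
  if_neg (by linarith)
lemma hh_zero (β ε : ℝ) : ∀ t ≤ 0, hh β ε t = 0 := fun t ht => if_neg (not_lt.2 ht)

lemma hr_nonneg {β ε t : ℝ} (hβ : 0 < β) (hε : 0 < ε) (ht : 0 < t) : 0 ≤ hr β ε t := by
  unfold hr
  apply mul_nonneg (by positivity)
  rw [sub_nonneg]
  exact Real.rpow_le_rpow (le_max_right _ _) (max_le (by linarith) ht.le) hβ.le

lemma time_core {β ε τ : ℝ} (hβ : 0 < β) (hε : 0 < ε) (hτ : ε < τ) :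
    ∫⁻ s, jj β ε s * vv β (τ - s) = ENNReal.ofReal (((τ - ε) / ε) ^ β / (β * τ)) := by
  have h0 : 0 < τ := hε.trans hτ
  have e1 : ∀ s, jj β ε s * vv β (τ - s) =
      (Ioo ε τ).indicator (fun s => ENNReal.ofReal (s ^ (-1 - β) * (τ - s) ^ (β - 1))) s := by
    intro s
    unfold jj vv
    by_cases h1 : ε < s
    · by_cases h2 : 0 < τ - s
      · rw [indicator_of_mem (by constructor <;> linarith), if_pos h1, if_pos h2,
          ENNReal.ofReal_mul (Real.rpow_nonneg (by linarith) _)]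
      · rw [indicator_of_notMem (by rintro ⟨_, h⟩; exact h2 (by linarith)), if_neg h2, mul_zero]
    · rw [indicator_of_notMem (by rintro ⟨h, _⟩; exact h1 h), if_neg h1, zero_mul]
  simp_rw [e1]
  rw [lintegral_indicator measurableSet_Ioo, restrict_Ioo_eq_restrict_Ioc]
  set G : ℝ → ℝ := fun s => -((τ - s) / s) ^ β / (β * τ) with hG
  have hder : ∀ s ∈ Ioo ε τ, HasDerivAt G (s ^ (-1 - β) * (τ - s) ^ (β - 1)) s := by
    intro s hs
    have hs0 : 0 < s := hε.trans hs.1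
    have hs1 : 0 < τ - s := by linarith [hs.2]
    have d1 : HasDerivAt (fun s : ℝ => (τ - s) / s) (((-1) * s - (τ - s) * 1) / s ^ 2) s :=
      ((hasDerivAt_id' s).const_sub τ).div (hasDerivAt_id' s) hs0.ne'
    have d2 := (d1.rpow_const (p := β) (Or.inl (by positivity))).neg.div_const (β * τ)
    refine d2.congr_deriv ?_
    rw [Real.div_rpow hs1.le hs0.le, show s ^ (-1 - β) = (s ^ (β - 1))⁻¹ / s ^ 2 by
      rw [← Real.rpow_neg hs0.le, ← Real.rpow_two, ← Real.rpow_sub hs0]; congr 1; ring]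
    have : s ^ (β - 1) ≠ 0 := by positivity
    field_simp
    ring
  have hcont : ContinuousOn G (Icc ε τ) := by
    apply ContinuousOn.div_const
    apply ContinuousOn.neg
    apply ContinuousOn.rpow_const
    · apply ContinuousOn.div (by fun_prop) (by fun_prop)
      intro s hs; linarith [hs.1]
    · intro s hs; right; exact hβ.le
  have hpos : ∀ s ∈ Ioo ε τ, 0 ≤ s ^ (-1 - β) * (τ - s) ^ (β - 1) := by
    intro s hs
    have hs0 : 0 < s := hε.trans hs.1
    have hs1 : 0 < τ - s := by linarith [hs.2]
    positivity
  have hint := intervalIntegral.integrableOn_deriv_of_nonneg hcont hder hpos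
  have hint2 : IntervalIntegrable (fun s => s ^ (-1 - β) * (τ - s) ^ (β - 1)) volume ε τ := by
    rw [intervalIntegrable_iff_integrableOn_Ioc_of_le hτ.le]; exact hint
  have hv := intervalIntegral.integral_eq_sub_of_hasDerivAt_of_le hτ.le hcont hder hint2
  rw [intervalIntegral.integral_of_le hτ.le] at hv
  rw [← ofReal_integral_eq_lintegral_ofReal hint, hv]
  · congr 1
    simp only [hG, sub_self, zero_div, Real.zero_rpow hβ.ne']
    ring
  · rw [← restrict_Ioo_eq_restrict_Ioc]
    filter_upwards [ae_restrict_mem measurableSet_Ioo] with s hs using hpos s hs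

lemma time_id {β ε : ℝ} (hβ : 0 < β) (hε : 0 < ε) (τ : ℝ) :
    ENNReal.ofReal (ε ^ (-β) / β) * vv β τ = (∫⁻ s, jj β ε s * vv β (τ - s)) + hh β ε τ := by
  rcases le_or_gt τ ε with h | h
  · have : ∀ s, jj β ε s * vv β (τ - s) = 0 := by
      intro s
      unfold jj vv
      by_cases h1 : ε < s
      · rw [if_neg (show ¬ 0 < τ - s by linarith), mul_zero]
      · rw [if_neg h1, zero_mul]
    simp_rw [this]
    rw [lintegral_zero, zero_add]
    unfold vv hh
    split_ifs with h0
    · rw [← ENNReal.ofReal_mul (by positivity)]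
      congr 1
      unfold hr
      rw [max_eq_right (by linarith), Real.zero_rpow hβ.ne', sub_zero, Real.rpow_sub h0, Real.rpow_one]
      field_simp
    · simp
  · have h0 : 0 < τ := hε.trans h
    rw [time_core hβ hε h]
    have hp : 0 < τ - ε := by linarith
    unfold vv hh
    rw [if_pos h0, if_pos h0, ← ENNReal.ofReal_mul (by positivity),
      ← ENNReal.ofReal_add (by positivity) (hr_nonneg hβ hε h0)]
    congr 1
    unfold hr
    rw [max_eq_left hp.le, Real.rpow_sub h0, Real.rpow_one, Real.div_rpow hp.le hε.le,
      Real.rpow_neg hε.le]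
    field_simp
    ring

lemma hr_bound {β ε t : ℝ} (hβ : 0 < β) (hβ1 : β < 1) (hε : 0 < ε) (ht : 0 < t) :
    hr β ε t ≤ ε ^ (1 - β) / β * t ^ (β - 2) := by
  have key : t ^ β - (max (t - ε) 0) ^ β ≤ ε * t ^ (β - 1) := by
    rcases le_or_gt t ε with h | h
    · rw [max_eq_right (by linarith), Real.zero_rpow hβ.ne', sub_zero]
      rw [show t ^ β = t * t ^ (β - 1) by rw [Real.rpow_sub ht, Real.rpow_one]; field_simp]
      gcongr
    · rw [max_eq_left (by linarith)]
      have hx : 0 < (t - ε) / t := div_pos (by linarith) ht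
      have h1 : (t - ε) / t ≤ ((t - ε) / t) ^ β := by
        conv_lhs => rw [← Real.rpow_one ((t - ε) / t)]
        exact Real.rpow_le_rpow_of_exponent_ge hx (by rw [div_le_one ht]; linarith) hβ1.le
      rw [Real.div_rpow (by linarith) ht.le, le_div_iff₀ (by positivity)] at h1
      have h2 : (t - ε) / t * t ^ β = t ^ β - ε * t ^ (β - 1) := by
        rw [Real.rpow_sub ht, Real.rpow_one]; field_simp
      linarith
  unfold hr
  calc ε ^ (-β) / (β * t) * (t ^ β - (max (t - ε) 0) ^ β)
      ≤ ε ^ (-β) / (β * t) * (ε * t ^ (β - 1)) := by gcongr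
    _ = _ := by
      rw [Real.rpow_sub ht, Real.rpow_sub ht, Real.rpow_sub hε, Real.rpow_neg hε.le, Real.rpow_one, Real.rpow_one,
        Real.rpow_two]
      field_simp

lemma hr_le {β ε t : ℝ} (hβ : 0 < β) (hε : 0 < ε) (ht : 0 < t) :
    hr β ε t ≤ ε ^ (-β) / β * t ^ (β - 1) := by
  unfold hr
  calc ε ^ (-β) / (β * t) * (t ^ β - (max (t - ε) 0) ^ β)
      ≤ ε ^ (-β) / (β * t) * t ^ β := by
        gcongr
        have : 0 ≤ (max (t - ε) 0) ^ β := Real.rpow_nonneg (le_max_right _ _) _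
        linarith
    _ = _ := by rw [Real.rpow_sub ht, Real.rpow_one]; field_simp

lemma hr_scale {β ε t : ℝ} (hβ : 0 < β) (hε : 0 < ε) (ht : 0 < t) :
    ε * hr β ε (ε * t) = hr β 1 t := by
  unfold hr
  rw [show max (ε * t - ε) 0 = ε * max (t - 1) 0 by
    rw [mul_max_of_nonneg _ _ hε.le]; ring_nf]
  rw [Real.mul_rpow hε.le ht.le, Real.mul_rpow hε.le (le_max_right _ _), Real.rpow_neg hε.le,
    Real.one_rpow]
  field_simp

lemma hh_scale {β ε : ℝ} (hβ : 0 < β) (hε : 0 < ε) (t : ℝ) :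
    ENNReal.ofReal ε * hh β ε (ε * t) = hh β 1 t := by
  unfold hh
  by_cases ht : 0 < t
  · rw [if_pos (by positivity), if_pos ht, ← ENNReal.ofReal_mul hε.le, hr_scale hβ hε ht]
  · rw [if_neg (by rw [mul_pos_iff_of_pos_left hε]; exact ht), if_neg ht, mul_zero]

lemma lintegral_pos_part {f : ℝ → ℝ≥0∞} (h0 : ∀ t ≤ 0, f t = 0) : ∫⁻ t, f t = ∫⁻ t in Ioi (0:ℝ), f t := by
  rw [← lintegral_indicator measurableSet_Ioi]
  apply lintegral_congr
  intro t
  by_cases ht : 0 < t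
  · rw [indicator_of_mem (by exact ht)]
  · rw [indicator_of_notMem (by exact ht), h0 t (not_lt.1 ht)]

lemma lintegral_hh_one {β : ℝ} (hβ : 0 < β) (hβ1 : β < 1) : ∫⁻ t, hh β 1 t < ⊤ := by
  rw [lintegral_pos_part (hh_zero β 1)]
  refine lint_two (r := β - 1) (s := β - 2) (by linarith) (by linarith) (1 / β) _ ?_ ?_
  · intro t ht _
    unfold hh
    rw [if_pos ht, ← ENNReal.ofReal_mul (by positivity)]
    apply ENNReal.ofReal_le_ofReal
    have := hr_le hβ one_pos ht
    rwa [Real.one_rpow] at this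
  · intro t ht
    have ht : 0 < t := by linarith
    unfold hh
    rw [if_pos ht, ← ENNReal.ofReal_mul (by positivity)]
    apply ENNReal.ofReal_le_ofReal
    have := hr_bound hβ hβ1 one_pos ht
    rwa [Real.one_rpow] at this

lemma lintegral_jj {β ε : ℝ} (hβ : 0 < β) (hε : 0 < ε) :
    ∫⁻ t, jj β ε t = ENNReal.ofReal (ε ^ (-β) / β) := by
  have e1 : ∀ s, jj β ε s = (Ioi ε).indicator (fun s => ENNReal.ofReal (s ^ (-1 - β))) s := by
    intro s; unfold jj; simp [indicator]
  simp_rw [e1]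
  rw [lintegral_indicator measurableSet_Ioi, ← ofReal_integral_eq_lintegral_ofReal
    (integrableOn_Ioi_rpow_of_lt (by linarith) hε), integral_Ioi_rpow_of_lt (by linarith) hε]
  · congr 1
    rw [show -1 - β + 1 = -β by ring]; field_simp
  · filter_upwards [ae_restrict_mem measurableSet_Ioi] with s hs
    have : 0 < s := hε.trans hs
    simp only [Pi.zero_apply]; positivity

/-- The family of approximating operators used in the proof. -/
structure Kit (n : ℕ) (α : ℝ) where
  J : ℕ → Rn n → ℝ≥0∞
  H : ℕ → Rn n → ℝ≥0∞
  m : ℕ → ℝ≥0∞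
  Θ : Measure (Rn n)
  s : ℕ → ℝ
  A : ℝ≥0∞
  e : ℕ → ℝ≥0∞
  s_pos : ∀ j, 0 < s j
  s_lim : Tendsto s atTop (𝓝 0)
  J_meas : ∀ j, Measurable (J j)
  H_meas : ∀ j, Measurable (H j)
  J_neg : ∀ j x, J j (-x) = J j x
  H_neg : ∀ j x, H j (-x) = H j x
  J_pos : ∀ j x, 0 < J j x
  J_mono : Monotone J
  J_int : ∀ j, ∫⁻ x, J j x = m j
  m_top : ∀ j, m j ≠ ⊤
  K2 : ∀ j x y, m j * riesz n α x y = (∫⁻ z, J j (x - z) * riesz n α z y) + H j (x - y)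
  Θ_fin : Θ univ ≠ ⊤
  Θ_open : ∀ U : Set (Rn n), IsOpen U → U.Nonempty → 0 < Θ U
  scal : ∀ j (w : Rn n → ℝ≥0∞), Measurable w → ∀ y,
    ∫⁻ x, H j (x - y) * w x = ∫⁻ u, w (y + s j • u) ∂Θ
  A_top : A ≠ ⊤
  bda : ∀ j x y, ∫⁻ z, H j (x - z) * riesz n α z y ≤ A * riesz n α x y
  limb : ∀ x y, x ≠ y → Tendsto (fun j => ∫⁻ z, H j (x - z) * riesz n α z y) atTop
    (𝓝 (Θ univ * riesz n α x y))
  far : ∀ j x, x ≠ 0 → H j x ≤ e j * ENNReal.ofReal (‖x‖ ^ (α - 2 - n))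
  e_top : ∀ j, e j ≠ ⊤
  e_lim : Tendsto e atTop (𝓝 0)
  PD : ∀ μ ν : Measure (Rn n), SFinite μ → SFinite ν →
    2 * energy (riesz n α) μ ν ≤ energy (riesz n α) μ μ + energy (riesz n α) ν ν

lemma riesz_eq (n : ℕ) {β : ℝ} (hβ : 0 < β) (hβn : β < n / 2) (x y : Rn n) :
    riesz n (2 * β) x y = (cG n β)⁻¹ * Pm n (vv β) (x - y) := by
  have e1 : ∀ v : Rn n, Pm n (vv β) v = ∫⁻ t in Ioi (0:ℝ), ENNReal.ofReal (t ^ (β - 1)) * gs n t v := by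
    intro v
    unfold Pm
    rw [lintegral_pos_part (fun t ht => by rw [vv_zero β t ht, zero_mul])]
    apply setLIntegral_congr_fun measurableSet_Ioi
    intro t ht
    simp only [vv]
    rw [if_pos (show 0 < t from ht)]
  have hc1 := (cG_lt_top n hβn).ne
  have hc2 := (cG_pos n β).ne'
  unfold riesz
  rw [e1]
  split_ifs with h
  · rw [h, sub_self, subordination_zero, ENNReal.mul_top]
    exact ENNReal.inv_ne_zero.2 hc1
  · rw [subordination n β (sub_ne_zero.2 h), ← mul_assoc, ENNReal.inv_mul_cancel hc2 hc1, one_mul]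

lemma riesz_meas (n : ℕ) (α : ℝ) : Measurable (fun p : Rn n × Rn n => riesz n α p.1 p.2) := by
  unfold riesz
  exact Measurable.ite (measurableSet_eq_fun measurable_fst measurable_snd) measurable_const
    (by fun_prop)

lemma riesz_symm (n : ℕ) (α : ℝ) (x y : Rn n) : riesz n α x y = riesz n α y x := by
  unfold riesz
  simp only [eq_comm (a := x), norm_sub_rev x y]

/-- pointwise bound for the Gaussian kernel -/
noncomputable def Kb (n : ℕ) : ℝ := Real.pi ^ (-(n:ℝ) / 2) * max 1 (((n:ℝ)/2) ^ ((n:ℝ)/2))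

lemma gs_bound (n : ℕ) (hn : 0 < n) {r T : ℝ} (hr : 0 < r) (hT : r ≤ T) {v : Rn n} (hv : v ≠ 0) :
    gs n T v ≤ ENNReal.ofReal (Kb n * min (r ^ (-(n:ℝ)/2)) (‖v‖ ^ (-(n:ℝ)))) := by
  have hpi := Real.pi_pos
  have hv' : 0 < ‖v‖ := norm_pos_iff.2 hv
  have hT0 : 0 < T := hr.trans_le hT
  have hn' : (0:ℝ) < n := by exact_mod_cast hn
  unfold gs Kb
  apply ENNReal.ofReal_le_ofReal
  rw [Real.mul_rpow hpi.le hT0.le, mul_assoc, mul_assoc]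
  apply mul_le_mul_of_nonneg_left _ (by positivity)
  rw [mul_min_of_nonneg _ _ (by positivity)]
  apply le_min
  · have h1 : T ^ (-(n:ℝ)/2) ≤ r ^ (-(n:ℝ)/2) :=
      Real.rpow_le_rpow_of_nonpos hr hT (by linarith)
    have h2 : Real.exp (-‖v‖^2 / T) ≤ 1 := by
      rw [Real.exp_le_one_iff]; apply div_nonpos_of_nonpos_of_nonneg _ hT0.le; nlinarith
    calc _ ≤ r ^ (-(n:ℝ)/2) * 1 := by gcongr
      _ ≤ _ := by
        rw [mul_comm]; gcongr; exact le_max_left _ _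
  · have h1 := pow_exp_bound (a := (n:ℝ)/2) (y := ‖v‖^2 / T) (by positivity) (by positivity)
    have e1 : (‖v‖^2/T) ^ ((n:ℝ)/2) = ‖v‖ ^ (n:ℝ) * T ^ (-(n:ℝ)/2) := by
      rw [Real.div_rpow (by positivity) hT0.le, ← Real.rpow_two, ← Real.rpow_mul hv'.le,
        neg_div, Real.rpow_neg hT0.le, div_eq_mul_inv]
      congr 2; ring
    rw [e1] at h1
    rw [Real.rpow_neg hv'.le, ← div_eq_mul_inv, le_div_iff₀ (by positivity)]
    calc _ = ‖v‖ ^ (n:ℝ) * T ^ (-(n:ℝ)/2) * Real.exp (-(‖v‖^2/T)) := by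
          rw [neg_div]; ring_nf
      _ ≤ _ := h1.trans (le_max_right _ _)

noncomputable def C1 (n : ℕ) (β : ℝ) : ℝ≥0∞ :=
  ∫⁻ r in Ioi (0:ℝ), ENNReal.ofReal (r ^ (β - 1)) * ENNReal.ofReal (Kb n * min (r ^ (-(n:ℝ)/2)) 1)

lemma Kb_pos (n : ℕ) : 0 < Kb n := by
  have hpi := Real.pi_pos
  unfold Kb
  have : (0:ℝ) < max 1 (((n:ℝ)/2) ^ ((n:ℝ)/2)) := lt_max_of_lt_left one_pos
  positivity

lemma C1_top (n : ℕ) {β : ℝ} (hβ : 0 < β) (hβn : β < n / 2) : C1 n β < ⊤ := by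
  have hK := Kb_pos n
  refine lint_two (r := β - 1) (s := β - 1 - n / 2) (by linarith) (by linarith) (Kb n) _ ?_ ?_
  · intro r hr _
    rw [mul_comm]
    gcongr
    calc _ ≤ Kb n * 1 := by gcongr; exact min_le_right _ _
      _ = _ := mul_one _
  · intro r hr
    have hr : 0 < r := by linarith
    rw [← ENNReal.ofReal_mul (by positivity), ← ENNReal.ofReal_mul (by positivity)]
    apply ENNReal.ofReal_le_ofReal
    calc _ ≤ r ^ (β - 1) * (Kb n * r ^ (-(n:ℝ)/2)) := by gcongr; exact min_le_left _ _
      _ = Kb n * (r ^ (β - 1) * r ^ (-(n:ℝ)/2)) := by ring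
      _ = _ := by rw [← Real.rpow_add hr]; congr 2; ring

lemma dom_int (n : ℕ) (β : ℝ) {v : Rn n} (hv : v ≠ 0) :
    ∫⁻ r, vv β r * ENNReal.ofReal (Kb n * min (r ^ (-(n:ℝ)/2)) (‖v‖ ^ (-(n:ℝ)))) =
      C1 n β * ENNReal.ofReal (‖v‖ ^ (2 * β - n)) := by
  have hv' : 0 < ‖v‖ := norm_pos_iff.2 hv
  have hK := Kb_pos n
  rw [lintegral_pos_part (fun t ht => by rw [vv_zero β t ht, zero_mul]),
    lintegral_Ioi_scale (a := ‖v‖ ^ 2) (by positivity) _ ((vv_meas β).fun_mul (by fun_prop))]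
  unfold C1
  rw [mul_comm, ← lintegral_mul_const' _ _ ENNReal.ofReal_ne_top,
    ← lintegral_mul_const' _ _ ENNReal.ofReal_ne_top]
  apply setLIntegral_congr_fun measurableSet_Ioi
  intro r hr
  have hr : 0 < r := hr
  simp only [vv]
  rw [if_pos (by positivity), ← ENNReal.ofReal_mul (by positivity),
    ← ENNReal.ofReal_mul (by positivity), ← ENNReal.ofReal_mul (by positivity),
    ← ENNReal.ofReal_mul (by positivity)]
  congr 1
  have e0 : (‖v‖ ^ 2) ^ (-(n:ℝ)/2) = ‖v‖ ^ (-(n:ℝ)) := by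
    rw [← Real.rpow_two, ← Real.rpow_mul hv'.le]; congr 1; ring
  have e1 : min ((‖v‖ ^ 2 * r) ^ (-(n:ℝ)/2)) (‖v‖ ^ (-(n:ℝ))) =
      ‖v‖ ^ (-(n:ℝ)) * min (r ^ (-(n:ℝ)/2)) 1 := by
    rw [mul_min_of_nonneg _ _ (by positivity), Real.mul_rpow (by positivity) hr.le, e0, mul_one]
  have e2 : ‖v‖ ^ (2 * β - n) = (‖v‖ ^ 2) ^ (β - 1) * ‖v‖ ^ (-(n:ℝ)) * ‖v‖ ^ 2 := by
    rw [← Real.rpow_two, ← Real.rpow_mul hv'.le, ← Real.rpow_add hv', ← Real.rpow_add hv']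
    congr 1; ring
  rw [e1, e2, Real.mul_rpow (by positivity) hr.le]
  ring

lemma gs_tendsto (n : ℕ) {r : ℝ} (hr : 0 < r) (v : Rn n) :
    Tendsto (fun T => gs n T v) (𝓝 r) (𝓝 (gs n r v)) := by
  have hpi := Real.pi_pos
  have : ContinuousAt (fun T => gs n T v) r := by
    unfold gs
    apply ENNReal.continuous_ofReal.continuousAt.comp
    apply ContinuousAt.mul
    · apply ContinuousAt.rpow_const (by fun_prop)
      left; positivity
    · apply Real.continuous_exp.continuousAt.comp
      apply ContinuousAt.div (by fun_prop) (by fun_prop) hr.ne'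
  exact this

/-- B function: the Gaussian average of the potential -/
noncomputable def Bf (n : ℕ) (β σ : ℝ) (v : Rn n) : ℝ≥0∞ := ∫⁻ r, vv β r * gs n (σ + r) v

lemma Bf_bound (n : ℕ) (hn : 0 < n) (β : ℝ) {σ : ℝ} (hσ : 0 ≤ σ) {v : Rn n} (hv : v ≠ 0) :
    Bf n β σ v ≤ C1 n β * ENNReal.ofReal (‖v‖ ^ (2 * β - n)) := by
  rw [← dom_int n β hv]
  unfold Bf
  apply lintegral_mono
  intro r
  rcases le_or_gt r 0 with h | h
  · simp [vv_zero β r h]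
  · simp only
    gcongr
    exact gs_bound n hn h (by linarith) hv

lemma Bf_meas (n : ℕ) (β : ℝ) (v : Rn n) : Measurable (fun σ => Bf n β σ v) := by
  unfold Bf
  apply Measurable.lintegral_prod_right' (f := fun p : ℝ × ℝ => vv β p.2 * gs n (p.1 + p.2) v)
  exact ((vv_meas β).comp measurable_snd).fun_mul (gs_meas2 n (by fun_prop) (by fun_prop))

lemma Bf_tendsto (n : ℕ) (hn : 0 < n) {β : ℝ} (hβ : 0 < β) (hβn : β < n / 2) {v : Rn n} (hv : v ≠ 0)
    {σ : ℕ → ℝ} (hσ : ∀ j, 0 ≤ σ j) (hl : Tendsto σ atTop (𝓝 0)) :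
    Tendsto (fun j => Bf n β (σ j) v) atTop (𝓝 (Pm n (vv β) v)) := by
  unfold Bf Pm
  apply tendsto_lintegral_of_dominated_convergence
    (fun r => vv β r * ENNReal.ofReal (Kb n * min (r ^ (-(n:ℝ)/2)) (‖v‖ ^ (-(n:ℝ)))))
  · intro j; exact (vv_meas β).fun_mul (gs_meas2 n (by fun_prop) (by fun_prop))
  · intro j
    refine Eventually.of_forall fun r => ?_
    rcases le_or_gt r 0 with h | h
    · simp [vv_zero β r h]
    · simp only
      gcongr
      exact gs_bound n hn h (by linarith [hσ j]) hv
  · rw [dom_int n β hv]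
    exact ENNReal.mul_ne_top (C1_top n hβ hβn).ne ENNReal.ofReal_ne_top
  · refine Eventually.of_forall fun r => ?_
    rcases le_or_gt r 0 with h | h
    · simp [vv_zero β r h]
    · apply ENNReal.Tendsto.const_mul
      · have h2 : Tendsto (fun j => σ j + r) atTop (𝓝 r) := by
          simpa using hl.add_const r
        exact (gs_tendsto n h v).comp h2
      · right; unfold vv; split_ifs <;> simp

lemma HV_eq (n : ℕ) {β ε : ℝ} (hβ : 0 < β) (hε : 0 < ε) (x y : Rn n) :
    ∫⁻ z, Pm n (hh β ε) (x - z) * Pm n (vv β) (z - y) =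
      ∫⁻ σ, hh β 1 σ * Bf n β (ε * σ) (x - y) := by
  rw [Pm_conv n (hh_meas _ _) (vv_meas _) (hh_zero _ _) (vv_zero _)]
  change ∫⁻ s, hh β ε s * Bf n β s (x - y) = _
  rw [lintegral_scale hε _ ((hh_meas _ _).fun_mul (Bf_meas n β _)), ← lintegral_const_mul']
  · apply lintegral_congr
    intro σ
    rw [← mul_assoc, hh_scale hβ hε]
  · exact ENNReal.ofReal_ne_top

lemma PD_lemma (n : ℕ) {β : ℝ} (hβ : 0 < β) (hβn : β < n / 2) (μ ν : Measure (Rn n))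
    [SFinite μ] [SFinite ν] :
    2 * energy (riesz n (2 * β)) μ ν ≤
      energy (riesz n (2 * β)) μ μ + energy (riesz n (2 * β)) ν ν := by
  set Γ : Measure (Rn n) → ℝ × Rn n → ℝ≥0∞ := fun ρ p => ∫⁻ x, gs n (p.1 / 2) (x - p.2) ∂ρ with hΓ
  have mΓ : ∀ ρ : Measure (Rn n), SFinite ρ → Measurable (Γ ρ) := by
    intro ρ hρ
    apply Measurable.lintegral_prod_right'
      (f := fun q : (ℝ × Rn n) × Rn n => gs n (q.1.1 / 2) (q.2 - q.1.2))
    exact gs_meas2 n (by fun_prop) (by fun_prop)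
  have rep : ∀ ρ τ : Measure (Rn n), SFinite ρ → SFinite τ → energy (riesz n (2 * β)) ρ τ =
      (cG n β)⁻¹ * ∫⁻ p : ℝ × Rn n, vv β p.1 * (Γ ρ p * Γ τ p) := by
    intro ρ τ hρ hτ
    unfold energy potential
    have hc : (cG n β)⁻¹ ≠ ⊤ := ENNReal.inv_ne_top.2 (cG_pos n β).ne'
    have s1 : ∀ x y : Rn n, riesz n (2 * β) x y = (cG n β)⁻¹ *
        ∫⁻ p : ℝ × Rn n, vv β p.1 * (gs n (p.1 / 2) (x - p.2) * gs n (p.1 / 2) (y - p.2)) := by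
      intro x y
      rw [riesz_eq n hβ hβn, Measure.volume_eq_prod, lintegral_prod]
      · congr 1
        unfold Pm
        apply lintegral_congr
        intro t
        simp only
        rw [lintegral_const_mul]
        · rcases le_or_gt t 0 with h | h
          · rw [vv_zero β t h, zero_mul, zero_mul]
          · congr 1
            have := gs_semigroup n (half_pos h) (half_pos h) x y
            rw [add_halves] at this
            rw [← this]
            apply lintegral_congr; intro z
            rw [gs_sub_comm n _ z y]
        · exact (gs_meas2 n (by fun_prop) (by fun_prop)).fun_mul (gs_meas2 n (by fun_prop) (by fun_prop))
      · exact (((vv_meas β).comp measurable_fst).fun_mul ((gs_meas2 n (by fun_prop) (by fun_prop)).mul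
          (gs_meas2 n (by fun_prop) (by fun_prop)))).aemeasurable
    simp_rw [s1]
    have s2 : ∀ x : Rn n, ∫⁻ y, ((cG n β)⁻¹ * ∫⁻ p : ℝ × Rn n, vv β p.1 *
        (gs n (p.1 / 2) (x - p.2) * gs n (p.1 / 2) (y - p.2))) ∂τ =
        (cG n β)⁻¹ * ∫⁻ p : ℝ × Rn n, vv β p.1 * (gs n (p.1 / 2) (x - p.2) * Γ τ p) := by
      intro x
      rw [lintegral_const_mul' _ _ hc]
      congr 1
      rw [lintegral_lintegral_swap]
      · apply lintegral_congr; intro p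
        rw [lintegral_const_mul, lintegral_const_mul]
        · exact gs_meas2 n (by fun_prop) (by fun_prop)
        · exact measurable_const.fun_mul (gs_meas2 n (by fun_prop) (by fun_prop))
      · exact (((vv_meas β).comp (by fun_prop : Measurable _)).fun_mul ((gs_meas2 n (by fun_prop) (by fun_prop)).mul
          (gs_meas2 n (by fun_prop) (by fun_prop)))).aemeasurable
    simp_rw [s2]
    rw [lintegral_const_mul' _ _ hc]
    congr 1
    rw [lintegral_lintegral_swap]
    · apply lintegral_congr; intro p
      rw [lintegral_const_mul, lintegral_mul_const]
      · exact gs_meas2 n (by fun_prop) (by fun_prop)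
      · exact (gs_meas2 n (by fun_prop) (by fun_prop)).fun_mul measurable_const
    · exact (((vv_meas β).comp (by fun_prop : Measurable _)).fun_mul ((gs_meas2 n (by fun_prop) (by fun_prop)).mul
          ((mΓ τ hτ).comp measurable_snd))).aemeasurable
  rw [rep μ ν inferInstance inferInstance, rep μ μ inferInstance inferInstance,
    rep ν ν inferInstance inferInstance, ← mul_add, mul_left_comm]
  gcongr
  have mv : Measurable fun p : ℝ × Rn n => vv β p.1 := (vv_meas β).comp measurable_fst
  rw [← lintegral_const_mul' _ _ (by norm_num), ← lintegral_add_left (mv.fun_mul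
    ((mΓ μ inferInstance).fun_mul (mΓ μ inferInstance)))]
  apply lintegral_mono
  intro p
  have amgm : ∀ a b : ℝ≥0∞, 2 * (a * b) ≤ a * a + b * b := by
    intro a b
    have : ∀ a b : ℝ≥0∞, a ≤ b → 2 * (a * b) ≤ a * a + b * b := by
      intro a b hab
      obtain ⟨d, rfl⟩ := exists_add_of_le hab
      calc 2 * (a * (a + d)) ≤ 2 * (a * (a + d)) + d * d := le_self_add
        _ = _ := by ring
    rcases le_total a b with h | h
    · exact this a b h
    · rw [mul_comm a b, add_comm]; exact this b a h
  simp only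
  calc _ = vv β p.1 * (2 * (Γ μ p * Γ ν p)) := by ring
    _ ≤ vv β p.1 * (Γ μ p * Γ μ p + Γ ν p * Γ ν p) := by gcongr; exact amgm _ _
    _ = _ := by ring

theorem exists_kit (n : ℕ) (hn : 0 < n) {α : ℝ} (h0 : 0 < α) (h2 : α < 2) (hαn : α < n) :
    Nonempty (Kit n α) := by
  obtain ⟨β, rfl⟩ : ∃ β, α = 2 * β := ⟨α / 2, by ring⟩
  have hβ : 0 < β := by linarith
  have hβ1 : β < 1 := by linarith
  have hβn : β < n / 2 := by linarith
  set s : ℕ → ℝ := fun j => 1 / ((j:ℝ) + 1) with hs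
  have spos : ∀ j, 0 < s j := fun j => by simp only [hs]; positivity
  have slim : Tendsto s atTop (𝓝 0) := tendsto_one_div_add_atTop_nhds_zero_nat
  have santi : Antitone s := by
    intro i j hij
    simp only [hs]
    have : (i:ℝ) ≤ j := by exact_mod_cast hij
    gcongr
  set C0 : ℝ≥0∞ := (cG n β)⁻¹ with hC0
  have hC0t : C0 ≠ ⊤ := ENNReal.inv_ne_top.2 (cG_pos n β).ne'
  have hC00 : C0 ≠ 0 := ENNReal.inv_ne_zero.2 (cG_lt_top n hβn).ne
  set ε : ℕ → ℝ := fun j => s j ^ 2 with hεd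
  have εpos : ∀ j, 0 < ε j := fun j => by simp only [hεd]; have := spos j; positivity
  have εlim : Tendsto ε atTop (𝓝 0) := by simpa using slim.pow 2
  have mg : ∀ c : Rn n, Measurable fun t : ℝ => gs n t c := fun c =>
    gs_meas2 n measurable_id measurable_const
  have HVC : ∀ j x y, ∫⁻ z, C0 * Pm n (hh β (ε j)) (x - z) * riesz n (2 * β) z y =
      C0 * (C0 * ∫⁻ σ, hh β 1 σ * Bf n β (ε j * σ) (x - y)) := by
    intro j x y
    rw [← HV_eq n hβ (εpos j), ← lintegral_const_mul' _ _ hC0t, ← lintegral_const_mul' _ _ hC0t]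
    apply lintegral_congr; intro z
    rw [riesz_eq n hβ hβn]; ring
  have Θuniv : (volume.withDensity (fun u : Rn n => C0 * Pm n (hh β 1) u)) univ =
      C0 * ∫⁻ t, hh β 1 t := by
    rw [withDensity_apply _ MeasurableSet.univ, Measure.restrict_univ,
      lintegral_const_mul' _ _ hC0t, lintegral_Pm n (hh_meas _ _) (hh_zero _ _)]
  refine ⟨{ J := fun j => Pm n (jj β (ε j)), H := fun j x => C0 * Pm n (hh β (ε j)) x,
            m := fun j => ENNReal.ofReal ((ε j) ^ (-β) / β),
            Θ := volume.withDensity (fun u => C0 * Pm n (hh β 1) u), s := s,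
            A := C0 * (C0 * (C1 n β * ∫⁻ t, hh β 1 t)) + 1,
            e := fun j => C0 * (ENNReal.ofReal ((ε j) ^ (1 - β) / β) * cG n (β - 1)),
            s_pos := spos, s_lim := slim, J_meas := fun j => Pm_meas n (jj_meas _ _),
            H_meas := fun j => measurable_const.fun_mul (Pm_meas n (hh_meas _ _)),
            J_neg := fun j x => Pm_neg n _ x,
            H_neg := fun j x => by simp only [Pm_neg],
            m_top := fun j => ENNReal.ofReal_ne_top,
            J_int := fun j => by
              rw [lintegral_Pm n (jj_meas _ _) (jj_zero _ (εpos j)), lintegral_jj hβ (εpos j)],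
            PD := fun μ ν h1 h2 => PD_lemma n hβ hβn μ ν,
            J_pos := ?_, J_mono := ?_, K2 := ?_, Θ_fin := ?_, Θ_open := ?_, scal := ?_,
            A_top := ?_, bda := ?_, limb := ?_, far := ?_, e_top := ?_, e_lim := ?_ }⟩
  · -- J_pos
    intro j x
    unfold Pm
    rw [lintegral_pos_iff_support ((jj_meas _ _).fun_mul (mg x))]
    have : Ioi (ε j) ⊆ Function.support fun t => jj β (ε j) t * gs n t x := by
      intro t ht
      have ht : ε j < t := ht
      have ht0 : 0 < t := (εpos j).trans ht
      simp only [Function.mem_support]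
      apply (ENNReal.mul_pos _ (gs_pos n ht0 x).ne').ne'
      unfold jj
      rw [if_pos ht]
      apply ne_of_gt
      rw [ENNReal.ofReal_pos]; positivity
    exact lt_of_lt_of_le (by simp) (measure_mono this)
  · -- J_mono
    intro i j hij x
    simp only [Pm]
    apply lintegral_mono
    intro t
    simp only
    gcongr
    unfold jj
    have : ε j ≤ ε i := by
      simp only [hεd]; have := santi hij; have := (spos j).le; gcongr
    by_cases h : ε i < t
    · rw [if_pos h, if_pos (by linarith)]
    · rw [if_neg h]; exact zero_le
  · -- K2
    intro j x y
    have e1 : ∫⁻ z, Pm n (jj β (ε j)) (x - z) * riesz n (2 * β) z y =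
        C0 * ∫⁻ z, Pm n (jj β (ε j)) (x - z) * Pm n (vv β) (z - y) := by
      rw [← lintegral_const_mul' _ _ hC0t]
      apply lintegral_congr; intro z
      rw [riesz_eq n hβ hβn]; ring
    rw [e1, Pm_conv' n (jj_meas _ _) (vv_meas _) (jj_zero _ (εpos j)) (vv_zero _),
      riesz_eq n hβ hβn, ← mul_add, mul_left_comm]
    congr 1
    unfold Pm
    rw [← lintegral_const_mul' _ _ ENNReal.ofReal_ne_top, ← lintegral_add_right]
    · apply lintegral_congr
      intro t
      rw [← mul_assoc, time_id hβ (εpos j), add_mul]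
    · exact (hh_meas _ _).fun_mul (mg _)
  · -- Θ_fin
    rw [Θuniv]
    exact ENNReal.mul_ne_top hC0t (lintegral_hh_one hβ hβ1).ne
  · -- Θ_open
    intro U hU hne
    rw [withDensity_apply _ hU.measurableSet, setLIntegral_pos_iff
      (measurable_const.fun_mul (Pm_meas n (hh_meas _ _)))]
    have : (Function.support fun u => C0 * Pm n (hh β 1) u) ∩ U = U := by
      apply inter_eq_right.2
      intro x _
      simp only [Function.mem_support]
      apply mul_ne_zero hC00
      apply ne_of_gt
      unfold Pm
      rw [lintegral_pos_iff_support ((hh_meas _ _).fun_mul (mg x))]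
      have : Ioo (0:ℝ) 1 ⊆ Function.support fun t => hh β 1 t * gs n t x := by
        intro t ht
        have ht0 : 0 < t := ht.1
        have ht1 : t < 1 := ht.2
        simp only [Function.mem_support]
        apply (ENNReal.mul_pos _ (gs_pos n ht0 x).ne').ne'
        unfold hh
        rw [if_pos ht0]
        apply ne_of_gt
        rw [ENNReal.ofReal_pos]
        unfold hr
        rw [max_eq_right (by linarith), Real.zero_rpow hβ.ne', sub_zero]
        positivity
      exact lt_of_lt_of_le (by simp) (measure_mono this)
    rw [this]
    exact hU.measure_pos _ hne
  · -- scal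
    intro j w hw y
    have mH : ∀ ε, Measurable (Pm n (hh β ε)) := fun ε => Pm_meas n (hh_meas _ _)
    rw [lintegral_withDensity_eq_lintegral_mul _ (measurable_const.fun_mul (mH 1))
      (show Measurable fun u => w (y + s j • u) from hw.comp (by fun_prop))]
    rw [← lintegral_add_right_eq_self _ y, lintegral_scale_Rn n (spos j), ← lintegral_const_mul']
    · apply lintegral_congr
      intro u
      simp only [Pi.mul_apply, add_sub_cancel_right]
      have : ENNReal.ofReal (s j ^ n) * Pm n (hh β (ε j)) (s j • u) = Pm n (hh β 1) u := by
        unfold Pm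
        rw [lintegral_scale (εpos j), ← lintegral_const_mul', ← lintegral_const_mul']
        · apply lintegral_congr
          intro t
          rcases le_or_gt t 0 with ht | ht
          · rw [hh_zero β 1 t ht, hh_zero β (ε j) (ε j * t)
              (mul_nonpos_of_nonneg_of_nonpos (εpos j).le ht)]
            simp
          · rw [← hh_scale hβ (εpos j), ← gs_scale n (spos j) ht]
            simp only [hεd]; ring
        · exact ENNReal.ofReal_ne_top
        · exact ENNReal.ofReal_ne_top
        · exact (hh_meas _ _).fun_mul (mg _)
      rw [← this, add_comm y]; ring
    · exact ENNReal.ofReal_ne_top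
    · have h1 := (mH (ε j)); fun_prop
  · -- A_top
    refine ENNReal.add_ne_top.2 ⟨?_, by simp⟩
    exact ENNReal.mul_ne_top hC0t (ENNReal.mul_ne_top hC0t (ENNReal.mul_ne_top (C1_top n hβ hβn).ne
      (lintegral_hh_one hβ hβ1).ne))
  · -- bda
    intro j x y
    by_cases hxy : x = y
    · have : riesz n (2 * β) x y = ⊤ := by simp [riesz, hxy]
      rw [this, ENNReal.mul_top (by simp)]
      exact le_top
    · rw [HVC]
      have hv : x - y ≠ 0 := sub_ne_zero.2 hxy
      have : riesz n (2 * β) x y = ENNReal.ofReal (‖x - y‖ ^ (2 * β - n)) := by simp [riesz, hxy]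
      rw [this]
      calc _ ≤ C0 * (C0 * ∫⁻ σ, hh β 1 σ * (C1 n β * ENNReal.ofReal (‖x - y‖ ^ (2 * β - n)))) := by
            refine mul_le_mul_right (mul_le_mul_right (lintegral_mono fun σ => ?_) _) _
            rcases le_or_gt σ 0 with h | h
            · simp [hh_zero β 1 σ h]
            · refine mul_le_mul_right ?_ _
              exact Bf_bound n hn β (by have := (εpos j); positivity) hv
        _ = C0 * (C0 * (C1 n β * ∫⁻ t, hh β 1 t)) * ENNReal.ofReal (‖x - y‖ ^ (2 * β - n)) := by
            rw [lintegral_mul_const _ (hh_meas _ _)]; ring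
        _ ≤ _ := by gcongr; exact le_self_add
  · -- limb
    intro x y hxy
    have hv : x - y ≠ 0 := sub_ne_zero.2 hxy
    simp only [HVC]
    rw [Θuniv, riesz_eq n hβ hβn]
    rw [show C0 * ∫⁻ t, hh β 1 t = ∫⁻ t, hh β 1 t * C0 by
      rw [lintegral_mul_const _ (hh_meas _ _), mul_comm], lintegral_mul_const _ (hh_meas _ _)]
    have : (∫⁻ t, hh β 1 t) * C0 * (C0 * Pm n (vv β) (x - y)) =
        C0 * (C0 * ∫⁻ σ, hh β 1 σ * Pm n (vv β) (x - y)) := by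
      rw [lintegral_mul_const _ (hh_meas _ _)]; ring
    rw [← hC0, this]
    refine ENNReal.Tendsto.const_mul (ENNReal.Tendsto.const_mul ?_ (Or.inr hC0t)) (Or.inr hC0t)
    apply tendsto_lintegral_of_dominated_convergence
      (fun σ => hh β 1 σ * (C1 n β * ENNReal.ofReal (‖x - y‖ ^ (2 * β - n))))
    · intro j; exact (hh_meas _ _).fun_mul ((Bf_meas n β _).comp (by fun_prop))
    · intro j
      refine Eventually.of_forall fun σ => ?_
      rcases le_or_gt σ 0 with h | h
      · simp [hh_zero β 1 σ h]
      · simp only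
        gcongr
        exact Bf_bound n hn β (by have := (εpos j); positivity) hv
    · rw [lintegral_mul_const _ (hh_meas _ _)]
      exact ENNReal.mul_ne_top (lintegral_hh_one hβ hβ1).ne
        (ENNReal.mul_ne_top (C1_top n hβ hβn).ne ENNReal.ofReal_ne_top)
    · refine Eventually.of_forall fun σ => ?_
      rcases le_or_gt σ 0 with h | h
      · simp [hh_zero β 1 σ h]
      · apply ENNReal.Tendsto.const_mul
        · apply Bf_tendsto n hn hβ hβn hv
          · intro j; have := (εpos j); positivity
          · simpa using εlim.mul_const σ
        · right; unfold hh; split_ifs <;> simp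
  · -- far
    intro j x hx
    have h1 := subordination n (β - 1) hx
    have : (2 * β - 2 - (n:ℝ)) = 2 * (β - 1) - n := by ring
    rw [this, mul_assoc, mul_assoc, ← h1, ← lintegral_const_mul' _ _ ENNReal.ofReal_ne_top]
    gcongr
    unfold Pm
    rw [lintegral_pos_part (fun t ht => by rw [hh_zero _ _ t ht, zero_mul])]
    apply setLIntegral_mono' measurableSet_Ioi
    intro t ht
    have ht : 0 < t := ht
    rw [← mul_assoc]
    gcongr
    unfold hh
    rw [if_pos ht, ← ENNReal.ofReal_mul (by have := εpos j; positivity)]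
    apply ENNReal.ofReal_le_ofReal
    rw [show β - 1 - 1 = β - 2 by ring]
    exact hr_bound hβ hβ1 (εpos j) ht
  · -- e_top
    intro j
    exact ENNReal.mul_ne_top hC0t (ENNReal.mul_ne_top ENNReal.ofReal_ne_top
      (cG_lt_top n (by have : (0:ℝ) ≤ n := by positivity
                       linarith)).ne)
  · -- e_lim
    have hcg : cG n (β - 1) ≠ ⊤ := (cG_lt_top n (by have : (0:ℝ) ≤ n := by positivity
                                                    linarith)).ne
    have : Tendsto (fun j => ENNReal.ofReal ((ε j) ^ (1 - β) / β)) atTop (𝓝 0) := by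
      rw [← ENNReal.ofReal_zero]
      apply (ENNReal.continuous_ofReal.tendsto 0).comp
      have h3 := (εlim.rpow_const (p := 1 - β) (Or.inr (by linarith))).div_const β
      rwa [Real.zero_rpow (by linarith), zero_div] at h3
    have h4 := ENNReal.Tendsto.const_mul (a := C0)
      (ENNReal.Tendsto.mul_const (b := cG n (β - 1)) this (Or.inr hcg)) (Or.inr hC0t)
    simpa using h4

lemma riesz_eq_enorm {n : ℕ} {α : ℝ} (hαn : α < n) (x y : Rn n) :
    riesz n α x y = ‖x - y‖ₑ ^ (α - (n:ℝ)) := by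
  unfold riesz
  split_ifs with h
  · rw [h, sub_self, enorm_zero, ENNReal.zero_rpow_of_neg (by linarith)]
  · have : 0 < ‖x - y‖ := norm_pos_iff.2 (sub_ne_zero.2 h)
    rw [← ofReal_norm, ENNReal.ofReal_rpow_of_pos this]

lemma riesz_cont {n : ℕ} {α : ℝ} (hαn : α < n) :
    Continuous (fun p : Rn n × Rn n => riesz n α p.1 p.2) := by
  simp_rw [riesz_eq_enorm hαn]
  exact ENNReal.continuous_rpow_const.comp (by fun_prop)

lemma riesz_pos {n : ℕ} {α : ℝ} (x y : Rn n) : 0 < riesz n α x y := by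
  unfold riesz
  split_ifs with h
  · simp
  · have : 0 < ‖x - y‖ := norm_pos_iff.2 (sub_ne_zero.2 h)
    rw [ENNReal.ofReal_pos]; positivity

lemma riesz_ne_top {n : ℕ} {α : ℝ} {x y : Rn n} (h : x ≠ y) : riesz n α x y ≠ ⊤ := by
  unfold riesz; simp [h]

lemma riesz_self {n : ℕ} {α : ℝ} (x : Rn n) : riesz n α x x = ⊤ := by simp [riesz]

lemma riesz_le {n : ℕ} {α : ℝ} (hαn : α < n) {x y : Rn n} {r : ℝ} (hr : 0 < r) (h : r ≤ dist x y) :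
    riesz n α x y ≤ ENNReal.ofReal (r ^ (α - n)) := by
  unfold riesz
  rw [if_neg (by rintro rfl; simp at h; linarith)]
  apply ENNReal.ofReal_le_ofReal
  rw [dist_eq_norm] at h
  exact Real.rpow_le_rpow_of_nonpos hr h (by linarith)

lemma riesz_measR {n : ℕ} {α : ℝ} (x : Rn n) : Measurable (fun y => riesz n α x y) :=
  (riesz_meas n α).comp (measurable_const.prodMk measurable_id)
lemma riesz_measL {n : ℕ} {α : ℝ} (y : Rn n) : Measurable (fun x => riesz n α x y) :=
  (riesz_meas n α).comp (measurable_id.prodMk measurable_const)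

/-- Riesz potential -/
noncomputable abbrev V (n : ℕ) (α : ℝ) (μ : Measure (Rn n)) (x : Rn n) : ℝ≥0∞ :=
  potential (riesz n α) μ x

lemma V_meas (n : ℕ) (α : ℝ) (μ : Measure (Rn n)) [SFinite μ] : Measurable (V n α μ) :=
  Measurable.lintegral_prod_right' (f := fun p : Rn n × Rn n => riesz n α p.1 p.2) (riesz_meas n α)

lemma V_dirac (n : ℕ) (α : ℝ) (y x : Rn n) : V n α (Measure.dirac y) x = riesz n α x y := by
  unfold V potential
  rw [lintegral_dirac]

lemma V_lsc {n : ℕ} {α : ℝ} (hαn : α < n) (μ : Measure (Rn n)) (x : Rn n) (p : ℕ → Rn n)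
    (hp : Tendsto p atTop (𝓝 x)) : V n α μ x ≤ liminf (fun j => V n α μ (p j)) atTop := by
  unfold V potential
  calc ∫⁻ y, riesz n α x y ∂μ = ∫⁻ y, liminf (fun j => riesz n α (p j) y) atTop ∂μ := by
        apply lintegral_congr; intro y
        have : Tendsto (fun j => riesz n α (p j) y) atTop (𝓝 (riesz n α x y)) :=
          ((riesz_cont hαn).tendsto (x, y)).comp (hp.prodMk_nhds tendsto_const_nhds)
        rw [this.liminf_eq]
    _ ≤ _ := lintegral_liminf_le (fun j => riesz_measR _)

/-- local integrability of the kernel -/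
lemma riesz_unit_int {n : ℕ} {α : ℝ} (hn : 0 < n) (h0 : 0 < α) :
    ∫⁻ y in Metric.ball (0 : Rn n) 1, ENNReal.ofReal (‖y‖ ^ (α - (n:ℝ))) < ⊤ := by
  haveI : Nonempty (Fin n) := ⟨⟨0, hn⟩⟩
  have h1 := integrable_fun_norm_addHaar (volume : Measure (Rn n))
    (f := (Iio (1:ℝ)).indicator (fun r => r ^ (α - (n:ℝ))))
  have h2 : IntegrableOn (fun y : ℝ => y ^ (Module.finrank ℝ (Rn n) - 1) •
      (Iio (1:ℝ)).indicator (fun r => r ^ (α - (n:ℝ))) y) (Ioi 0) := by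
    have h3 : IntegrableOn (fun y : ℝ => y ^ (α - 1)) (Ioo 0 1) := by
      have := (intervalIntegral.intervalIntegrable_rpow' (r := α - 1) (by linarith) (a := 0) (b := 1))
      rw [intervalIntegrable_iff_integrableOn_Ioo_of_le zero_le_one] at this
      exact this
    have h4 : IntegrableOn ((Ioo (0:ℝ) 1).indicator (fun y : ℝ => y ^ (α - 1))) (Ioi 0) :=
      ((integrable_indicator_iff measurableSet_Ioo).2 h3).integrableOn
    refine h4.congr_fun ?_ measurableSet_Ioi
    intro y hy
    have hy : 0 < y := hy
    simp only [indicator, mem_Ioo, mem_Iio, hy, true_and, smul_eq_mul, finrank_euclideanSpace,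
      Fintype.card_fin]
    split_ifs
    · rw [← Real.rpow_natCast, ← Real.rpow_add hy]
      congr 1
      rw [Nat.cast_sub hn]; push_cast; ring
    · simp
  have h5 := (h1.2 h2).lintegral_lt_top
  rw [← lintegral_indicator Metric.isOpen_ball.measurableSet]
  refine lt_of_le_of_lt (lintegral_mono fun y => ?_) h5
  by_cases hy : ‖y‖ < 1
  · rw [indicator_of_mem (by simpa using hy), indicator_of_mem (by exact hy)]
  · rw [indicator_of_notMem (by simpa using hy)]; exact zero_le

lemma riesz_int_bound {n : ℕ} {α : ℝ} (hn : 0 < n) (h0 : 0 < α) (hαn : α < n) :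
    ∃ c : ℝ≥0∞, c ≠ ⊤ ∧ ∀ (x : Rn n) (S : Set (Rn n)), MeasurableSet S →
      ∫⁻ y in S, riesz n α x y ≤ c + volume S := by
  refine ⟨_, (riesz_unit_int (n := n) (α := α) hn h0).ne, fun x S hS => ?_⟩
  haveI : Nonempty (Fin n) := ⟨⟨0, hn⟩⟩
  rw [← lintegral_inter_add_sdiff _ S (Metric.isOpen_ball (x := x) (ε := 1)).measurableSet]
  refine add_le_add ?_ ?_
  · calc ∫⁻ y in S ∩ Metric.ball x 1, riesz n α x y ≤ ∫⁻ y in Metric.ball x 1, riesz n α x y :=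
          lintegral_mono_set inter_subset_right
      _ = ∫⁻ y in Metric.ball (0:Rn n) 1, riesz n α 0 y := by
          rw [← lintegral_indicator Metric.isOpen_ball.measurableSet,
            ← lintegral_indicator Metric.isOpen_ball.measurableSet, ← lintegral_add_right_eq_self _ x]
          apply lintegral_congr; intro y
          simp [indicator, riesz, @eq_comm _ y 0]
      _ = _ := by
          apply lintegral_congr_ae
          apply ae_restrict_of_ae
          have : ∀ᵐ y : Rn n, y ≠ 0 := by
            simp [ae_iff]
          filter_upwards [this] with y hy
          simp [riesz, hy.symm]
  · calc ∫⁻ y in S \ Metric.ball x 1, riesz n α x y ≤ ∫⁻ y in S \ Metric.ball x 1, 1 := by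
          apply setLIntegral_mono measurable_const
          intro y hy
          have : (1:ℝ) ≤ dist x y := by
            have := hy.2; simp only [Metric.mem_ball, not_lt] at this; rwa [dist_comm]
          simpa using riesz_le hαn one_pos this
      _ ≤ volume S := by simp; exact measure_mono sdiff_subset

lemma riesz_ball_bound {n : ℕ} {α : ℝ} (hαn : α < n) (μ : Measure (Rn n))
    (M : ℝ≥0∞) (hM : ∀ᵐ x ∂μ, V n α μ x ≤ M) (x : Rn n) :
    V n α μ x ≤ ENNReal.ofReal (2 ^ ((n:ℝ) - α)) * M := by
  set A : Set (Rn n) := {x | V n α μ x ≤ M} with hA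
  set S := closure A with hS
  have hS0 : μ Sᶜ = 0 := measure_mono_null (compl_subset_compl.2 subset_closure) hM
  have hSM : ∀ z ∈ S, V n α μ z ≤ M := by
    intro z hz
    obtain ⟨p, hp, hpl⟩ := mem_closure_iff_seq_limit.1 hz
    refine (V_lsc hαn μ z p hpl).trans ?_
    refine (liminf_le_liminf (v := fun _ => M) (Eventually.of_forall fun j => hp j)).trans ?_
    rw [liminf_const]
  rcases S.eq_empty_or_nonempty with he | hne
  · have : μ = 0 := by
      rw [he, compl_empty] at hS0; exact Measure.measure_univ_eq_zero.1 hS0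
    rw [this]; unfold V potential; simp
  · obtain ⟨z, hzS, hz⟩ := (isClosed_closure (s := A)).exists_infDist_eq_dist hne x
    refine le_trans ?_ (mul_le_mul_right (hSM z hzS) _)
    unfold V potential
    rw [← lintegral_const_mul' _ _ ENNReal.ofReal_ne_top]
    apply lintegral_mono_ae
    have : ∀ᵐ y ∂μ, y ∈ S := hS0
    filter_upwards [this] with y hy
    have h1 : dist x z ≤ dist x y := by rw [← hz]; exact Metric.infDist_le_dist_of_mem hy
    have h2 : dist z y ≤ 2 * dist x y := by
      have := dist_triangle z x y; rw [dist_comm z x] at this; linarith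
    by_cases hzy : z = y
    · rw [hzy, riesz_self, ENNReal.mul_top]
      · exact le_top
      · have : (0:ℝ) < 2 ^ ((n:ℝ) - α) := by positivity
        simpa using this
    · have hd : 0 < dist z y := dist_pos.2 hzy
      calc riesz n α x y ≤ ENNReal.ofReal ((dist z y / 2) ^ (α - n)) :=
            riesz_le hαn (by positivity) (by linarith)
        _ = _ := by
          unfold riesz
          rw [if_neg hzy, ← ENNReal.ofReal_mul (by positivity), ← dist_eq_norm]
          congr 1
          rw [Real.div_rpow hd.le (by norm_num), show (n:ℝ) - α = -(α - n) by ring,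
            Real.rpow_neg (by norm_num)]
          field_simp

/-! energies -/
lemma energy_symm (n : ℕ) (α : ℝ) (μ ν : Measure (Rn n)) [SFinite μ] [SFinite ν] :
    energy (riesz n α) μ ν = energy (riesz n α) ν μ := by
  unfold energy potential
  rw [lintegral_lintegral_swap (riesz_meas n α).aemeasurable]
  simp_rw [riesz_symm n α]

lemma pot_add {X : Type*} [MeasurableSpace X] (κ : X → X → ℝ≥0∞) (μ ν : Measure X) (x : X) :
    potential κ (μ + ν) x = potential κ μ x + potential κ ν x := by
  simp [potential, lintegral_add_measure]

lemma energy_add_left {X : Type*} [TopologicalSpace X] [MeasurableSpace X] (κ : X → X → ℝ≥0∞) (μ ν σ : Measure X) :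
    energy κ (μ + ν) σ = energy κ μ σ + energy κ ν σ := by
  simp [energy, lintegral_add_measure]

lemma energy_add_right (n : ℕ) (α : ℝ) (μ ν σ : Measure (Rn n)) [SFinite μ] [SFinite ν] :
    energy (riesz n α) σ (μ + ν) = energy (riesz n α) σ μ + energy (riesz n α) σ ν := by
  unfold energy
  simp_rw [pot_add]
  exact lintegral_add_left (V_meas n α μ) _

lemma energy_smul_left {X : Type*} [TopologicalSpace X] [MeasurableSpace X] (κ : X → X → ℝ≥0∞) (c : ℝ≥0∞) (μ σ : Measure X) :
    energy κ (c • μ) σ = c * energy κ μ σ := by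
  simp [energy, lintegral_smul_measure]

lemma energy_smul_right {X : Type*} [TopologicalSpace X] [MeasurableSpace X] (κ : X → X → ℝ≥0∞) (c : ℝ≥0∞) (hc : c ≠ ⊤)
    (μ σ : Measure X) :
    energy κ σ (c • μ) = c * energy κ σ μ := by
  simp only [energy, potential, lintegral_smul_measure, smul_eq_mul]
  rw [lintegral_const_mul' _ _ hc]

/-- measures of finite energy do not charge sets of zero inner capacity -/
lemma cap_null {n : ℕ} (κ : Rn n → Rn n → ℝ≥0∞) (μ : Measure (Rn n)) (hμ : μ.Regular)
    (hE : energy κ μ μ < ⊤) (S : Set (Rn n)) (hS : MeasurableSet S) (hc : innerCap κ S = 0) :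
    μ S = 0 := by
  by_contra hne
  have hex : ∃ N : ℕ, μ (S ∩ Metric.closedBall 0 N) ≠ 0 := by
    by_contra hcon
    push Not at hcon
    apply hne
    have : S = ⋃ N : ℕ, S ∩ Metric.closedBall 0 N := by
      rw [← inter_iUnion, Metric.iUnion_closedBall_nat, inter_univ]
    rw [this]
    exact measure_iUnion_null hcon
  obtain ⟨N, hN⟩ := hex
  have hfin : μ (S ∩ Metric.closedBall 0 N) ≠ ⊤ :=
    ((measure_mono inter_subset_right).trans_lt (isCompact_closedBall (0 : Rn n) (N:ℝ)).measure_lt_top).ne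
  have hSm : MeasurableSet (S ∩ Metric.closedBall 0 N) := hS.inter Metric.isClosed_closedBall.measurableSet
  obtain ⟨K, hKS, hK, hKp⟩ := hSm.exists_lt_isCompact_of_ne_top hfin (pos_iff_ne_zero.2 hN)
  have hKt : μ K ≠ ⊤ := hK.measure_lt_top.ne
  set ρ : Measure (Rn n) := (μ K)⁻¹ • μ.restrict K with hρ
  have hinv : (μ K)⁻¹ ≠ ⊤ := ENNReal.inv_ne_top.2 hKp.ne'
  have hρp : IsProbabilityMeasure ρ := ⟨by
    rw [hρ, Measure.smul_apply, smul_eq_mul, Measure.restrict_apply_univ, ENNReal.inv_mul_cancel hKp.ne' hKt]⟩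
  have hρK : ρ Kᶜ = 0 := by
    rw [hρ, Measure.smul_apply, smul_eq_mul, Measure.restrict_apply hK.measurableSet.compl]; simp
  have hρE : energy κ ρ ρ < ⊤ := by
    rw [hρ, energy_smul_left, energy_smul_right _ _ hinv]
    refine ENNReal.mul_lt_top hinv.lt_top (ENNReal.mul_lt_top hinv.lt_top (lt_of_le_of_lt ?_ hE))
    unfold energy potential
    exact lintegral_mono' Measure.restrict_le_self (fun x => lintegral_mono' Measure.restrict_le_self le_rfl)
  have h1 : capC κ K = 0 := by
    apply le_antisymm _ zero_le
    rw [← hc]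
    exact le_iSup_of_le K (le_iSup_of_le hK (le_iSup_of_le (hKS.trans inter_subset_left) le_rfl))
  unfold capC at h1
  rw [ENNReal.inv_eq_zero] at h1
  have h2 : (⨅ (μ : Measure (Rn n)) (_ : IsProbabilityMeasure μ) (_ : μ Kᶜ = 0), energy κ μ μ) ≤ energy κ ρ ρ :=
    iInf_le_of_le ρ (iInf_le_of_le hρp (iInf_le_of_le hρK le_rfl))
  rw [h1] at h2
  exact absurd hρE (not_lt.2 h2)

lemma cap_null_vol {n : ℕ} {α : ℝ} (hn : 0 < n) (h0 : 0 < α) (hαn : α < n) (S : Set (Rn n))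
    (hS : MeasurableSet S) (hc : innerCap (riesz n α) S = 0) : volume S = 0 := by
  obtain ⟨c, hc1, hc2⟩ := riesz_int_bound (n := n) hn h0 hαn
  have : S = ⋃ N : ℕ, S ∩ Metric.closedBall 0 N := by
    rw [← inter_iUnion, Metric.iUnion_closedBall_nat, inter_univ]
  rw [this]
  refine measure_iUnion_null fun N => ?_
  have hB : MeasurableSet (Metric.closedBall (0 : Rn n) N) := Metric.isClosed_closedBall.measurableSet
  have hBt : volume (Metric.closedBall (0 : Rn n) N) < ⊤ := (isCompact_closedBall _ _).measure_lt_top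
  haveI : IsFiniteMeasure (volume.restrict (Metric.closedBall (0 : Rn n) N)) := ⟨by simpa using hBt⟩
  have h := cap_null (riesz n α) (volume.restrict (Metric.closedBall (0 : Rn n) N)) inferInstance ?_ S hS hc
  · rwa [Measure.restrict_apply hS] at h
  · unfold energy potential
    calc _ ≤ ∫⁻ x in Metric.closedBall (0 : Rn n) N, (c + volume (Metric.closedBall (0 : Rn n) N)) :=
          lintegral_mono fun x => hc2 x _ hB
      _ < ⊤ := by
        rw [lintegral_const]
        refine ENNReal.mul_lt_top (ENNReal.add_lt_top.2 ⟨hc1.lt_top, hBt⟩) (by simpa using hBt)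

noncomputable def Kit.Jop {n : ℕ} {α : ℝ} (K : Kit n α) (j : ℕ) (f : Rn n → ℝ≥0∞) (x : Rn n) : ℝ≥0∞ :=
  ∫⁻ z, K.J j (x - z) * f z
noncomputable def Kit.Hop {n : ℕ} {α : ℝ} (K : Kit n α) (j : ℕ) (f : Rn n → ℝ≥0∞) (x : Rn n) : ℝ≥0∞ :=
  ∫⁻ z, K.H j (x - z) * f z

lemma conv_meas {n : ℕ} (k f : Rn n → ℝ≥0∞) (hk : Measurable k) (hf : Measurable f)
    (ν : Measure (Rn n)) [SFinite ν] : Measurable (fun x => ∫⁻ z, k (x - z) * f z ∂ν) := by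
  apply Measurable.lintegral_prod_right' (f := fun p : Rn n × Rn n => k (p.1 - p.2) * f p.2)
  exact (hk.comp (measurable_fst.sub measurable_snd)).mul (hf.comp measurable_snd)

lemma conv_symm {n : ℕ} (k f g : Rn n → ℝ≥0∞) (hk : Measurable k) (hf : Measurable f)
    (hg : Measurable g) (hkn : ∀ x, k (-x) = k x) (μ ν : Measure (Rn n)) [SFinite μ] [SFinite ν] :
    ∫⁻ x, g x * (∫⁻ z, k (x - z) * f z ∂ν) ∂μ = ∫⁻ z, f z * (∫⁻ x, k (z - x) * g x ∂μ) ∂ν := by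
  have h1 : ∀ x, g x * (∫⁻ z, k (x - z) * f z ∂ν) = ∫⁻ z, g x * (k (x - z) * f z) ∂ν := by
    intro x
    rw [lintegral_const_mul]
    exact (hk.comp (measurable_const.sub measurable_id)).mul hf
  have h2 : ∀ z, f z * (∫⁻ x, k (z - x) * g x ∂μ) = ∫⁻ x, f z * (k (z - x) * g x) ∂μ := by
    intro x
    rw [lintegral_const_mul]
    exact (hk.comp (measurable_const.sub measurable_id)).mul hg
  simp_rw [h1, h2]
  rw [lintegral_lintegral_swap]
  · apply lintegral_congr; intro z
    apply lintegral_congr; intro x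
    rw [← hkn, neg_sub]; ring
  · apply Measurable.aemeasurable
    exact (hg.comp measurable_fst).mul ((hk.comp (measurable_fst.sub measurable_snd)).mul (hf.comp measurable_snd))

section
variable {n : ℕ} {α : ℝ} (K : Kit n α)

lemma Kit.J_measS (j : ℕ) (x : Rn n) : Measurable fun y => K.J j (x - y) :=
  (K.J_meas j).comp (measurable_const.sub measurable_id)
lemma Kit.H_measS (j : ℕ) (x : Rn n) : Measurable fun y => K.H j (x - y) :=
  (K.H_meas j).comp (measurable_const.sub measurable_id)

lemma Kit.Jop_meas (j : ℕ) {f : Rn n → ℝ≥0∞} (hf : Measurable f) : Measurable (K.Jop j f) :=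
  conv_meas _ _ (K.J_meas j) hf _
lemma Kit.Hop_meas (j : ℕ) {f : Rn n → ℝ≥0∞} (hf : Measurable f) : Measurable (K.Hop j f) :=
  conv_meas _ _ (K.H_meas j) hf _

lemma Kit.Jop_symm (j : ℕ) {f g : Rn n → ℝ≥0∞} (hf : Measurable f) (hg : Measurable g) :
    ∫⁻ x, g x * K.Jop j f x = ∫⁻ x, f x * K.Jop j g x :=
  conv_symm _ _ _ (K.J_meas j) hf hg (K.J_neg j) _ _

lemma Kit.Hmu_symm (j : ℕ) {w : Rn n → ℝ≥0∞} (hw : Measurable w) (μ : Measure (Rn n)) [SFinite μ] :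
    ∫⁻ x, w x * (∫⁻ y, K.H j (x - y) ∂μ) = ∫⁻ y, K.Hop j w y ∂μ := by
  have := conv_symm (K.H j) (fun _ => 1) w (K.H_meas j) measurable_const hw (K.H_neg j) volume μ
  simpa [Kit.Hop] using this

lemma Kit.Jop_mono (j : ℕ) {f g : Rn n → ℝ≥0∞} (h : ∀ᵐ x, f x ≤ g x) (x : Rn n) :
    K.Jop j f x ≤ K.Jop j g x := by
  apply lintegral_mono_ae
  filter_upwards [h] with z hz
  exact mul_le_mul_right hz _
lemma Kit.Hop_mono (j : ℕ) {f g : Rn n → ℝ≥0∞} (h : ∀ᵐ x, f x ≤ g x) (x : Rn n) :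
    K.Hop j f x ≤ K.Hop j g x := by
  apply lintegral_mono_ae
  filter_upwards [h] with z hz
  exact mul_le_mul_right hz _
lemma Kit.Jop_congr (j : ℕ) {f g : Rn n → ℝ≥0∞} (h : ∀ᵐ x, f x = g x) (x : Rn n) :
    K.Jop j f x = K.Jop j g x := by
  apply lintegral_congr_ae
  filter_upwards [h] with z hz
  rw [hz]
lemma Kit.Hop_congr (j : ℕ) {f g : Rn n → ℝ≥0∞} (h : ∀ᵐ x, f x = g x) (x : Rn n) :
    K.Hop j f x = K.Hop j g x := by
  apply lintegral_congr_ae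
  filter_upwards [h] with z hz
  rw [hz]
lemma Kit.Jop_add (j : ℕ) {f g : Rn n → ℝ≥0∞} (hf : Measurable f) (x : Rn n) :
    K.Jop j (fun z => f z + g z) x = K.Jop j f x + K.Jop j g x := by
  unfold Kit.Jop
  simp_rw [mul_add]
  exact lintegral_add_left (((K.J_meas j).comp (measurable_const.sub measurable_id)).fun_mul hf) _
lemma Kit.Hop_add (j : ℕ) {f g : Rn n → ℝ≥0∞} (hf : Measurable f) (x : Rn n) :
    K.Hop j (fun z => f z + g z) x = K.Hop j f x + K.Hop j g x := by
  unfold Kit.Hop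
  simp_rw [mul_add]
  exact lintegral_add_left (((K.H_meas j).comp (measurable_const.sub measurable_id)).fun_mul hf) _

lemma Kit.Hop_eq (j : ℕ) {f : Rn n → ℝ≥0∞} (hf : Measurable f) (x : Rn n) :
    K.Hop j f x = ∫⁻ u, f (x + K.s j • u) ∂K.Θ := by
  rw [← K.scal j f hf x]
  unfold Kit.Hop
  apply lintegral_congr; intro z
  rw [← K.H_neg, neg_sub]

lemma Kit.Hop_le_const (j : ℕ) {f : Rn n → ℝ≥0∞} (hf : Measurable f) {M : ℝ≥0∞} (hM : ∀ x, f x ≤ M)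
    (x : Rn n) : K.Hop j f x ≤ M * K.Θ univ := by
  rw [K.Hop_eq j hf]
  calc _ ≤ ∫⁻ u, M ∂K.Θ := lintegral_mono fun u => hM _
    _ = _ := by simp

lemma Kit.Jop_one (j : ℕ) (x : Rn n) : K.Jop j (fun _ => 1) x = K.m j := by
  unfold Kit.Jop
  simp only [mul_one]
  rw [lintegral_sub_left_eq_self (fun z => K.J j z) x, K.J_int]

lemma Kit.Jop_le_const (j : ℕ) {f : Rn n → ℝ≥0∞} (hf : ∀ x, f x ≤ 1)
    (x : Rn n) : K.Jop j f x ≤ K.m j := by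
  rw [← K.Jop_one j x]
  exact K.Jop_mono j (ae_of_all _ hf) x

lemma Kit.KV (j : ℕ) (μ : Measure (Rn n)) [SFinite μ] (x : Rn n) :
    K.m j * V n α μ x = K.Jop j (V n α μ) x + ∫⁻ y, K.H j (x - y) ∂μ := by
  unfold V potential Kit.Jop
  have hJ : Measurable fun z => K.J j (x - z) := (K.J_meas j).comp (measurable_const.sub measurable_id)
  rw [← lintegral_const_mul _ (riesz_measR x)]
  simp_rw [K.K2 j x]
  rw [lintegral_add_right _ (K.H_measS j x)]
  congr 1
  rw [lintegral_lintegral_swap]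
  · apply lintegral_congr; intro z
    rw [lintegral_const_mul _ (riesz_measR z)]
  · apply Measurable.aemeasurable
    exact (hJ.comp measurable_snd).mul ((riesz_meas n α).comp (measurable_snd.prodMk measurable_fst))

lemma Kit.JV_le (j : ℕ) (μ : Measure (Rn n)) [SFinite μ] (x : Rn n) :
    K.Jop j (V n α μ) x ≤ K.m j * V n α μ x := by
  rw [K.KV]; exact le_self_add

lemma Kit.KVw (j : ℕ) (μ : Measure (Rn n)) [SFinite μ] {w : Rn n → ℝ≥0∞} (hw : Measurable w) :
    K.m j * ∫⁻ x, w x * V n α μ x = (∫⁻ x, w x * K.Jop j (V n α μ) x) + ∫⁻ y, K.Hop j w y ∂μ := by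
  rw [← K.Hmu_symm j hw, ← lintegral_const_mul _ (hw.fun_mul (V_meas n α μ)),
    ← lintegral_add_left (hw.fun_mul (K.Jop_meas j (V_meas n α μ)))]
  apply lintegral_congr; intro x
  rw [mul_left_comm, K.KV, mul_add]

lemma Kit.Hpot_swap (j : ℕ) (κ : Rn n → Rn n → ℝ≥0∞) (hκ : Measurable fun p : Rn n × Rn n => κ p.1 p.2)
    (μ : Measure (Rn n)) [SFinite μ] (x : Rn n) :
    K.Hop j (potential κ μ) x = ∫⁻ y, K.Hop j (fun z => κ z y) x ∂μ := by
  unfold potential Kit.Hop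
  rw [← lintegral_lintegral_swap]
  · apply lintegral_congr; intro z
    exact (lintegral_const_mul _ (hκ.comp (measurable_const.prodMk measurable_id))).symm
  · apply Measurable.aemeasurable
    exact ((K.H_measS j x).comp measurable_fst).mul hκ

lemma Kit.Jpot_swap (j : ℕ) (κ : Rn n → Rn n → ℝ≥0∞) (hκ : Measurable fun p : Rn n × Rn n => κ p.1 p.2)
    (μ : Measure (Rn n)) [SFinite μ] (x : Rn n) :
    K.Jop j (potential κ μ) x = ∫⁻ y, K.Jop j (fun z => κ z y) x ∂μ := by
  unfold potential Kit.Jop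
  rw [← lintegral_lintegral_swap]
  · apply lintegral_congr; intro z
    exact (lintegral_const_mul _ (hκ.comp (measurable_const.prodMk measurable_id))).symm
  · apply Measurable.aemeasurable
    exact ((K.J_measS j x).comp measurable_fst).mul hκ

lemma Kit.HV_swap' (j : ℕ) (μ : Measure (Rn n)) [SFinite μ] (x : Rn n) :
    K.Hop j (V n α μ) x = ∫⁻ y, (∫⁻ z, K.H j (x - z) * riesz n α z y) ∂μ :=
  K.Hpot_swap j _ (riesz_meas n α) μ x

lemma Kit.Hriesz_meas (j : ℕ) (x : Rn n) :
    Measurable fun y => ∫⁻ z, K.H j (x - z) * riesz n α z y := by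
  have hJ : Measurable fun z => K.H j (x - z) := (K.H_meas j).comp (measurable_const.sub measurable_id)
  exact Measurable.lintegral_prod_right' (f := fun p : Rn n × Rn n => K.H j (x - p.2) * riesz n α p.2 p.1)
    ((hJ.comp measurable_snd).mul ((riesz_meas n α).comp (measurable_snd.prodMk measurable_fst)))

lemma Kit.HV_le (j : ℕ) (μ : Measure (Rn n)) [SFinite μ] (x : Rn n) :
    K.Hop j (V n α μ) x ≤ K.A * V n α μ x := by
  rw [K.HV_swap']
  unfold V potential
  rw [← lintegral_const_mul _ (riesz_measR x)]
  exact lintegral_mono fun y => K.bda j x y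

lemma no_atom (μ : Measure (Rn n)) (x : Rn n) (hx : V n α μ x ≠ ⊤) : ∀ᵐ y ∂μ, y ≠ x := by
  have h := ae_lt_top (riesz_measR (n := n) (α := α) x) hx
  filter_upwards [h] with y hy hyx
  rw [hyx, riesz_self] at hy
  exact lt_irrefl _ hy

lemma Kit.HV_tendsto (μ : Measure (Rn n)) [SFinite μ] (x : Rn n) (hx : V n α μ x ≠ ⊤) :
    Tendsto (fun j => K.Hop j (V n α μ) x) atTop (𝓝 (K.Θ univ * V n α μ x)) := by
  simp_rw [K.HV_swap']
  unfold V potential at hx ⊢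
  rw [← lintegral_const_mul _ (riesz_measR x)]
  apply tendsto_lintegral_of_dominated_convergence (fun y => K.A * riesz n α x y)
  · intro j; exact K.Hriesz_meas j x
  · intro j; exact ae_of_all _ fun y => K.bda j x y
  · rw [lintegral_const_mul _ (riesz_measR x)]
    exact ENNReal.mul_ne_top K.A_top hx
  · filter_upwards [no_atom μ x hx] with y hy
    exact K.limb x y hy.symm

lemma Kit.s_tendsto (x u : Rn n) : Tendsto (fun j => x + K.s j • u) atTop (𝓝 x) := by
  have := (tendsto_const_nhds (x := x)).add (K.s_lim.smul_const u)
  simpa using this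

lemma Kit.Hliminf {f : Rn n → ℝ≥0∞} (hf : Measurable f) (x : Rn n)
    (hl : ∀ p : ℕ → Rn n, Tendsto p atTop (𝓝 x) → f x ≤ liminf (fun j => f (p j)) atTop) :
    K.Θ univ * f x ≤ liminf (fun j => K.Hop j f x) atTop := by
  simp_rw [K.Hop_eq _ hf]
  calc K.Θ univ * f x = ∫⁻ u, f x ∂K.Θ := by simp [mul_comm]
    _ ≤ ∫⁻ u, liminf (fun j => f (x + K.s j • u)) atTop ∂K.Θ :=
        lintegral_mono fun u => hl _ (K.s_tendsto x u)
    _ ≤ _ := lintegral_liminf_le fun j => hf.comp (by fun_prop)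

/-- liminf of `H_j 1_U` at points of the open set `U` -/
lemma Kit.Hliminf_open {U : Set (Rn n)} (hU : IsOpen U) (x : Rn n) :
    U.indicator (fun _ => K.Θ univ) x ≤ liminf (fun j => K.Hop j (U.indicator fun _ => 1) x) atTop := by
  by_cases hx : x ∈ U
  · have := K.Hliminf (f := U.indicator fun _ => 1) (measurable_const.indicator hU.measurableSet) x (by
      intro p hp
      have h2 : ∀ᶠ j in atTop, U.indicator (fun _ => (1:ℝ≥0∞)) (p j) = 1 := by
        filter_upwards [hp.eventually (hU.mem_nhds hx)] with j hj
        rw [indicator_of_mem hj]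
      rw [liminf_congr h2]
      simp [hx])
    simpa [hx] using this
  · rw [indicator_of_notMem hx]; exact zero_le

/-- far-off bound -/
lemma Kit.Hfar (j : ℕ) {w : Rn n → ℝ≥0∞} (hw : Measurable w) (z : Rn n) {δ : ℝ} (hδ : 0 < δ)
    (h : ∀ x, w x ≠ 0 → δ ≤ dist z x) :
    K.Hop j w z ≤ K.e j * ENNReal.ofReal (δ ^ (-2:ℝ)) * ∫⁻ x, riesz n α z x * w x := by
  unfold Kit.Hop
  rw [← lintegral_const_mul _ ((riesz_measR z).fun_mul hw)]
  apply lintegral_mono fun x => ?_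
  by_cases hx : w x = 0
  · simp [hx]
  have hd := h x hx
  rw [← mul_assoc]
  refine mul_le_mul_left ?_ _
  have hne : z ≠ x := by rintro rfl; simp at hd; linarith
  have hp : 0 < ‖z - x‖ := norm_pos_iff.2 (sub_ne_zero.2 hne)
  refine (K.far j _ (sub_ne_zero.2 hne)).trans ?_
  rw [mul_assoc]
  refine mul_le_mul_right ?_ _
  unfold riesz
  rw [if_neg hne, ← ENNReal.ofReal_mul (by positivity)]
  apply ENNReal.ofReal_le_ofReal
  rw [show α - 2 - (n:ℝ) = (-2) + (α - n) by ring, Real.rpow_add hp]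
  refine mul_le_mul_of_nonneg_right ?_ (by positivity)
  rw [dist_eq_norm] at hd
  exact Real.rpow_le_rpow_of_nonpos hδ hd (by norm_num)

lemma Kit.Hfar_lim {w : Rn n → ℝ≥0∞} (hw : Measurable w) (z : Rn n) {δ : ℝ} (hδ : 0 < δ)
    (h : ∀ x, w x ≠ 0 → δ ≤ dist z x) (hfin : ∫⁻ x, riesz n α z x * w x ≠ ⊤) :
    Tendsto (fun j => K.Hop j w z) atTop (𝓝 0) := by
  have h1 : Tendsto (fun j => K.e j * (ENNReal.ofReal (δ ^ (-2:ℝ)) * ∫⁻ x, riesz n α z x * w x)) atTop (𝓝 0) := by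
    have := ENNReal.Tendsto.mul_const (b := ENNReal.ofReal (δ ^ (-2:ℝ)) * ∫⁻ x, riesz n α z x * w x) K.e_lim
      (Or.inr (ENNReal.mul_ne_top ENNReal.ofReal_ne_top hfin))
    simpa using this
  refine tendsto_of_tendsto_of_tendsto_of_le_of_le tendsto_const_nhds h1 (fun j => zero_le) fun j => ?_
  rw [← mul_assoc]
  exact K.Hfar j hw z hδ h

lemma Kit.H_w_zero {w r u : Rn n → ℝ≥0∞} (hr : Measurable r) (z : Rn n)
    (hwr : ∀ᵐ x, w x + r x = u x)
    (hu : Tendsto (fun j => K.Hop j u z) atTop (𝓝 (K.Θ univ * u z)))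
    (hl : K.Θ univ * r z ≤ liminf (fun j => K.Hop j r z) atTop)
    (he : u z = r z) (hfin : u z ≠ ⊤) :
    Tendsto (fun j => K.Hop j w z) atTop (𝓝 0) := by
  have hadd : ∀ j, K.Hop j u z = K.Hop j r z + K.Hop j w z := by
    intro j
    rw [← K.Hop_add j hr]
    apply K.Hop_congr j
    filter_upwards [hwr] with x hx
    rw [← hx, add_comm]
  have hL : K.Θ univ * u z ≠ ⊤ := ENNReal.mul_ne_top K.Θ_fin hfin
  rw [← he] at hl
  rw [ENNReal.tendsto_nhds_zero]
  intro ε hε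
  by_cases htop : ε = ⊤
  · simp [htop]
  have hε2 : 0 < ε / 2 := ENNReal.half_pos hε.ne'
  have h1 : ∀ᶠ j in atTop, K.Hop j u z ≤ K.Θ univ * u z + ε / 2 := by
    apply (hu.eventually (Iic_mem_nhds ?_))
    exact ENNReal.lt_add_right hL hε2.ne'
  have h2 : ∀ᶠ j in atTop, K.Θ univ * u z ≤ K.Hop j r z + ε / 2 := by
    by_cases h0 : K.Θ univ * u z = 0
    · simp [h0]
    have : K.Θ univ * u z - ε / 2 < liminf (fun j => K.Hop j r z) atTop :=
      lt_of_lt_of_le (ENNReal.sub_lt_self hL h0 hε2.ne') hl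
    filter_upwards [eventually_lt_of_lt_liminf this] with j hj
    exact tsub_le_iff_right.1 hj.le
  filter_upwards [h1, h2] with j a b
  rw [hadd] at a
  have hrt : K.Hop j r z ≠ ⊤ := by
    intro h
    rw [h] at a; simp at a
    rcases a with a | a
    · exact hL a
    · exact (ENNReal.div_ne_top htop (by norm_num)) a
  have : K.Hop j r z + K.Hop j w z ≤ K.Hop j r z + ε := by
    calc _ ≤ K.Θ univ * u z + ε / 2 := a
      _ ≤ K.Hop j r z + ε / 2 + ε / 2 := by gcongr
      _ = _ := by rw [add_assoc, ENNReal.add_halves]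
  exact (ENNReal.add_le_add_iff_left hrt).1 this

end

lemma amgm (a b : ℝ≥0∞) : 2 * (a * b) ≤ a * a + b * b := by
  rcases le_total a b with h | h
  · obtain ⟨d, rfl⟩ := exists_add_of_le h
    calc 2 * (a * (a + d)) = a * a + (a * a + a * d + a * d) := by ring
      _ ≤ a * a + (a * a + a * d + a * d + d * d) := add_le_add_right le_self_add _
      _ = _ := by ring
  · obtain ⟨d, rfl⟩ := exists_add_of_le h
    calc 2 * ((b + d) * b) = b * b + b * d + b * d + b * b := by ring
      _ ≤ (b * b + b * d + b * d + d * d) + b * b := add_le_add_left le_self_add _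
      _ = _ := by ring

section
variable {n : ℕ} {α : ℝ} (K : Kit n α)

lemma Kit.Jop_ind (j : ℕ) {D : Set (Rn n)} (hD : MeasurableSet D) (x : Rn n) :
    K.Jop j (D.indicator fun _ => 1) x + K.Jop j (Dᶜ.indicator fun _ => 1) x = K.m j := by
  rw [← K.Jop_add j (measurable_const.indicator hD), ← K.Jop_one j x]
  apply K.Jop_congr j
  refine ae_of_all _ fun z => ?_
  by_cases hz : z ∈ D <;> simp [hz]

lemma Kit.Jop_ind_pos (j : ℕ) {B : Set (Rn n)} (hB : MeasurableSet B) (h0 : volume B ≠ 0) (x : Rn n) :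
    0 < K.Jop j (B.indicator fun _ => 1) x := by
  have : K.Jop j (B.indicator fun _ => 1) x = ∫⁻ z in B, K.J j (x - z) := by
    rw [← lintegral_indicator hB]
    unfold Kit.Jop
    apply lintegral_congr; intro z
    by_cases hz : z ∈ B <;> simp [hz]
  rw [this, setLIntegral_pos_iff (K.J_measS j x)]
  have h2 : Function.support (fun z => K.J j (x - z)) = univ := by
    ext z; simpa using (K.J_pos j (x - z)).ne'
  rw [h2, univ_inter]
  exact pos_iff_ne_zero.2 h0

lemma Kit.JwD (j : ℕ) {D : Set (Rn n)} (hD : MeasurableSet D) {w : Rn n → ℝ≥0∞} (hw : Measurable w)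
    (hoff : ∀ᵐ x, x ∉ D → w x = 0) :
    ∫⁻ x, w x * K.Jop j w x ≤ ∫⁻ x, (w x * w x) * K.Jop j (D.indicator fun _ => 1) x := by
  have h1D : Measurable (D.indicator fun _ => (1:ℝ≥0∞)) := measurable_const.indicator hD
  have hww : Measurable fun x => w x * w x := hw.fun_mul hw
  have key : ∀ᵐ x, 2 * (w x * K.Jop j w x) ≤ (w x * w x) * K.Jop j (D.indicator fun _ => 1) x
      + (D.indicator (fun _ => 1) x) * K.Jop j (fun x => w x * w x) x := by
    filter_upwards [hoff] with x hx
    unfold Kit.Jop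
    rw [← lintegral_const_mul _ ((K.J_measS j x).fun_mul hw),
      ← lintegral_const_mul _ ((K.J_measS j x).fun_mul hw |>.const_mul _),
      ← lintegral_const_mul _ ((K.J_measS j x).fun_mul h1D),
      ← lintegral_const_mul _ ((K.J_measS j x).fun_mul hww),
      ← lintegral_add_left (((K.J_measS j x).fun_mul h1D).const_mul _)]
    apply lintegral_mono_ae
    filter_upwards [hoff] with z hz
    by_cases hxD : x ∈ D
    · by_cases hzD : z ∈ D
      · simp only [indicator_of_mem hxD, indicator_of_mem hzD]
        calc 2 * (w x * (K.J j (x - z) * w z)) = K.J j (x - z) * (2 * (w x * w z)) := by ring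
          _ ≤ K.J j (x - z) * (w x * w x + w z * w z) := mul_le_mul_right (amgm _ _) _
          _ = _ := by ring
      · simp [hz hzD]
    · simp [hx hxD]
  have h2 := lintegral_mono_ae key
  rw [lintegral_const_mul _ (hw.fun_mul (K.Jop_meas j hw)),
    lintegral_add_left (hww.fun_mul (K.Jop_meas j h1D)),
    K.Jop_symm j hww h1D, ← two_mul] at h2
  exact (ENNReal.mul_le_mul_iff_right (by norm_num) (by norm_num)).1 h2

/-- the domination lemma -/
lemma Kit.dom {D : Set (Rn n)} (hD : MeasurableSet D) (hDv : volume D ≠ ⊤) (hDc : volume Dᶜ ≠ 0)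
    {u v : Rn n → ℝ≥0∞} (hu : Measurable u) (hv : Measurable v) {M : ℝ≥0∞} (hM : M ≠ ⊤)
    (huM : ∀ x, u x ≤ M) (hoff : ∀ᵐ x, x ∉ D → u x ≤ v x) (S T : ℕ → ℝ≥0∞)
    (hS : ∀ j, K.m j * ∫⁻ x, (u x - v x) * u x ≤ (∫⁻ x, (u x - v x) * K.Jop j u x) + S j)
    (hT : ∀ j, ∫⁻ x, (u x - v x) * K.Jop j v x ≤ K.m j * (∫⁻ x, (u x - v x) * v x) + T j)
    (hSl : Tendsto S atTop (𝓝 0)) (hTl : Tendsto T atTop (𝓝 0)) :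
    ∀ᵐ x, u x ≤ v x := by
  set w : Rn n → ℝ≥0∞ := fun x => u x - v x with hwdef
  have hw : Measurable w := hu.sub hv
  have hww : Measurable fun x => w x * w x := hw.fun_mul hw
  set r : Rn n → ℝ≥0∞ := fun x => min (u x) (v x) with hrdef
  have hr : Measurable r := hu.min hv
  have hw0 : ∀ᵐ x, x ∉ D → w x = 0 := by
    filter_upwards [hoff] with x hx hxD
    exact tsub_eq_zero_of_le (hx hxD)
  have hwr : ∀ x, w x + r x = u x := by
    intro x
    rcases le_total (u x) (v x) with h | h
    · simp only [hwdef, hrdef, min_eq_left h, tsub_eq_zero_of_le h, zero_add]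
    · simp only [hwdef, hrdef, min_eq_right h, tsub_add_cancel_of_le h]
  have hwv : ∀ x, w x * v x = w x * r x := by
    intro x
    rcases le_total (u x) (v x) with h | h
    · simp only [hwdef, tsub_eq_zero_of_le h, zero_mul]
    · simp only [hrdef, min_eq_right h]
  have hwM : ∀ x, w x ≤ M := fun x => (tsub_le_self).trans (huM x)
  have hrM : ∀ x, r x ≤ M := fun x => (min_le_left _ _).trans (huM x)
  have hfin : ∀ f : Rn n → ℝ≥0∞, (∀ x, f x ≤ M) → ∫⁻ x, w x * f x ≠ ⊤ := by
    intro f hf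
    have : ∫⁻ x, w x * f x ≤ ∫⁻ x, D.indicator (fun _ => M * M) x := by
      apply lintegral_mono_ae
      filter_upwards [hw0] with x hx
      by_cases hxD : x ∈ D
      · rw [indicator_of_mem hxD]; exact mul_le_mul' (hwM x) (hf x)
      · simp [hx hxD]
    refine ne_top_of_le_ne_top ?_ this
    rw [lintegral_indicator hD]
    simp only [lintegral_const, Measure.restrict_apply MeasurableSet.univ, univ_inter]
    exact ENNReal.mul_ne_top (ENNReal.mul_ne_top hM hM) hDv
  have main : ∀ j, ∫⁻ x, (w x * w x) * K.Jop j (Dᶜ.indicator fun _ => 1) x ≤ S j + T j := by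
    intro j
    have a1 := hS j
    have a2 := hT j
    have e1 : ∫⁻ x, w x * u x = (∫⁻ x, w x * w x) + ∫⁻ x, w x * r x := by
      rw [← lintegral_add_left hww]
      apply lintegral_congr; intro x; rw [← mul_add, hwr]
    have e2 : ∫⁻ x, w x * K.Jop j u x = (∫⁻ x, w x * K.Jop j w x) + ∫⁻ x, w x * K.Jop j r x := by
      rw [← lintegral_add_left (hw.fun_mul (K.Jop_meas j hw))]
      apply lintegral_congr; intro x
      rw [← mul_add, ← K.Jop_add j hw]
      congr 2; ext z; rw [hwr]
    have e3 : ∫⁻ x, w x * v x = ∫⁻ x, w x * r x := lintegral_congr hwv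
    have e4 : ∫⁻ x, w x * K.Jop j r x ≤ ∫⁻ x, w x * K.Jop j v x :=
      lintegral_mono fun x => mul_le_mul_right (K.Jop_mono j (ae_of_all _ fun z => min_le_right _ _) x) _
    have e5 := K.JwD j hD hw hw0
    have e6 : K.m j * ∫⁻ x, w x * w x = (∫⁻ x, (w x * w x) * K.Jop j (D.indicator fun _ => 1) x)
        + ∫⁻ x, (w x * w x) * K.Jop j (Dᶜ.indicator fun _ => 1) x := by
      rw [← lintegral_add_left (hww.fun_mul (K.Jop_meas j (measurable_const.indicator hD))),
        ← lintegral_const_mul _ hww]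
      apply lintegral_congr; intro x
      rw [← mul_add, K.Jop_ind j hD, mul_comm]
    have f1 : K.m j * ∫⁻ x, w x * r x ≠ ⊤ := ENNReal.mul_ne_top (K.m_top j) (hfin r hrM)
    have f2 : ∫⁻ x, (w x * w x) * K.Jop j (D.indicator fun _ => 1) x ≠ ⊤ := by
      refine ne_top_of_le_ne_top (ENNReal.mul_ne_top (K.m_top j) (hfin w hwM)) ?_
      rw [e6]; exact le_self_add
    rw [e1, e2, mul_add, e6] at a1
    rw [e3] at a2
    have : (K.m j * ∫⁻ x, w x * r x) + ((∫⁻ x, (w x * w x) * K.Jop j (D.indicator fun _ => 1) x)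
        + ∫⁻ x, (w x * w x) * K.Jop j (Dᶜ.indicator fun _ => 1) x) ≤
        (K.m j * ∫⁻ x, w x * r x) + ((∫⁻ x, (w x * w x) * K.Jop j (D.indicator fun _ => 1) x) + (S j + T j)) := by
      calc _ = _ := add_comm _ _
        _ ≤ _ := a1
        _ ≤ (∫⁻ x, (w x * w x) * K.Jop j (D.indicator fun _ => 1) x) +
            ((K.m j * ∫⁻ x, w x * r x) + T j) + S j := by
            gcongr
            exact e4.trans a2
        _ = _ := by ring
    exact (ENNReal.add_le_add_iff_left f2).1 ((ENNReal.add_le_add_iff_left f1).1 this)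
  have main0 : ∀ j, ∫⁻ x, (w x * w x) * K.Jop 0 (Dᶜ.indicator fun _ => 1) x ≤ S j + T j := by
    intro j
    refine le_trans (lintegral_mono fun x => mul_le_mul_right ?_ _) (main j)
    exact lintegral_mono fun z => mul_le_mul_left (K.J_mono (Nat.zero_le j) _) _
  have hz : ∫⁻ x, (w x * w x) * K.Jop 0 (Dᶜ.indicator fun _ => 1) x = 0 := by
    have := hSl.add hTl
    rw [add_zero] at this
    exact le_antisymm (ge_of_tendsto' this main0) zero_le
  rw [lintegral_eq_zero_iff (hww.fun_mul (K.Jop_meas 0 (measurable_const.indicator hD.compl)))] at hz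
  filter_upwards [hz] with x hx
  simp only [Pi.zero_apply, mul_eq_zero, or_self] at hx
  rcases hx with hx | hx
  · exact tsub_eq_zero_iff_le.1 hx
  · exact absurd hx (K.Jop_ind_pos 0 hD.compl hDc x).ne'

lemma sdist_bound (μ ν σ : Measure (Rn n)) [SFinite μ] [SFinite ν] [SFinite σ]
    (hμ : energy (riesz n α) μ μ < ⊤) (hν : energy (riesz n α) ν ν < ⊤)
    (s : ℝ) (hs : 0 < s) (hd : sDist (riesz n α) μ ν < s) (hK : Nonempty (Kit n α)) :
    energy (riesz n α) σ ν ≤ energy (riesz n α) σ μ + ENNReal.ofReal s * (1 + energy (riesz n α) σ σ) := by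
  obtain ⟨K⟩ := hK
  set t := ENNReal.ofReal s with ht
  have ht0 : t ≠ 0 := by simpa [ht] using hs
  have htt : t ≠ ⊤ := ENNReal.ofReal_ne_top
  have h0 := K.PD μ ν inferInstance inferInstance
  have hμν : energy (riesz n α) μ ν ≠ ⊤ := by
    intro h; rw [h] at h0
    have : energy (riesz n α) μ μ + energy (riesz n α) ν ν < ⊤ := ENNReal.add_lt_top.2 ⟨hμ, hν⟩
    rw [ENNReal.mul_top (by norm_num)] at h0
    exact absurd h0 (not_le.2 this)
  have h1 := K.PD (μ + t • σ) ν inferInstance inferInstance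
  have h2 : energy (riesz n α) μ μ + energy (riesz n α) ν ν ≤ 2 * energy (riesz n α) μ ν + t * t := by
    have : (energy (riesz n α) μ μ).toReal + (energy (riesz n α) ν ν).toReal
        - 2 * (energy (riesz n α) μ ν).toReal ≤ s * s := by
      unfold sDist at hd
      rw [Real.sqrt_lt' hs] at hd
      nlinarith
    have h5 : 2 * energy (riesz n α) μ ν ≠ ⊤ := ENNReal.mul_ne_top (by norm_num) hμν
    have h6 : t * t ≠ ⊤ := ENNReal.mul_ne_top htt htt
    rw [← ENNReal.toReal_le_toReal (ENNReal.add_ne_top.2 ⟨hμ.ne, hν.ne⟩) (ENNReal.add_ne_top.2 ⟨h5, h6⟩),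
      ENNReal.toReal_add hμ.ne hν.ne, ENNReal.toReal_add h5 h6, ENNReal.toReal_mul, ENNReal.toReal_mul,
      ht, ENNReal.toReal_ofReal hs.le, ENNReal.toReal_ofNat]
    linarith
  simp only [energy_add_left, energy_add_right, energy_smul_left, energy_smul_right _ _ htt] at h1
  rw [energy_symm n α μ σ] at h1
  set a := energy (riesz n α) σ ν
  set b := energy (riesz n α) σ μ
  set d := energy (riesz n α) σ σ
  set c := energy (riesz n α) μ ν
  have h3 : 2 * c + (2 * t) * a ≤ 2 * c + (2 * t) * (b + t * (1 + d)) := by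
    calc 2 * c + (2 * t) * a = 2 * (c + t * a) := by ring
      _ ≤ _ := h1
      _ = (energy (riesz n α) μ μ + energy (riesz n α) ν ν) + (2 * t * b + t * t * d) := by ring
      _ ≤ (2 * c + t * t) + (2 * t * b + t * t * d) := by gcongr
      _ ≤ (2 * c + t * t) + (2 * t * b + t * t * d) + (t * t + t * t * d) := le_self_add
      _ = _ := by ring
  have h4 := (ENNReal.add_le_add_iff_left (ENNReal.mul_ne_top (by norm_num) hμν)).1 h3
  exact (ENNReal.mul_le_mul_iff_right (mul_ne_zero (by norm_num) ht0) (ENNReal.mul_ne_top (by norm_num) htt)).1 h4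

lemma sDist_symm (μ ν : Measure (Rn n)) [SFinite μ] [SFinite ν] :
    sDist (riesz n α) μ ν = sDist (riesz n α) ν μ := by
  unfold sDist
  rw [energy_symm n α μ ν, add_comm (energy (riesz n α) μ μ).toReal]

lemma energy_wd {w : Rn n → ℝ≥0∞} (hw : Measurable w) (ν : Measure (Rn n)) [SFinite ν] :
    energy (riesz n α) (volume.withDensity w) ν = ∫⁻ x, w x * V n α ν x := by
  unfold energy
  rw [lintegral_withDensity_eq_lintegral_mul _ hw (V_meas n α ν)]
  rfl

lemma V_wd {w : Rn n → ℝ≥0∞} (hw : Measurable w) (x : Rn n) :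
    V n α (volume.withDensity w) x = ∫⁻ z, w z * riesz n α x z := by
  unfold V potential
  rw [lintegral_withDensity_eq_lintegral_mul _ hw (riesz_measR x)]
  rfl

/-- potentials of `J w` -/
lemma Kit.V_Jw (j : ℕ) {w : Rn n → ℝ≥0∞} (hw : Measurable w) (x : Rn n) :
    V n α (volume.withDensity (K.Jop j w)) x ≤ K.m j * V n α (volume.withDensity w) x := by
  rw [V_wd hw, V_wd (K.Jop_meas j hw)]
  simp_rw [riesz_symm n α x]
  have h := K.Jop_symm j (f := w) (g := fun z => riesz n α z x) hw (riesz_measL x)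
  simp_rw [mul_comm (K.Jop j w _)]
  rw [h, ← lintegral_const_mul _ (hw.fun_mul (riesz_measL x))]
  refine lintegral_mono fun z => ?_
  rw [mul_left_comm]
  refine mul_le_mul_right ?_ _
  rw [K.K2]; exact le_self_add

/-- measures of `E'(A)` are carried by the closed set `A` -/
lemma Kit.M1 (K : Kit n α) (hn : 0 < n) (h0 : 0 < α) (hαn : α < n) (A : Set (Rn n)) (hA : IsClosed A)
    (μ : Measure (Rn n)) (hμ : memEClos (riesz n α) A μ) : μ Aᶜ = 0 := by
  obtain ⟨⟨hreg, hE⟩, happ⟩ := hμ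
  have hreg' : μ.Regular := hreg
  have hE' : energy (riesz n α) μ μ < ⊤ := hE
  obtain ⟨cB, hcB, hB⟩ := riesz_int_bound (n := n) (α := α) hn h0 hαn
  refine measure_null_of_locally_null _ fun x hx => ?_
  obtain ⟨δ, hδ, hball⟩ := Metric.isOpen_iff.1 hA.isOpen_compl x hx
  refine ⟨Metric.ball x (δ/2), mem_nhdsWithin_of_mem_nhds (Metric.ball_mem_nhds x (by positivity)), ?_⟩
  set U := Metric.ball x (δ/2) with hU
  have hUm : MeasurableSet U := Metric.isOpen_ball.measurableSet
  set w : Rn n → ℝ≥0∞ := U.indicator fun _ => 1 with hwdef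
  have hw : Measurable w := measurable_const.indicator hUm
  have hUv : volume U ≠ ⊤ := measure_ball_lt_top.ne
  have hdist : ∀ z ∈ A, ∀ y, w y ≠ 0 → δ/2 ≤ dist z y := by
    intro z hz y hy
    have hyU : y ∈ U := by by_contra h; exact hy (by simp [hwdef, h])
    have h1 : dist y x < δ/2 := hyU
    have h2 : δ ≤ dist z x := by
      by_contra h; push Not at h
      exact hball h hz
    have := dist_triangle z y x
    linarith
  set σ := (volume : Measure (Rn n)).withDensity w with hσ
  have hVσ : ∀ y, V n α σ y ≤ cB + volume U := by
    intro y
    rw [hσ, V_wd hw]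
    calc _ = ∫⁻ z in U, riesz n α y z := by
          rw [← lintegral_indicator hUm]; apply lintegral_congr; intro z
          by_cases hz : z ∈ U <;> simp [hwdef, hz]
      _ ≤ _ := hB y U hUm
  have hσs : SFinite σ := by rw [hσ]; infer_instance
  have hEσ : energy (riesz n α) σ σ < ⊤ := by
    rw [hσ, energy_wd hw, ← hσ]
    calc _ ≤ ∫⁻ y, w y * (cB + volume U) := lintegral_mono fun y => mul_le_mul_right (hVσ y) _
      _ = volume U * (cB + volume U) := by
          rw [lintegral_mul_const _ hw]; simp [hwdef, hUm]
      _ < ⊤ := ENNReal.mul_lt_top hUv.lt_top (ENNReal.add_lt_top.2 ⟨hcB.lt_top, hUv.lt_top⟩)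
  have hfin2 : ∀ τ : Measure (Rn n), SFinite τ → energy (riesz n α) τ τ < ⊤ → energy (riesz n α) τ μ < ⊤ := by
    intro τ _ hτ
    have := K.PD τ μ inferInstance inferInstance
    have h2 : 2 * energy (riesz n α) τ μ < ⊤ := lt_of_le_of_lt this (ENNReal.add_lt_top.2 ⟨hτ, hE'⟩)
    by_contra h
    rw [not_lt, top_le_iff] at h
    rw [h, ENNReal.mul_top (by norm_num)] at h2
    exact lt_irrefl _ h2
  have main : ∀ j, ∫⁻ y, K.Hop j w y ∂μ ≤ K.e j * ENNReal.ofReal ((δ/2) ^ (-2:ℝ)) * energy (riesz n α) σ μ := by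
    intro j
    set τ := (volume : Measure (Rn n)).withDensity (K.Jop j w) with hτ
    have hτs : SFinite τ := by rw [hτ]; infer_instance
    have hEτ : energy (riesz n α) τ τ < ⊤ := by
      have hs1 : energy (riesz n α) τ σ ≤ K.m j * energy (riesz n α) σ σ := by
        rw [energy_symm n α τ σ]
        unfold energy
        rw [← lintegral_const_mul _ (V_meas n α σ)]
        exact lintegral_mono fun y => K.V_Jw j hw y
      have hs2 : energy (riesz n α) τ τ ≤ K.m j * energy (riesz n α) τ σ := by
        unfold energy
        rw [← lintegral_const_mul _ (V_meas n α σ)]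
        exact lintegral_mono fun y => K.V_Jw j hw y
      refine lt_of_le_of_lt (hs2.trans (mul_le_mul_right hs1 _)) ?_
      exact ENNReal.mul_lt_top (K.m_top j).lt_top (ENNReal.mul_lt_top (K.m_top j).lt_top hEσ)
    have hkv : ∀ ν : Measure (Rn n), SFinite ν → K.m j * energy (riesz n α) σ ν =
        energy (riesz n α) τ ν + ∫⁻ y, K.Hop j w y ∂ν := by
      intro ν _
      rw [hσ, hτ, energy_wd hw, energy_wd (K.Jop_meas j hw), K.KVw j ν hw, K.Jop_symm j (V_meas n α ν) hw]
      congr 1; apply lintegral_congr; intro y; rw [mul_comm]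
    set C := K.e j * ENNReal.ofReal ((δ/2) ^ (-2:ℝ)) with hC
    have hCt : C ≠ ⊤ := ENNReal.mul_ne_top (K.e_top j) ENNReal.ofReal_ne_top
    set a := 1 + energy (riesz n α) τ τ
    set b := 1 + energy (riesz n α) σ σ
    have hat : a ≠ ⊤ := ENNReal.add_ne_top.2 ⟨by simp, hEτ.ne⟩
    have hbt : b ≠ ⊤ := ENNReal.add_ne_top.2 ⟨by simp, hEσ.ne⟩
    have step : ∀ s : ℝ, 0 < s → ∫⁻ y, K.Hop j w y ∂μ ≤ C * energy (riesz n α) σ μ +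
        ENNReal.ofReal s * (a + C * b + K.m j * b) := by
      intro s hs
      obtain ⟨ν, ⟨⟨hνr, hνE⟩, hνA⟩, hd⟩ := happ s hs
      have hνr' : ν.Regular := hνr
      have hνE' : energy (riesz n α) ν ν < ⊤ := hνE
      have hd' : sDist (riesz n α) ν μ < s := by rw [sDist_symm]; exact hd
      have b1 := sdist_bound ν μ σ hνE' hE' s hs hd' ⟨K⟩
      have b2 := sdist_bound μ ν τ hE' hνE' s hs hd ⟨K⟩
      have b3 := sdist_bound μ ν σ hE' hνE' s hs hd ⟨K⟩
      have b4 : ∫⁻ y, K.Hop j w y ∂ν ≤ C * energy (riesz n α) σ ν := by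
        rw [energy_symm n α σ ν]
        unfold energy
        rw [← lintegral_const_mul _ (V_meas n α σ)]
        apply lintegral_mono_ae
        have : ∀ᵐ y ∂ν, y ∈ A := hνA
        filter_upwards [this] with y hy
        refine (K.Hfar j hw y (by positivity) (hdist y hy)).trans (le_of_eq ?_)
        rw [V_wd hw, hC]
        congr 1; apply lintegral_congr; intro z; rw [mul_comm]
      have hτμ := hfin2 τ hτs hEτ
      have : energy (riesz n α) τ μ + ∫⁻ y, K.Hop j w y ∂μ ≤ energy (riesz n α) τ μ +
        (C * energy (riesz n α) σ μ + ENNReal.ofReal s * (a + C * b + K.m j * b)) := by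
        calc _ = K.m j * energy (riesz n α) σ μ := (hkv μ inferInstance).symm
          _ ≤ K.m j * (energy (riesz n α) σ ν + ENNReal.ofReal s * b) := mul_le_mul_right b1 _
          _ = energy (riesz n α) τ ν + (∫⁻ y, K.Hop j w y ∂ν) + K.m j * (ENNReal.ofReal s * b) := by
              rw [mul_add, hkv ν inferInstance]
          _ ≤ (energy (riesz n α) τ μ + ENNReal.ofReal s * a) +
              (C * (energy (riesz n α) σ μ + ENNReal.ofReal s * b)) + K.m j * (ENNReal.ofReal s * b) := by
              gcongr
              exact b4.trans (mul_le_mul_right b3 _)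
          _ = _ := by ring
      exact (ENNReal.add_le_add_iff_left hτμ.ne).1 this
    have hlim : Tendsto (fun k : ℕ => C * energy (riesz n α) σ μ +
        ENNReal.ofReal (1 / ((k:ℝ) + 1)) * (a + C * b + K.m j * b)) atTop (𝓝 (C * energy (riesz n α) σ μ)) := by
      have h1 : Tendsto (fun k : ℕ => ENNReal.ofReal (1 / ((k:ℝ) + 1))) atTop (𝓝 0) := by
        have := ENNReal.tendsto_ofReal (tendsto_one_div_add_atTop_nhds_zero_nat (𝕜 := ℝ))
        simpa using this
      have h2 := ENNReal.Tendsto.mul_const (b := a + C * b + K.m j * b) h1 (Or.inr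
        (ENNReal.add_ne_top.2 ⟨ENNReal.add_ne_top.2 ⟨hat, ENNReal.mul_ne_top hCt hbt⟩,
          ENNReal.mul_ne_top (K.m_top j) hbt⟩))
      have h3 := (tendsto_const_nhds (x := C * energy (riesz n α) σ μ)).add h2
      simpa using h3
    exact ge_of_tendsto' hlim fun k => step _ (by positivity)
  have hlim : Tendsto (fun j => ∫⁻ y, K.Hop j w y ∂μ) atTop (𝓝 0) := by
    have h1 : Tendsto (fun j => K.e j * (ENNReal.ofReal ((δ/2) ^ (-2:ℝ)) * energy (riesz n α) σ μ)) atTop (𝓝 0) := by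
      have := ENNReal.Tendsto.mul_const (b := ENNReal.ofReal ((δ/2) ^ (-2:ℝ)) * energy (riesz n α) σ μ) K.e_lim
        (Or.inr (ENNReal.mul_ne_top ENNReal.ofReal_ne_top (hfin2 σ hσs hEσ).ne))
      simpa using this
    refine tendsto_of_tendsto_of_tendsto_of_le_of_le tendsto_const_nhds h1 (fun j => zero_le) fun j => ?_
    rw [← mul_assoc]
    exact main j
  have hfat : ∫⁻ y, U.indicator (fun _ => K.Θ univ) y ∂μ ≤ 0 := by
    calc _ ≤ ∫⁻ y, liminf (fun j => K.Hop j w y) atTop ∂μ :=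
          lintegral_mono fun y => K.Hliminf_open Metric.isOpen_ball y
      _ ≤ liminf (fun j => ∫⁻ y, K.Hop j w y ∂μ) atTop := lintegral_liminf_le fun j => K.Hop_meas j hw
      _ = 0 := hlim.liminf_eq
  rw [lintegral_indicator hUm] at hfat
  simp only [lintegral_const, Measure.restrict_apply MeasurableSet.univ, univ_inter, nonpos_iff_eq_zero,
    mul_eq_zero] at hfat
  exact hfat.resolve_left (K.Θ_open univ isOpen_univ univ_nonempty).ne'
end

lemma lsc_min {f g : ℕ → ℝ≥0∞} {a b : ℝ≥0∞} (ha : a ≤ liminf f atTop) (hb : b ≤ liminf g atTop) :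
    min a b ≤ liminf (fun j => min (f j) (g j)) atTop := by
  refine le_of_forall_lt fun c hc => ?_
  obtain ⟨d, hcd, hd⟩ := exists_between hc
  refine lt_of_lt_of_le hcd ?_
  refine le_liminf_of_le ?_ ?_
  · isBoundedDefault
  have h1 := eventually_lt_of_lt_liminf (lt_of_lt_of_le (lt_of_lt_of_le hd (min_le_left _ _)) ha)
  have h2 := eventually_lt_of_lt_liminf (lt_of_lt_of_le (lt_of_lt_of_le hd (min_le_right _ _)) hb)
  filter_upwards [h1, h2] with j hj1 hj2
  exact le_min hj1.le hj2.le

structure Ctx (n : ℕ) (α : ℝ) (D : Set (Rn n)) (ε : Rn n → Measure (Rn n)) : Prop where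
  hn : 0 < n
  h0 : 0 < α
  hαn : α < n
  hDo : IsOpen D
  hDb : Bornology.IsBounded D
  hε : ∀ y ∈ D, IsInnerBalayage (riesz n α) Dᶜ (Measure.dirac y) (ε y)

section
variable {n : ℕ} {α : ℝ} (K : Kit n α) {D : Set (Rn n)} {ε : Rn n → Measure (Rn n)}

lemma Ctx.volD (C : Ctx n α D ε) : volume D ≠ ⊤ := C.hDb.measure_lt_top.ne

lemma Ctx.volDc (C : Ctx n α D ε) : volume Dᶜ ≠ 0 := by
  have : Nonempty (Fin n) := ⟨⟨0, C.hn⟩⟩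
  have h1 : (volume : Measure (Rn n)) univ = ⊤ := by simp
  rw [← measure_add_measure_compl C.hDo.measurableSet] at h1
  intro h
  rw [h, add_zero] at h1
  exact C.volD h1

lemma Ctx.reg (C : Ctx n α D ε) {y : Rn n} (hy : y ∈ D) : (ε y).Regular := (C.hε y hy).1.1.1
lemma Ctx.en (C : Ctx n α D ε) {y : Rn n} (hy : y ∈ D) : energy (riesz n α) (ε y) (ε y) < ⊤ := (C.hε y hy).1.1.2

lemma Ctx.conc (K : Kit n α) (C : Ctx n α D ε) {y : Rn n} (hy : y ∈ D) : ∀ᵐ z ∂ε y, z ∉ D := by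
  have := K.M1 C.hn C.h0 C.hαn Dᶜ C.hDo.isClosed_compl (ε y) (C.hε y hy).1
  exact this

lemma Ctx.Sset (C : Ctx n α D ε) {y : Rn n} (hy : y ∈ D) :
    MeasurableSet {x ∈ Dᶜ | V n α (ε y) x ≠ riesz n α x y} ∧
    innerCap (riesz n α) {x ∈ Dᶜ | V n α (ε y) x ≠ riesz n α x y} = 0 := by
  have := C.reg hy
  constructor
  · exact C.hDo.measurableSet.compl.inter (measurableSet_eq_fun (V_meas n α (ε y)) (riesz_measL y)).compl
  · have := (C.hε y hy).2
    simp_rw [← V_dirac n α y]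
    exact this

lemma Ctx.M2 (K : Kit n α) (C : Ctx n α D ε) {x y : Rn n} (hx : x ∈ D) (hy : y ∈ D) :
    ∀ᵐ z ∂ε x, V n α (ε y) z = riesz n α z y := by
  obtain ⟨h1, h2⟩ := C.Sset hy
  have h3 := cap_null _ (ε x) (C.reg hx) (C.en hx) _ h1 h2
  have h4 : ∀ᵐ z ∂ε x, ¬ (z ∈ {x ∈ Dᶜ | V n α (ε y) x ≠ riesz n α x y}) := measure_eq_zero_iff_ae_notMem.1 h3
  filter_upwards [h4, C.conc K hx] with z hz hzD
  by_contra hne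
  exact hz ⟨hzD, hne⟩

lemma Ctx.M2v (C : Ctx n α D ε) {y : Rn n} (hy : y ∈ D) :
    ∀ᵐ z, z ∉ D → V n α (ε y) z = riesz n α z y := by
  obtain ⟨h1, h2⟩ := C.Sset hy
  have h3 := cap_null_vol C.hn C.h0 C.hαn _ h1 h2
  have h4 : ∀ᵐ z, ¬ (z ∈ {x ∈ Dᶜ | V n α (ε y) x ≠ riesz n α x y}) := measure_eq_zero_iff_ae_notMem.1 h3
  filter_upwards [h4] with z hz hzD
  by_contra hne
  exact hz ⟨hzD, hne⟩

lemma Ctx.M3 (K : Kit n α) (C : Ctx n α D ε) {y : Rn n} (hy : y ∈ D) {r : ℝ} (hr : 0 < r) (hb : Metric.ball y r ⊆ D)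
    (x : Rn n) : V n α (ε y) x ≤ ENNReal.ofReal (2 ^ ((n:ℝ) - α)) * ENNReal.ofReal (r ^ (α - n)) := by
  apply riesz_ball_bound C.hαn
  filter_upwards [C.M2 K hy hy, C.conc K hy] with z hz hzD
  rw [hz]
  apply riesz_le C.hαn hr
  by_contra h
  push Not at h
  exact hzD (hb h)

lemma Ctx.M3' (K : Kit n α) (C : Ctx n α D ε) {y : Rn n} (hy : y ∈ D) :
    ∃ M : ℝ≥0∞, M ≠ ⊤ ∧ ∀ x, V n α (ε y) x ≤ M := by
  obtain ⟨r, hr, hb⟩ := Metric.isOpen_iff.1 C.hDo y hy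
  exact ⟨_, ENNReal.mul_ne_top ENNReal.ofReal_ne_top ENNReal.ofReal_ne_top, C.M3 K hy hr hb⟩

lemma Ctx.Vtop (K : Kit n α) (C : Ctx n α D ε) {y : Rn n} (hy : y ∈ D) (x : Rn n) : V n α (ε y) x ≠ ⊤ := by
  obtain ⟨M, hM, h⟩ := C.M3' K hy
  exact ne_top_of_le_ne_top hM (h x)

lemma riesz_tendsto (hαn : α < n) (y : Rn n) {p : ℕ → Rn n} {x : Rn n} (hp : Tendsto p atTop (𝓝 x)) :
    Tendsto (fun j => riesz n α (p j) y) atTop (𝓝 (riesz n α x y)) :=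
  ((riesz_cont hαn).tendsto (x, y)).comp (hp.prodMk_nhds tendsto_const_nhds)

lemma Kit.Hriesz_tendsto {x y : Rn n} (h : x ≠ y) :
    Tendsto (fun j => K.Hop j (fun z => riesz n α z y) x) atTop (𝓝 (K.Θ univ * riesz n α x y)) :=
  K.limb x y h

lemma Kit.c_pos : K.Θ univ ≠ 0 := (K.Θ_open univ isOpen_univ univ_nonempty).ne'

lemma Ctx.M4 (K : Kit n α) (C : Ctx n α D ε) {y : Rn n} (hy : y ∈ D) (x : Rn n) : V n α (ε y) x ≤ riesz n α x y := by
  have := C.reg hy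
  have hVm := V_meas n α (ε y)
  have hRm := riesz_measL (n := n) (α := α) y
  have hae : ∀ᵐ x, V n α (ε y) x ≤ riesz n α x y := by
    obtain ⟨M, hM, hVM⟩ := C.M3' K hy
    set w : Rn n → ℝ≥0∞ := fun x => V n α (ε y) x - riesz n α x y with hwdef
    have hw : Measurable w := hVm.sub hRm
    refine K.dom C.hDo.measurableSet C.volD C.volDc hVm hRm hM hVM ?_
      (fun j => ∫⁻ z, K.Hop j w z ∂ε y) (fun _ => 0) ?_ ?_ ?_ tendsto_const_nhds
    · filter_upwards [C.M2v hy] with z hz hzD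
      exact (hz hzD).le
    · intro j
      exact (K.KVw j (ε y) hw).le
    · intro j
      rw [add_zero, ← lintegral_const_mul _ (hw.fun_mul hRm)]
      refine lintegral_mono fun z => ?_
      rw [mul_left_comm]
      refine mul_le_mul_right ?_ _
      rw [K.K2]; exact le_self_add
    · have h := tendsto_lintegral_of_dominated_convergence (μ := ε y) (F := fun j z => K.Hop j w z) (f := fun _ => 0)
        (fun z => K.A * V n α (ε y) z) (fun j => K.Hop_meas j hw) ?_ ?_ ?_
      · simpa using h
      · intro j
        refine ae_of_all _ fun z => ?_
        exact (K.Hop_mono j (ae_of_all _ fun z => tsub_le_self) z).trans (K.HV_le j (ε y) z)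
      · rw [lintegral_const_mul _ hVm]
        exact ENNReal.mul_ne_top K.A_top (C.en hy).ne
      · filter_upwards [C.M2 K hy hy] with z hz
        refine K.H_w_zero (r := fun z => min (V n α (ε y) z) (riesz n α z y)) (u := V n α (ε y))
          (hVm.min hRm) z ?_ (K.HV_tendsto (ε y) z (C.Vtop K hy z)) ?_ ?_ (C.Vtop K hy z)
        · refine ae_of_all _ fun x => ?_
          rcases le_total (V n α (ε y) x) (riesz n α x y) with h | h
          · simp only [hwdef, min_eq_left h, tsub_eq_zero_of_le h, zero_add]
          · simp only [hwdef, min_eq_right h, tsub_add_cancel_of_le h]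
        · apply K.Hliminf (hVm.min hRm)
          intro p hp
          exact lsc_min (V_lsc C.hαn _ _ p hp) (riesz_tendsto C.hαn y hp).liminf_eq.ge
        · simp [hz]
  by_cases hxy : x = y
  · rw [hxy, riesz_self]; exact le_top
  have h1 := K.HV_tendsto (ε y) x (C.Vtop K hy x)
  have h2 := K.Hriesz_tendsto hxy
  have h3 := le_of_tendsto_of_tendsto' h1 h2 fun j => K.Hop_mono j hae x
  exact (ENNReal.mul_le_mul_iff_right K.c_pos K.Θ_fin).1 h3

lemma Ctx.Vsymm (K : Kit n α) (C : Ctx n α D ε) {x y : Rn n} (hx : x ∈ D) (hy : y ∈ D) :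
    V n α (ε y) x = V n α (ε x) y := by
  have := C.reg hy
  have := C.reg hx
  have h : ∀ a ∈ D, ∀ b ∈ D, V n α (ε b) a = energy (riesz n α) (ε b) (ε a) := by
    intro a ha b hb
    unfold energy
    rw [show V n α (ε b) a = ∫⁻ z, riesz n α a z ∂ε b from rfl]
    apply lintegral_congr_ae
    filter_upwards [C.M2 K hb ha] with z hz
    rw [riesz_symm n α a z]; exact hz.symm
  rw [h x hx y hy, h y hy x hx, energy_symm]

lemma Ctx.Vcont (K : Kit n α) (C : Ctx n α D ε) {x y : Rn n} (hx : x ∈ D) (hy : y ∈ D) :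
    Tendsto (V n α (ε y)) (𝓝 x) (𝓝 (V n α (ε y) x)) := by
  obtain ⟨r, hr, hb⟩ := Metric.isOpen_iff.1 C.hDo x hx
  have hαn := C.hαn
  rw [show V n α (ε y) = fun x => ∫⁻ z, riesz n α x z ∂ε y from rfl]
  refine tendsto_lintegral_filter_of_dominated_convergence
    (fun z => ENNReal.ofReal (2 ^ ((n:ℝ) - α)) * riesz n α x z) ?_ ?_ ?_ ?_
  · exact Eventually.of_forall fun x' => riesz_measR x'
  · filter_upwards [Metric.ball_mem_nhds x (half_pos hr)] with x' hx'
    filter_upwards [C.conc K hy] with z hz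
    have h1 : r ≤ dist x z := by
      by_contra h; push Not at h
      exact hz (hb (by rw [Metric.mem_ball, dist_comm]; exact h))
    have h2 : dist x' x < r / 2 := hx'
    have h3 : dist x z ≤ 2 * dist x' z := by
      have := dist_triangle_left x z x'
      linarith
    have h4 : 0 < dist x z := by linarith
    refine (riesz_le (r := dist x z / 2) hαn (by positivity) (by linarith)).trans ?_
    unfold riesz
    rw [if_neg (dist_pos.1 h4), ← ENNReal.ofReal_mul (by positivity)]
    apply ENNReal.ofReal_le_ofReal
    rw [← dist_eq_norm, Real.div_rpow h4.le (by norm_num), div_eq_mul_inv, mul_comm,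
      ← Real.rpow_neg (by norm_num), neg_sub]
  · rw [lintegral_const_mul _ (riesz_measR x)]
    exact ENNReal.mul_ne_top ENNReal.ofReal_ne_top (C.Vtop K hy x)
  · refine ae_of_all _ fun z => ?_
    exact ((riesz_cont hαn).tendsto (x, z)).comp (tendsto_id.prodMk_nhds tendsto_const_nhds)

lemma green_off {x y : Rn n} (h : x ∉ D) : green n α D ε x y = 0 := by
  unfold green; rw [if_neg (fun h' => h h'.1)]
lemma green_off' {x y : Rn n} (h : y ∉ D) : green n α D ε x y = 0 := by
  unfold green; rw [if_neg (fun h' => h h'.2)]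
lemma green_on {x y : Rn n} (hx : x ∈ D) (hy : y ∈ D) : green n α D ε x y = riesz n α x y - V n α (ε y) x := by
  unfold green; rw [if_pos ⟨hx, hy⟩]; rfl

lemma green_le (x y : Rn n) : green n α D ε x y ≤ riesz n α x y := by
  unfold green; split_ifs
  · exact tsub_le_self
  · exact zero_le

lemma Ctx.g_eq (K : Kit n α) (C : Ctx n α D ε) {x y : Rn n} (hx : x ∈ D) (hy : y ∈ D) :
    green n α D ε x y + V n α (ε y) x = riesz n α x y := by
  rw [green_on hx hy, tsub_add_cancel_of_le (C.M4 K hy x)]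

lemma Ctx.g_ae (K : Kit n α) (C : Ctx n α D ε) {y : Rn n} (hy : y ∈ D) :
    ∀ᵐ x, green n α D ε x y + V n α (ε y) x = riesz n α x y := by
  filter_upwards [C.M2v hy] with x hx
  by_cases hxD : x ∈ D
  · exact C.g_eq K hxD hy
  · rw [green_off hxD, zero_add, hx hxD]

lemma Ctx.g_symm (K : Kit n α) (C : Ctx n α D ε) (x y : Rn n) :
    green n α D ε x y = green n α D ε y x := by
  by_cases hx : x ∈ D
  · by_cases hy : y ∈ D
    · rw [green_on hx hy, green_on hy hx, C.Vsymm K hx hy, riesz_symm]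
    · rw [green_off hy, green_off' hy]
  · rw [green_off hx, green_off' hx]

lemma Ctx.g_tendsto (K : Kit n α) (C : Ctx n α D ε) {x : Rn n} (hx : x ∈ D) (y : Rn n) {p : ℕ → Rn n}
    (hp : Tendsto p atTop (𝓝 x)) :
    Tendsto (fun j => green n α D ε (p j) y) atTop (𝓝 (green n α D ε x y)) := by
  by_cases hy : y ∈ D
  · rw [green_on hx hy]
    have h1 : Tendsto (fun j => riesz n α (p j) y - V n α (ε y) (p j)) atTop
        (𝓝 (riesz n α x y - V n α (ε y) x)) :=
      ENNReal.Tendsto.sub (riesz_tendsto C.hαn y hp) ((C.Vcont K hx hy).comp hp) (Or.inr (C.Vtop K hy x))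
    refine h1.congr' ?_
    filter_upwards [hp.eventually (C.hDo.mem_nhds hx)] with j hj
    rw [green_on hj hy]
  · simp [green_off' hy]

lemma Ctx.g_meas (K : Kit n α) (C : Ctx n α D ε) : Measurable fun p : Rn n × Rn n => green n α D ε p.1 p.2 := by
  have hD := C.hDo.measurableSet
  have h1 : Measurable (Function.uncurry fun (x : D) (y : D) => V n α (ε y.1) x.1) := by
    apply measurable_uncurry_of_continuous_of_measurable
    · intro y
      rw [continuous_iff_continuousAt]
      intro x
      exact (C.Vcont K x.2 y.2).comp continuous_subtype_val.continuousAt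
    · intro x
      have := C.reg x.2
      have h2 : (fun y : D => V n α (ε y.1) x.1) = fun y : D => V n α (ε x.1) y.1 := by
        ext y; exact C.Vsymm K x.2 y.2
      rw [h2]
      exact (V_meas n α (ε x.1)).comp measurable_subtype_coe
  refine measurable_of_restrict_of_restrict_compl (hD.prod hD) ?_ ?_
  · have : ((D ×ˢ D).domRestrict fun p : Rn n × Rn n => green n α D ε p.1 p.2) =
        fun p => riesz n α p.1.1 p.1.2 -
          (Function.uncurry fun (x : D) (y : D) => V n α (ε y.1) x.1) (⟨p.1.1, p.2.1⟩, ⟨p.1.2, p.2.2⟩) := by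
      ext p
      exact green_on p.2.1 p.2.2
    rw [this]
    refine ((riesz_meas n α).comp measurable_subtype_coe).sub (h1.comp ?_)
    exact (measurable_subtype_coe.fst.subtype_mk).prodMk (measurable_subtype_coe.snd.subtype_mk)
  · have : ((D ×ˢ D)ᶜ.domRestrict fun p : Rn n × Rn n => green n α D ε p.1 p.2) = fun p => 0 := by
      ext p
      have h := p.2
      simp only [domRestrict_apply]
      unfold green
      exact if_neg h
    rw [this]; exact measurable_const

lemma Ctx.g_measL (K : Kit n α) (C : Ctx n α D ε) (y : Rn n) : Measurable fun x => green n α D ε x y :=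
  (C.g_meas K).comp (measurable_id.prodMk measurable_const)
lemma Ctx.g_measR (K : Kit n α) (C : Ctx n α D ε) (x : Rn n) : Measurable fun y => green n α D ε x y :=
  (C.g_meas K).comp (measurable_const.prodMk measurable_id)

/-- the fundamental identity, pointwise -/
lemma Ctx.star0 (C : Ctx n α D ε) {y : Rn n} (hy : y ∈ D) (j : ℕ) :
    ∀ᵐ x, K.m j * green n α D ε x y + (∫⁻ z, K.H j (x - z) ∂ε y) =
      K.Jop j (fun x => green n α D ε x y) x + K.H j (x - y) := by
  have := C.reg hy
  have hae := C.g_ae K hy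
  filter_upwards [hae] with x hx
  have h1 := K.K2 j x y
  have h2 := K.KV j (ε y) x
  have h3 : (∫⁻ z, K.J j (x - z) * riesz n α z y) = K.Jop j (fun x => green n α D ε x y) x + K.Jop j (V n α (ε y)) x := by
    rw [← K.Jop_add j (C.g_measL K y)]
    apply K.Jop_congr j
    filter_upwards [hae] with z hz
    exact hz.symm
  rw [h3, ← hx, mul_add, h2] at h1
  have hfin : K.Jop j (V n α (ε y)) x ≠ ⊤ :=
    ne_top_of_le_ne_top (ENNReal.mul_ne_top (K.m_top j) (C.Vtop K hy x)) (K.JV_le j _ x)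
  refine (ENNReal.add_right_inj hfin).1 ?_
  calc _ = _ := by ring
    _ = _ := h1
    _ = _ := by ring

/-- the fundamental identity, paired with `w` -/
lemma Ctx.star (C : Ctx n α D ε) {y : Rn n} (hy : y ∈ D) (j : ℕ) {w : Rn n → ℝ≥0∞} (hw : Measurable w) :
    K.m j * (∫⁻ x, w x * green n α D ε x y) + ∫⁻ z, K.Hop j w z ∂ε y =
      (∫⁻ x, w x * K.Jop j (fun x => green n α D ε x y) x) + K.Hop j w y := by
  have := C.reg hy
  have hg := C.g_measL K y
  have e : K.Hop j w y = ∫⁻ x, w x * K.H j (x - y) := by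
    unfold Kit.Hop
    apply lintegral_congr; intro x
    rw [← K.H_neg, neg_sub, mul_comm]
  rw [e, ← K.Hmu_symm j hw, ← lintegral_const_mul _ (hw.fun_mul hg),
    ← lintegral_add_left ((hw.fun_mul hg).const_mul _),
    ← lintegral_add_left (hw.fun_mul (K.Jop_meas j hg))]
  apply lintegral_congr_ae
  filter_upwards [C.star0 K hy j] with x hx
  rw [mul_left_comm, ← mul_add, ← mul_add, hx]
end

section
variable {n : ℕ} {α : ℝ} {D : Set (Rn n)} {ε : Rn n → Measure (Rn n)}

lemma Ctx.Hg_le (K : Kit n α) (j : ℕ) (η x : Rn n) :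
    K.Hop j (fun z => green n α D ε z η) x ≤ K.A * riesz n α x η :=
  (K.Hop_mono j (ae_of_all _ fun z => green_le z η) x).trans (K.bda j x η)

lemma Ctx.M8a (K : Kit n α) (C : Ctx n α D ε) {η x : Rn n} (hη : η ∈ D) (hx : x ∈ D) (hne : x ≠ η) :
    Tendsto (fun j => K.Hop j (fun z => green n α D ε z η) x) atTop
      (𝓝 (K.Θ univ * green n α D ε x η)) := by
  have := C.reg hη
  have hV : ∀ j, K.Hop j (V n α (ε η)) x ≠ ⊤ := fun j =>
    ne_top_of_le_ne_top (ENNReal.mul_ne_top K.A_top (C.Vtop K hη x)) (K.HV_le j (ε η) x)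
  have e : ∀ j, K.Hop j (fun z => green n α D ε z η) x =
      K.Hop j (fun z => riesz n α z η) x - K.Hop j (V n α (ε η)) x := by
    intro j
    rw [← K.Hop_congr j (C.g_ae K hη) x, K.Hop_add j (C.g_measL K η)]
    exact (ENNReal.add_sub_cancel_right (hV j)).symm
  simp_rw [e]
  have h3 : K.Θ univ * green n α D ε x η = K.Θ univ * riesz n α x η - K.Θ univ * V n α (ε η) x := by
    rw [← C.g_eq K hx hη, mul_add, ENNReal.add_sub_cancel_right]
    exact ENNReal.mul_ne_top K.Θ_fin (C.Vtop K hη x)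
  rw [h3]
  exact ENNReal.Tendsto.sub (K.Hriesz_tendsto hne) (K.HV_tendsto (ε η) x (C.Vtop K hη x))
    (Or.inr (ENNReal.mul_ne_top K.Θ_fin (C.Vtop K hη x)))

lemma Ctx.M8b (K : Kit n α) (C : Ctx n α D ε) {η y : Rn n} (hη : η ∈ D) (hy : y ∈ D) :
    ∀ᵐ z ∂ε y, Tendsto (fun j => K.Hop j (fun z => green n α D ε z η) z) atTop (𝓝 0) := by
  have := C.reg hη
  filter_upwards [C.M2 K hy hη, C.conc K hy] with z hz hzD
  have hne : z ≠ η := fun h => hzD (h ▸ hη)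
  refine K.H_w_zero (r := V n α (ε η)) (u := fun z => riesz n α z η) (V_meas n α _) z (C.g_ae K hη)
    (K.Hriesz_tendsto hne) (K.HV_tendsto (ε η) z (C.Vtop K hη z)).liminf_eq.ge hz.symm
    (riesz_ne_top hne)

lemma Ctx.int_riesz (y η : Rn n) : ∫⁻ z, riesz n α z η ∂ε y = V n α (ε y) η := by
  apply lintegral_congr; intro z; exact riesz_symm n α z η

lemma Ctx.M8c (K : Kit n α) (C : Ctx n α D ε) {η y : Rn n} (hη : η ∈ D) (hy : y ∈ D) :
    Tendsto (fun j => ∫⁻ z, K.Hop j (fun z => green n α D ε z η) z ∂ε y) atTop (𝓝 0) := by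
  have h := tendsto_lintegral_of_dominated_convergence (μ := ε y)
    (F := fun j z => K.Hop j (fun z => green n α D ε z η) z) (f := fun _ => 0)
    (fun z => K.A * riesz n α z η) (fun j => K.Hop_meas j (C.g_measL K η)) ?_ ?_ ?_
  · simpa using h
  · exact fun j => ae_of_all _ fun z => Ctx.Hg_le K j η z
  · rw [lintegral_const_mul _ (riesz_measL η), Ctx.int_riesz]
    exact ENNReal.mul_ne_top K.A_top (C.Vtop K hy η)
  · exact C.M8b K hη hy

lemma Ctx.g_int (C : Ctx n α D ε) (y : Rn n) : ∫⁻ x, green n α D ε x y ≠ ⊤ := by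
  obtain ⟨c, hc, h⟩ := riesz_int_bound C.hn C.h0 C.hαn
  refine ne_top_of_le_ne_top (ENNReal.add_ne_top.2 ⟨hc, C.volD⟩) (le_trans ?_ (h y D C.hDo.measurableSet))
  rw [← lintegral_indicator C.hDo.measurableSet]
  refine lintegral_mono fun x => ?_
  by_cases hx : x ∈ D
  · rw [indicator_of_mem hx, riesz_symm n α y x]; exact green_le x y
  · rw [green_off hx]; exact zero_le

lemma Ctx.M10a (K : Kit n α) (C : Ctx n α D ε) {y : Rn n} (hy : y ∈ D) (j : ℕ) :
    (∫⁻ x, green n α D ε x y * K.Jop j (Dᶜ.indicator fun _ => 1) x) +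
      ∫⁻ z, K.Hop j (D.indicator fun _ => 1) z ∂ε y = K.Hop j (D.indicator fun _ => 1) y := by
  have hD := C.hDo.measurableSet
  have h1 : Measurable (D.indicator fun _ : Rn n => (1:ℝ≥0∞)) := measurable_const.indicator hD
  have h2 : Measurable (Dᶜ.indicator fun _ : Rn n => (1:ℝ≥0∞)) := measurable_const.indicator hD.compl
  have hg := C.g_measL K y
  have h := C.star K hy j h1
  rw [K.Jop_symm j hg h1] at h
  have e : ∫⁻ x, D.indicator (fun _ => 1) x * green n α D ε x y = ∫⁻ x, green n α D ε x y := by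
    apply lintegral_congr; intro x
    by_cases hx : x ∈ D
    · simp [hx]
    · simp [hx, green_off hx]
  have e2 : K.m j * ∫⁻ x, green n α D ε x y =
      (∫⁻ x, green n α D ε x y * K.Jop j (D.indicator fun _ => 1) x) +
      ∫⁻ x, green n α D ε x y * K.Jop j (Dᶜ.indicator fun _ => 1) x := by
    rw [← lintegral_add_left (hg.fun_mul (K.Jop_meas j h1)), ← lintegral_const_mul _ hg]
    apply lintegral_congr; intro x
    rw [← mul_add, K.Jop_ind j hD, mul_comm]
  have hfin : ∫⁻ x, green n α D ε x y * K.Jop j (D.indicator fun _ => 1) x ≠ ⊤ :=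
    ne_top_of_le_ne_top (ENNReal.mul_ne_top (K.m_top j) (C.g_int y)) (e2 ▸ le_self_add)
  rw [e, e2, add_assoc] at h
  exact (ENNReal.add_right_inj hfin).1 h

lemma Ctx.Hind_le (K : Kit n α) (j : ℕ) {U : Set (Rn n)} (hU : MeasurableSet U) (y : Rn n) :
    K.Hop j (U.indicator fun _ => 1) y ≤ K.Θ univ := by
  have := K.Hop_le_const j (f := U.indicator fun _ => 1) (measurable_const.indicator hU) (M := 1)
    (fun x => indicator_le_self' (fun _ _ => zero_le) x) y
  simpa using this

lemma ind_fin (hn : 0 < n) (h0 : 0 < α) (hαn : α < n) (z : Rn n) {U : Set (Rn n)} (hU : MeasurableSet U) (hv : volume U ≠ ⊤) :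
    ∫⁻ x, riesz n α z x * U.indicator (fun _ => 1) x ≠ ⊤ := by
  obtain ⟨c, hc, h⟩ := riesz_int_bound hn h0 hαn
  refine ne_top_of_le_ne_top (ENNReal.add_ne_top.2 ⟨hc, hv⟩) (le_trans (le_of_eq ?_) (h z U hU))
  rw [← lintegral_indicator hU]
  apply lintegral_congr; intro x
  by_cases hx : x ∈ U <;> simp [hx]

/-- Exterior collar of `D`. -/
def collar (D : Set (Rn n)) (k : ℕ) : Set (Rn n) := (closure D)ᶜ ∩ Metric.thickening (1 / ((k:ℝ) + 1)) D

lemma collar_open (k : ℕ) : IsOpen (collar D k) :=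
  isClosed_closure.isOpen_compl.inter Metric.isOpen_thickening

lemma collar_anti : Antitone (collar D) := by
  intro a b hab
  apply inter_subset_inter_right
  apply Metric.thickening_mono
  apply one_div_le_one_div_of_le (by positivity)
  have : (a:ℝ) ≤ b := by exact_mod_cast hab
  linarith

lemma collar_inter : ⋂ k, collar D k = ∅ := by
  rw [eq_empty_iff_forall_notMem]
  intro x hx
  rw [mem_iInter] at hx
  apply (hx 0).1
  rw [Metric.mem_closure_iff]
  intro δ hδ
  obtain ⟨k, hk⟩ := exists_nat_one_div_lt hδ
  obtain ⟨z, hz, hd⟩ := Metric.mem_thickening_iff.1 (hx k).2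
  exact ⟨z, hz, hd.trans hk⟩

lemma collar_compl (k : ℕ) : collar D k ⊆ Dᶜ := fun _ hx h => hx.1 (subset_closure h)

lemma Ctx.collar_pt (K : Kit n α) (h11 : C11 n D) {z : Rn n} (hz : z ∈ frontier D) :
    ∃ t : ℝ≥0∞, 0 < t ∧ ∀ k, t ≤ liminf (fun j => K.Hop j ((collar D k).indicator fun _ => 1) z) atTop := by
  obtain ⟨-, x', r, hr, -, hb, -, hd⟩ := h11 z hz
  set U : Set (Rn n) := {u | 0 < inner ℝ u (x' - z)} with hU
  have hUo : IsOpen U := isOpen_lt continuous_const (continuous_id.inner continuous_const)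
  have hxz : 0 < ‖x' - z‖ := by rw [← dist_eq_norm, dist_comm, hd]; exact hr
  have hUn : U.Nonempty := ⟨x' - z, by
    rw [hU, mem_setOf_eq, real_inner_self_eq_norm_sq]; positivity⟩
  refine ⟨K.Θ U, K.Θ_open U hUo hUn, fun k => ?_⟩
  have hNm := (collar_open (D := D) k).measurableSet
  have h1 : Measurable ((collar D k).indicator fun _ : Rn n => (1:ℝ≥0∞)) := measurable_const.indicator hNm
  simp_rw [K.Hop_eq _ h1]
  refine le_trans ?_ (lintegral_liminf_le fun j => h1.comp (by fun_prop))
  rw [← lintegral_indicator_one hUo.measurableSet]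
  refine lintegral_mono fun u => ?_
  by_cases hu : u ∈ U
  swap
  · rw [indicator_of_notMem hu]; exact zero_le
  have hev : ∀ᶠ j in atTop, z + K.s j • u ∈ collar D k := by
    have ha : ∀ᶠ j in atTop, z + K.s j • u ∈ Metric.thickening (1 / ((k:ℝ) + 1)) D := by
      apply (K.s_tendsto z u).eventually
      apply Metric.isOpen_thickening.mem_nhds
      exact Metric.closure_subset_thickening (by positivity) D (frontier_subset_closure hz)
    have hb' : ∀ᶠ j in atTop, K.s j * ‖u‖ ^ 2 < 2 * inner ℝ u (x' - z) := by
      have : Tendsto (fun j => K.s j * ‖u‖ ^ 2) atTop (𝓝 (0 * ‖u‖ ^ 2)) := K.s_lim.mul_const _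
      rw [zero_mul] at this
      apply this.eventually_lt_const
      have : 0 < inner ℝ u (x' - z) := hu
      linarith
    filter_upwards [ha, hb'] with j hj1 hj2
    refine ⟨?_, hj1⟩
    have hin : z + K.s j • u ∈ Metric.ball x' r := by
      rw [Metric.mem_ball, dist_eq_norm]
      have hs := K.s_pos j
      have e : z + K.s j • u - x' = K.s j • u - (x' - z) := by abel
      rw [e]
      apply lt_of_pow_lt_pow_left₀ 2 hr.le
      rw [norm_sub_sq_real, norm_smul, inner_smul_left, mul_pow, Real.norm_eq_abs, sq_abs,
        ← dist_eq_norm x' z, dist_comm x' z, hd]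
      simp only [conj_trivial]
      nlinarith
    intro hcl
    obtain ⟨w, hw1, hw2⟩ := mem_closure_iff.1 hcl _ Metric.isOpen_ball hin
    exact hb hw1 hw2
  rw [indicator_of_mem hu]
  refine le_liminf_of_le (by isBoundedDefault) ?_
  filter_upwards [hev] with j hj
  simp [hj]

lemma Ctx.M9 (K : Kit n α) (C : Ctx n α D ε) (h11 : C11 n D) {y : Rn n} (hy : y ∈ D) :
    ∀ᵐ z ∂ε y, z ∉ frontier D := by
  have hD := C.hDo.measurableSet
  have hg := C.g_measL K y
  set ρ : Rn n → ℝ≥0∞ := fun x => ⨆ j, K.Jop j (fun x => green n α D ε x y) x with hρ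
  have hρm : Measurable ρ := Measurable.iSup fun j => K.Jop_meas j hg
  have h2 : Measurable (Dᶜ.indicator fun _ : Rn n => (1:ℝ≥0∞)) := measurable_const.indicator hD.compl
  have hρi : ∫⁻ x in Dᶜ, ρ x ≤ K.Θ univ := by
    rw [hρ, lintegral_iSup (fun j => K.Jop_meas j hg)]
    · apply iSup_le; intro j
      have e : ∫⁻ x in Dᶜ, K.Jop j (fun x => green n α D ε x y) x =
          ∫⁻ x, green n α D ε x y * K.Jop j (Dᶜ.indicator fun _ => 1) x := by
        rw [← K.Jop_symm j hg h2, ← lintegral_indicator hD.compl]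
        apply lintegral_congr; intro x
        by_cases hx : x ∈ Dᶜ
        · rw [indicator_of_mem hx, indicator_of_mem hx, one_mul]
        · rw [indicator_of_notMem hx, indicator_of_notMem hx, zero_mul]
      rw [e]
      refine le_trans ?_ (Ctx.Hind_le K j hD y)
      rw [← C.M10a K hy j]
      exact le_self_add
    · intro a b hab x
      exact lintegral_mono fun z => mul_le_mul_left (K.J_mono hab _) _
  set ν : Measure (Rn n) := (volume.restrict Dᶜ).withDensity ρ with hν
  have hνf : ν univ ≠ ⊤ := by
    rw [hν, withDensity_apply _ MeasurableSet.univ, Measure.restrict_univ]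
    exact ne_top_of_le_ne_top K.Θ_fin hρi
  have hτ : Tendsto (fun k => ν (collar D k)) atTop (𝓝 0) := by
    have := tendsto_measure_iInter_atTop (μ := ν) (s := collar D)
      (fun k => (collar_open k).measurableSet.nullMeasurableSet) collar_anti
      ⟨0, ne_top_of_le_ne_top hνf (measure_mono (subset_univ _))⟩
    rwa [collar_inter, measure_empty] at this
  set f : Rn n → ℝ≥0∞ := fun z => ⨅ k, liminf (fun j => K.Hop j ((collar D k).indicator fun _ => 1) z) atTop with hf
  have hNm : ∀ k, Measurable ((collar D k).indicator fun _ : Rn n => (1:ℝ≥0∞)) := fun k =>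
    measurable_const.indicator (collar_open k).measurableSet
  have hfm : Measurable f := Measurable.iInf fun k => Measurable.liminf fun j => K.Hop_meas j (hNm k)
  have hfk : ∀ k, ∫⁻ z, f z ∂ε y ≤ ν (collar D k) := by
    intro k
    refine (lintegral_mono fun z => iInf_le _ k).trans ?_
    refine (lintegral_liminf_le fun j => K.Hop_meas j (hNm k)).trans ?_
    have hb : ∀ j, ∫⁻ z, K.Hop j ((collar D k).indicator fun _ => 1) z ∂ε y ≤
        ν (collar D k) + K.Hop j ((collar D k).indicator fun _ => 1) y := by
      intro j
      have h := C.star K hy j (hNm k)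
      refine le_trans (h ▸ le_add_self) (add_le_add_left ?_ _)
      rw [hν, withDensity_apply _ (collar_open k).measurableSet,
        Measure.restrict_restrict (collar_open k).measurableSet, inter_eq_left.2 (collar_compl k),
        ← lintegral_indicator (collar_open k).measurableSet]
      refine lintegral_mono fun x => ?_
      by_cases hx : x ∈ collar D k
      · rw [indicator_of_mem hx, indicator_of_mem hx, one_mul]
        exact le_iSup (fun j => K.Jop j (fun x => green n α D ε x y) x) j
      · rw [indicator_of_notMem hx, indicator_of_notMem hx, zero_mul]
    refine (liminf_le_liminf (Eventually.of_forall hb)).trans ?_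
    have hlim : Tendsto (fun j => K.Hop j ((collar D k).indicator fun _ => 1) y) atTop (𝓝 0) := by
      obtain ⟨r, hr, hrb⟩ := Metric.isOpen_iff.1 C.hDo y hy
      refine K.Hfar_lim (hNm k) y hr ?_ (ind_fin C.hn C.h0 C.hαn y (collar_open k).measurableSet ?_)
      · intro x hx
        have hx' : x ∈ collar D k := by by_contra h; exact hx (indicator_of_notMem h _)
        by_contra h; push Not at h
        exact collar_compl k hx' (hrb (by rw [Metric.mem_ball, dist_comm]; exact h))
      · exact ((C.hDb.thickening).subset inter_subset_right).measure_lt_top.ne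
    have := (tendsto_const_nhds (x := ν (collar D k))).add hlim
    rw [add_zero] at this
    exact this.liminf_eq.le
  have hf0 : ∫⁻ z, f z ∂ε y = 0 := le_antisymm (ge_of_tendsto' hτ hfk) zero_le
  rw [lintegral_eq_zero_iff hfm] at hf0
  filter_upwards [hf0] with z hz hzf
  obtain ⟨t, ht, htk⟩ := Ctx.collar_pt K h11 hzf
  have : t ≤ f z := le_iInf htk
  rw [hz] at this
  exact absurd (lt_of_lt_of_le ht this) (lt_irrefl _)

/-- the killing density -/
noncomputable def Kit.kill (K : Kit n α) (D : Set (Rn n)) (x : Rn n) : ℝ≥0∞ :=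
  ⨆ j, K.Jop j (Dᶜ.indicator fun _ => 1) x

lemma Ctx.kill_meas (K : Kit n α) (C : Ctx n α D ε) : Measurable (K.kill D) :=
  Measurable.iSup fun j => K.Jop_meas j (measurable_const.indicator C.hDo.measurableSet.compl)

lemma Ctx.kill_pos (K : Kit n α) (C : Ctx n α D ε) (x : Rn n) : 0 < K.kill D x :=
  lt_of_lt_of_le (K.Jop_ind_pos 0 C.hDo.measurableSet.compl C.volDc x)
    (le_iSup (fun j => K.Jop j (Dᶜ.indicator fun _ => 1) x) 0)

lemma Ctx.M10b (K : Kit n α) (C : Ctx n α D ε) (h11 : C11 n D) {y : Rn n} (hy : y ∈ D) :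
    Tendsto (fun j => ∫⁻ z, K.Hop j (D.indicator fun _ => 1) z ∂ε y) atTop (𝓝 0) := by
  have hD := C.hDo.measurableSet
  have h1 : Measurable (D.indicator fun _ : Rn n => (1:ℝ≥0∞)) := measurable_const.indicator hD
  obtain ⟨R, hR⟩ := C.hDb.subset_ball y
  obtain ⟨B, hB, hBl⟩ : ∃ B : ℝ≥0∞, B ≠ ⊤ ∧ ∀ x ∈ D, 1 ≤ B * riesz n α x y := by
    have hRp : 0 < R := Metric.pos_of_mem_ball (hR hy)
    refine ⟨ENNReal.ofReal (R ^ ((n:ℝ) - α)), ENNReal.ofReal_ne_top, fun x hx => ?_⟩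
    unfold riesz
    split_ifs with h
    · rw [ENNReal.mul_top]
      · exact le_top
      · rw [Ne, ENNReal.ofReal_eq_zero, not_le]; positivity
    · rw [← ENNReal.ofReal_mul (by positivity), ENNReal.one_le_ofReal]
      have hp : 0 < ‖x - y‖ := norm_pos_iff.2 (sub_ne_zero.2 h)
      have hlt : ‖x - y‖ ≤ R := by rw [← dist_eq_norm]; exact (hR hx).le
      have h3 : R ^ (α - n) ≤ ‖x - y‖ ^ (α - n) :=
        Real.rpow_le_rpow_of_nonpos hp hlt (by linarith [C.hαn])
      calc (1:ℝ) = R ^ ((n:ℝ) - α) * R ^ (α - n) := by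
            rw [← Real.rpow_add hRp]; simp
        _ ≤ _ := by gcongr
  have h := tendsto_lintegral_of_dominated_convergence (μ := ε y)
    (F := fun j z => K.Hop j (D.indicator fun _ => 1) z) (f := fun _ => 0)
    (fun z => B * (K.A * riesz n α z y)) (fun j => K.Hop_meas j h1) ?_ ?_ ?_
  · simpa using h
  · intro j
    refine ae_of_all _ fun z => ?_
    refine le_trans ?_ (mul_le_mul_right (K.bda j z y) B)
    rw [← lintegral_const_mul _ ((K.H_measS j z).fun_mul (riesz_measL y))]
    refine lintegral_mono fun x => ?_
    rw [mul_left_comm]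
    refine mul_le_mul_right ?_ _
    by_cases hx : x ∈ D
    · rw [indicator_of_mem hx]; exact hBl x hx
    · rw [indicator_of_notMem hx]; exact zero_le
  · rw [lintegral_const_mul _ ((riesz_measL y).const_mul _), lintegral_const_mul _ (riesz_measL y), Ctx.int_riesz]
    exact ENNReal.mul_ne_top hB (ENNReal.mul_ne_top K.A_top (C.Vtop K hy y))
  · filter_upwards [C.conc K hy, C.M9 K h11 hy] with z hz1 hz2
    have hz : z ∈ (closure D)ᶜ := by
      intro h
      apply hz2
      rw [frontier, C.hDo.interior_eq]
      exact ⟨h, hz1⟩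
    obtain ⟨r, hr, hb⟩ := Metric.isOpen_iff.1 isClosed_closure.isOpen_compl z hz
    refine K.Hfar_lim h1 z hr ?_ (ind_fin C.hn C.h0 C.hαn z hD C.volD)
    intro x hx
    have hx' : x ∈ D := by by_contra h; exact hx (indicator_of_notMem h _)
    by_contra h; push Not at h
    exact hb (by rw [Metric.mem_ball, dist_comm]; exact h : x ∈ Metric.ball z r) (subset_closure hx')

lemma Ctx.M10 (K : Kit n α) (C : Ctx n α D ε) (h11 : C11 n D) {y : Rn n} (hy : y ∈ D) :
    ∫⁻ x, green n α D ε x y * K.kill D x = K.Θ univ := by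
  have hD := C.hDo.measurableSet
  have h2 : Measurable (Dᶜ.indicator fun _ : Rn n => (1:ℝ≥0∞)) := measurable_const.indicator hD.compl
  have hg := C.g_measL K y
  have hm : Monotone fun j => K.Jop j (Dᶜ.indicator fun _ => 1) := by
    intro a b hab x
    exact lintegral_mono fun z => mul_le_mul_left (K.J_mono hab _) _
  have e : ∫⁻ x, green n α D ε x y * K.kill D x =
      ⨆ j, ∫⁻ x, green n α D ε x y * K.Jop j (Dᶜ.indicator fun _ => 1) x := by
    rw [← lintegral_iSup (fun j => hg.fun_mul (K.Jop_meas j h2))]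
    · apply lintegral_congr; intro x
      unfold Kit.kill
      rw [ENNReal.mul_iSup]
    · intro a b hab x
      exact mul_le_mul_right (hm hab x) _
  have hl1 : Tendsto (fun j => ∫⁻ x, green n α D ε x y * K.Jop j (Dᶜ.indicator fun _ => 1) x) atTop
      (𝓝 (∫⁻ x, green n α D ε x y * K.kill D x)) := by
    rw [e]
    apply tendsto_atTop_iSup
    intro a b hab
    exact lintegral_mono fun x => mul_le_mul_right (hm hab x) _
  have hl2 := hl1.add (C.M10b K h11 hy)
  rw [add_zero] at hl2
  simp_rw [C.M10a K hy] at hl2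
  refine le_antisymm (le_of_tendsto' hl2 fun j => Ctx.Hind_le K j hD y) ?_
  have h3 := K.Hliminf_open C.hDo y
  rw [indicator_of_mem hy, hl2.liminf_eq] at h3
  exact h3
end

section
variable {n : ℕ} {α : ℝ} {D : Set (Rn n)} {ε : Rn n → Measure (Rn n)}

lemma Ctx.pot_meas (K : Kit n α) (C : Ctx n α D ε) (σ : Measure (Rn n)) [SFinite σ] :
    Measurable (potential (green n α D ε) σ) :=
  Measurable.lintegral_prod_right' (ν := σ) (C.g_meas K)

lemma Ctx.pot_swap (K : Kit n α) (C : Ctx n α D ε) (σ : Measure (Rn n)) [SFinite σ] {w : Rn n → ℝ≥0∞}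
    (hw : Measurable w) :
    ∫⁻ x, w x * potential (green n α D ε) σ x = ∫⁻ y, (∫⁻ x, w x * green n α D ε x y) ∂σ := by
  rw [← lintegral_lintegral_swap]
  · apply lintegral_congr; intro x
    unfold potential
    rw [lintegral_const_mul _ (C.g_measR K x)]
  · exact ((hw.comp measurable_fst).fun_mul (C.g_meas K)).aemeasurable

lemma Ctx.wg_meas (K : Kit n α) (C : Ctx n α D ε) {w : Rn n → ℝ≥0∞} (hw : Measurable w) :
    Measurable fun y => ∫⁻ x, w x * green n α D ε x y :=
  Measurable.lintegral_prod_left' (μ := volume) (f := fun p : Rn n × Rn n => w p.1 * green n α D ε p.1 p.2)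
    ((hw.comp measurable_fst).fun_mul (C.g_meas K))

lemma Ctx.starM (K : Kit n α) (C : Ctx n α D ε) (σ : Measure (Rn n)) [SFinite σ] (hσ : ∀ᵐ y ∂σ, y ∈ D)
    (j : ℕ) {w : Rn n → ℝ≥0∞} (hw : Measurable w) :
    K.m j * (∫⁻ x, w x * potential (green n α D ε) σ x) + ∫⁻ y, (∫⁻ z, K.Hop j w z ∂ε y) ∂σ =
      (∫⁻ x, w x * K.Jop j (potential (green n α D ε) σ) x) + ∫⁻ y, K.Hop j w y ∂σ := by
  have hJ : Measurable (K.Jop j w) := K.Jop_meas j hw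
  have hm := C.wg_meas K hw
  rw [K.Jop_symm j (C.pot_meas K σ) hw]
  simp_rw [mul_comm (potential (green n α D ε) σ _)]
  rw [C.pot_swap K σ hw, C.pot_swap K σ hJ, ← lintegral_const_mul _ hm,
    ← lintegral_add_left (hm.const_mul _), ← lintegral_add_right _ (K.Hop_meas j hw)]
  apply lintegral_congr_ae
  filter_upwards [hσ] with y hy
  rw [C.star K hy j hw, K.Jop_symm j (C.g_measL K y) hw]
  congr 1
  apply lintegral_congr; intro x; rw [mul_comm]

lemma Ctx.pot_le_V (σ : Measure (Rn n)) (x : Rn n) : potential (green n α D ε) σ x ≤ V n α σ x :=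
  lintegral_mono fun y => green_le x y

lemma Ctx.pot_lsc (K : Kit n α) (C : Ctx n α D ε) (σ : Measure (Rn n)) {x : Rn n} (hx : x ∈ D) {p : ℕ → Rn n}
    (hp : Tendsto p atTop (𝓝 x)) :
    potential (green n α D ε) σ x ≤ liminf (fun j => potential (green n α D ε) σ (p j)) atTop := by
  refine le_trans ?_ (lintegral_liminf_le fun j => C.g_measR K (p j))
  refine lintegral_mono fun y => ?_
  exact (C.g_tendsto K hx y hp).liminf_eq.ge

lemma Ctx.Hg_meas2 (K : Kit n α) (C : Ctx n α D ε) (j : ℕ) :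
    Measurable fun p : Rn n × Rn n => K.Hop j (fun z => green n α D ε z p.2) p.1 := by
  unfold Kit.Hop
  refine Measurable.lintegral_prod_right' (ν := volume)
    (f := fun q : (Rn n × Rn n) × Rn n => K.H j (q.1.1 - q.2) * green n α D ε q.2 q.1.2) ?_
  refine ((K.H_meas j).comp (by fun_prop)).fun_mul ((C.g_meas K).comp (g := fun p : Rn n × Rn n => green n α D ε p.1 p.2)
    (f := fun q : (Rn n × Rn n) × Rn n => (q.2, q.1.2)) (by fun_prop))

lemma Ctx.Hpot_tendsto (K : Kit n α) (C : Ctx n α D ε) (μ : Measure (Rn n)) [SFinite μ] (hμ : ∀ᵐ y ∂μ, y ∈ D)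
    {x : Rn n} (hx : x ∈ D) (hV : V n α μ x ≠ ⊤) :
    Tendsto (fun j => K.Hop j (potential (green n α D ε) μ) x) atTop
      (𝓝 (K.Θ univ * potential (green n α D ε) μ x)) := by
  simp_rw [K.Hpot_swap _ _ (C.g_meas K) μ x]
  unfold potential
  rw [← lintegral_const_mul _ (C.g_measR K x)]
  refine tendsto_lintegral_of_dominated_convergence (fun y => K.A * riesz n α x y) ?_ ?_ ?_ ?_
  · intro j; exact (C.Hg_meas2 K j).comp (measurable_const.prodMk measurable_id)
  · exact fun j => ae_of_all _ fun y => Ctx.Hg_le K j y x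
  · rw [lintegral_const_mul _ (riesz_measR x)]
    exact ENNReal.mul_ne_top K.A_top hV
  · filter_upwards [hμ, no_atom μ x hV] with y hy hne
    exact C.M8a K hy hx hne.symm

lemma Ctx.Vε_int (K : Kit n α) (C : Ctx n α D ε) (μ : Measure (Rn n)) {y : Rn n} (hy : y ∈ D) :
    ∫⁻ x, V n α (ε y) x ∂μ ≤ V n α μ y := by
  refine lintegral_mono fun x => ?_
  rw [riesz_symm n α y x]
  exact C.M4 K hy x

lemma Ctx.b_lim (K : Kit n α) (C : Ctx n α D ε) (μ : Measure (Rn n)) [SFinite μ] (hμ : ∀ᵐ y ∂μ, y ∈ D)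
    {y : Rn n} (hy : y ∈ D) (hV : V n α μ y ≠ ⊤) :
    Tendsto (fun j => ∫⁻ z, K.Hop j (potential (green n α D ε) μ) z ∂ε y) atTop (𝓝 0) := by
  have := C.reg hy
  have e : ∀ j, ∫⁻ z, K.Hop j (potential (green n α D ε) μ) z ∂ε y =
      ∫⁻ η, (∫⁻ z, K.Hop j (fun x => green n α D ε x η) z ∂ε y) ∂μ := by
    intro j
    rw [← lintegral_lintegral_swap]
    · apply lintegral_congr; intro z
      rw [K.Hpot_swap _ _ (C.g_meas K) μ z]
    · exact (C.Hg_meas2 K j).aemeasurable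
  simp_rw [e]
  have h := tendsto_lintegral_of_dominated_convergence (μ := μ)
    (F := fun j η => ∫⁻ z, K.Hop j (fun x => green n α D ε x η) z ∂ε y) (f := fun _ => 0)
    (fun η => K.A * V n α (ε y) η) ?_ ?_ ?_ ?_
  · simpa using h
  · intro j
    exact Measurable.lintegral_prod_left' (μ := ε y) (C.Hg_meas2 K j)
  · intro j
    refine ae_of_all _ fun η => ?_
    change _ ≤ K.A * V n α (ε y) η
    rw [← Ctx.int_riesz (ε := ε) y η, ← lintegral_const_mul _ (riesz_measL η)]
    exact lintegral_mono fun z => Ctx.Hg_le K j η z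
  · rw [lintegral_const_mul _ (V_meas n α _)]
    exact ENNReal.mul_ne_top K.A_top (ne_top_of_le_ne_top hV (C.Vε_int K μ hy))
  · filter_upwards [hμ] with η hη
    exact C.M8c K hη hy

lemma Ctx.Gdom (K : Kit n α) (C : Ctx n α D ε) (μ ω : Measure (Rn n)) [IsFiniteMeasure μ] [IsFiniteMeasure ω]
    (hμ : ∀ᵐ y ∂μ, y ∈ D) (hω : ∀ᵐ y ∂ω, y ∈ D) {M : ℝ≥0∞} (hM : M ≠ ⊤) (hVM : ∀ x, V n α μ x ≤ M)
    (hle : ∀ᵐ x ∂μ, potential (green n α D ε) μ x ≤ potential (green n α D ε) ω x) :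
    ∀ᵐ x, potential (green n α D ε) μ x ≤ potential (green n α D ε) ω x := by
  have hp := C.pot_meas K μ
  have hq := C.pot_meas K ω
  set p := potential (green n α D ε) μ with hpdef
  set q := potential (green n α D ε) ω with hqdef
  have hpM : ∀ x, p x ≤ M := fun x => (Ctx.pot_le_V μ x).trans (hVM x)
  set w : Rn n → ℝ≥0∞ := fun x => p x - q x with hwdef
  have hw : Measurable w := hp.sub hq
  refine K.dom C.hDo.measurableSet C.volD C.volDc hp hq hM hpM ?_
    (fun j => ∫⁻ z, K.Hop j w z ∂μ) (fun j => ∫⁻ y, (∫⁻ z, K.Hop j w z ∂ε y) ∂ω) ?_ ?_ ?_ ?_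
  · refine ae_of_all _ fun x hx => ?_
    have : p x = 0 := by
      rw [hpdef]; unfold potential
      simp [green_off hx]
    rw [this]; exact zero_le
  · intro j
    rw [← C.starM K μ hμ j hw]; exact le_self_add
  · intro j
    have h := C.starM K ω hω j hw
    exact le_trans le_self_add h.ge
  · have h := tendsto_lintegral_of_dominated_convergence (μ := μ) (F := fun j z => K.Hop j w z) (f := fun _ => 0)
      (fun z => M * K.Θ univ) (fun j => K.Hop_meas j hw) ?_ ?_ ?_
    · simpa using h
    · exact fun j => ae_of_all _ fun z => K.Hop_le_const j hw (fun x => tsub_le_self.trans (hpM x)) z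
    · rw [lintegral_const]
      exact ENNReal.mul_ne_top (ENNReal.mul_ne_top hM K.Θ_fin) (measure_ne_top μ _)
    · filter_upwards [hle, hμ] with z hz hzD
      refine K.H_w_zero (r := fun z => min (p z) (q z)) (u := p) (hp.min hq) z ?_
        (C.Hpot_tendsto K μ hμ hzD (ne_top_of_le_ne_top hM (hVM z))) ?_ ?_ (ne_top_of_le_ne_top hM (hpM z))
      · refine ae_of_all _ fun x => ?_
        rcases le_total (p x) (q x) with h | h
        · simp only [hwdef, min_eq_left h, tsub_eq_zero_of_le h, zero_add]
        · simp only [hwdef, min_eq_right h, tsub_add_cancel_of_le h]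
      · apply K.Hliminf (hp.min hq)
        intro t ht
        exact lsc_min (C.pot_lsc K μ hzD ht) (C.pot_lsc K ω hzD ht)
      · simp [hz]
  · have hb : Tendsto (fun j => ∫⁻ y, (∫⁻ z, K.Hop j p z ∂ε y) ∂ω) atTop (𝓝 0) := by
      have h := tendsto_lintegral_of_dominated_convergence' (μ := ω)
        (F := fun j y => ∫⁻ z, K.Hop j p z ∂ε y) (f := fun _ => 0)
        (fun z => K.A * M) ?_ ?_ ?_ ?_
      · simpa using h
      · intro j
        refine AEMeasurable.congr (f := fun y => (∫⁻ x, K.Jop j p x * green n α D ε x y) + K.Hop j p y -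
          K.m j * ∫⁻ x, p x * green n α D ε x y) ?_ ?_
        · exact (((C.wg_meas K (K.Jop_meas j hp)).add (K.Hop_meas j hp)).sub
            ((C.wg_meas K hp).const_mul _)).aemeasurable
        · filter_upwards [hω] with y hy
          have h := C.star K hy j hp
          rw [K.Jop_symm j (C.g_measL K y) hp] at h
          simp_rw [mul_comm (K.Jop j p _)]
          rw [← h, ENNReal.add_sub_cancel_left]
          refine ENNReal.mul_ne_top (K.m_top j) (ne_top_of_le_ne_top
            (ENNReal.mul_ne_top hM (C.g_int y)) ?_)
          rw [← lintegral_const_mul _ (C.g_measL K y)]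
          exact lintegral_mono fun x => mul_le_mul_left (hpM x) _
      · intro j
        filter_upwards [hω] with y hy
        have := C.reg hy
        calc ∫⁻ z, K.Hop j p z ∂ε y ≤ ∫⁻ z, K.A * V n α μ z ∂ε y :=
              lintegral_mono fun z => (K.Hop_mono j (ae_of_all _ (Ctx.pot_le_V μ)) z).trans (K.HV_le j μ z)
          _ = K.A * energy (riesz n α) (ε y) μ := lintegral_const_mul _ (V_meas n α μ)
          _ ≤ K.A * M := by
            rw [energy_symm]
            exact mul_le_mul_right ((C.Vε_int K μ hy).trans (hVM y)) _
      · rw [lintegral_const]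
        exact ENNReal.mul_ne_top (ENNReal.mul_ne_top K.A_top hM) (measure_ne_top ω _)
      · filter_upwards [hω] with y hy
        exact C.b_lim K μ hμ hy (ne_top_of_le_ne_top hM (hVM y))
    refine tendsto_of_tendsto_of_tendsto_of_le_of_le tendsto_const_nhds hb (fun _ => zero_le) fun j => ?_
    exact lintegral_mono fun y => lintegral_mono fun z =>
      K.Hop_mono j (ae_of_all _ fun x => tsub_le_self) z

/-- Without boundedness of the potential. -/
lemma Ctx.Gdom2 (K : Kit n α) (C : Ctx n α D ε) (μ ω : Measure (Rn n)) [IsFiniteMeasure μ] [IsFiniteMeasure ω]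
    (hμ : ∀ᵐ y ∂μ, y ∈ D) (hω : ∀ᵐ y ∂ω, y ∈ D) (hE : energy (green n α D ε) μ μ ≠ ⊤)
    (hle : ∀ᵐ x ∂μ, potential (green n α D ε) μ x ≤ potential (green n α D ε) ω x) :
    ∀ᵐ x, potential (green n α D ε) μ x ≤ potential (green n α D ε) ω x := by
  have hp := C.pot_meas K μ
  set p := potential (green n α D ε) μ with hpdef
  have hDc : (Dᶜ).Nonempty := by
    rw [nonempty_iff_ne_empty]; intro h; exact C.volDc (by rw [h, measure_empty])
  let A : ℕ → Set (Rn n) := fun N => {x | p x ≤ N} ∩ {x | 1 / ((N:ℝ) + 1) ≤ Metric.infDist x Dᶜ}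
  have hA : ∀ N, MeasurableSet (A N) := fun N =>
    (measurableSet_le hp measurable_const).inter
      (measurableSet_le measurable_const (Metric.continuous_infDist_pt _).measurable)
  have hAm : Monotone A := by
    intro a b hab
    have h1 : (a:ℝ) ≤ b := by exact_mod_cast hab
    have h2 : (a:ℝ≥0∞) ≤ b := by exact_mod_cast hab
    refine inter_subset_inter (fun x (hx : p x ≤ a) => hx.trans h2) (fun x hx => ?_)
    refine le_trans ?_ (show 1 / ((a:ℝ) + 1) ≤ Metric.infDist x Dᶜ from hx)
    apply one_div_le_one_div_of_le (by positivity); linarith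
  have hN : ∀ N, ∀ᵐ x, potential (green n α D ε) (μ.restrict (A N)) x ≤ potential (green n α D ε) ω x := by
    intro N
    have hμN : ∀ᵐ y ∂μ.restrict (A N), y ∈ D := ae_restrict_of_ae hμ
    have hAN : ∀ᵐ y ∂μ.restrict (A N), y ∈ A N := ae_restrict_mem (hA N)
    have hpN : ∀ x, potential (green n α D ε) (μ.restrict (A N)) x ≤ p x := fun x => setLIntegral_le_lintegral _ _
    set B : ℝ≥0∞ := ENNReal.ofReal (2 ^ ((n:ℝ) - α)) * ENNReal.ofReal ((1 / ((N:ℝ) + 1)) ^ (α - n)) with hB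
    have hBt : B ≠ ⊤ := ENNReal.mul_ne_top ENNReal.ofReal_ne_top ENNReal.ofReal_ne_top
    have hV : ∀ᵐ x ∂μ.restrict (A N), V n α (μ.restrict (A N)) x ≤ N + B * μ univ := by
      filter_upwards [hμN, hAN] with x hxD hxA
      calc V n α (μ.restrict (A N)) x ≤ ∫⁻ y, (green n α D ε x y + B) ∂μ.restrict (A N) := by
            refine lintegral_mono_ae ?_
            filter_upwards [hμN, hAN] with y hyD hyA
            rw [← C.g_eq K hxD hyD]
            refine add_le_add_right (C.M3 K hyD (by positivity) ?_ x) _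
            intro z hz
            by_contra hzD
            have h1 := Metric.infDist_le_dist_of_mem (s := Dᶜ) (x := y) (y := z) hzD
            have h2 : 1 / ((N:ℝ) + 1) ≤ Metric.infDist y Dᶜ := hyA.2
            rw [Metric.mem_ball, dist_comm] at hz
            linarith
        _ = potential (green n α D ε) (μ.restrict (A N)) x + B * (μ.restrict (A N)) univ := by
            rw [lintegral_add_right _ measurable_const, lintegral_const]; rfl
        _ ≤ N + B * μ univ := by
            refine add_le_add ((hpN x).trans hxA.1) (mul_le_mul_right ?_ _)
            exact Measure.restrict_apply_le _ _
    refine C.Gdom K _ ω hμN hω (M := ENNReal.ofReal (2 ^ ((n:ℝ) - α)) * (N + B * μ univ)) ?_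
      (riesz_ball_bound C.hαn _ _ hV) ?_
    · exact ENNReal.mul_ne_top ENNReal.ofReal_ne_top (ENNReal.add_ne_top.2 ⟨ENNReal.natCast_ne_top N,
        ENNReal.mul_ne_top hBt (measure_ne_top μ _)⟩)
    · filter_upwards [ae_restrict_of_ae hle] with x hx
      exact (hpN x).trans hx
  have hU : ∀ᵐ x ∂μ, x ∈ ⋃ N, A N := by
    have hfin : ∀ᵐ x ∂μ, p x < ⊤ := ae_lt_top hp hE
    filter_upwards [hfin, hμ] with x hx hxD
    obtain ⟨N1, h1⟩ := ENNReal.exists_nat_gt hx.ne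
    have h2 : 0 < Metric.infDist x Dᶜ := by
      rw [← C.hDo.isClosed_compl.notMem_iff_infDist_pos hDc]; exact fun h => h hxD
    obtain ⟨N2, h2⟩ := exists_nat_one_div_lt h2
    rw [mem_iUnion]
    refine ⟨max N1 N2, ?_, ?_⟩
    · refine h1.le.trans ?_
      exact_mod_cast le_max_left N1 N2
    · refine le_trans ?_ h2.le
      apply one_div_le_one_div_of_le (by positivity)
      have : (N2:ℝ) ≤ (max N1 N2 : ℕ) := by exact_mod_cast le_max_right N1 N2
      linarith
  filter_upwards [ae_all_iff.2 hN] with x hx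
  have e : p x = ∫⁻ y in ⋃ N, A N, green n α D ε x y ∂μ := by
    rw [Measure.restrict_eq_self_of_ae_mem hU]; rfl
  rw [e, setLIntegral_iUnion_of_directed _ hAm.directed_le]
  exact iSup_le hx

lemma Ctx.kill_int (K : Kit n α) (C : Ctx n α D ε) (h11 : C11 n D) (σ : Measure (Rn n)) [SFinite σ]
    (hσ : ∀ᵐ y ∂σ, y ∈ D) :
    ∫⁻ x, K.kill D x * potential (green n α D ε) σ x = K.Θ univ * σ univ := by
  rw [C.pot_swap K σ (C.kill_meas K), ← lintegral_const]
  apply lintegral_congr_ae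
  filter_upwards [hσ] with y hy
  rw [← C.M10 K h11 hy]
  apply lintegral_congr; intro x; rw [mul_comm]

lemma Ctx.pot_eq (K : Kit n α) (C : Ctx n α D ε) (h11 : C11 n D) (μ ω : Measure (Rn n)) [IsFiniteMeasure μ]
    [IsFiniteMeasure ω] (hμ : ∀ᵐ y ∂μ, y ∈ D) (hω : ∀ᵐ y ∂ω, y ∈ D)
    (hle : ∀ᵐ x, potential (green n α D ε) μ x ≤ potential (green n α D ε) ω x) (hm : ω univ ≤ μ univ) :
    ∀ᵐ x, potential (green n α D ε) μ x = potential (green n α D ε) ω x := by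
  have hk := C.kill_meas K
  have h1 := C.kill_int K h11 μ hμ
  have h2 := C.kill_int K h11 ω hω
  have hf : ∫⁻ x, K.kill D x * potential (green n α D ε) ω x ≠ ⊤ := by
    rw [h2]; exact ENNReal.mul_ne_top K.Θ_fin (measure_ne_top ω _)
  have hle' : ∀ᵐ x, K.kill D x * potential (green n α D ε) μ x ≤ K.kill D x * potential (green n α D ε) ω x := by
    filter_upwards [hle] with x hx
    exact mul_le_mul_right hx _
  have heq := ae_eq_of_ae_le_of_lintegral_le hle'
    (ne_top_of_le_ne_top hf (lintegral_mono_ae hle'))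
    (hk.fun_mul (C.pot_meas K ω)).aemeasurable (by rw [h1, h2]; exact mul_le_mul_right hm _)
  have hfin := ae_lt_top (hk.fun_mul (C.pot_meas K ω)) hf
  filter_upwards [hle, heq, hfin] with x h3 h4 h5
  by_cases ht : K.kill D x = ⊤
  · have : potential (green n α D ε) ω x = 0 := by
      by_contra h0
      rw [ht, ENNReal.top_mul h0] at h5
      exact lt_irrefl _ h5
    rw [this] at h3 ⊢
    exact le_antisymm h3 zero_le
  · exact (ENNReal.mul_right_inj (C.kill_pos K x).ne' ht).1 h4

lemma Ctx.pot_int (K : Kit n α) (C : Ctx n α D ε) (σ : Measure (Rn n)) [IsFiniteMeasure σ] :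
    ∫⁻ x, potential (green n α D ε) σ x ≠ ⊤ := by
  obtain ⟨c, hc, h⟩ := riesz_int_bound C.hn C.h0 C.hαn
  have e := C.pot_swap K σ (w := fun _ => 1) measurable_const
  simp only [one_mul] at e
  rw [e]
  refine ne_top_of_le_ne_top (b := ∫⁻ y, (c + volume D) ∂σ) ?_ (lintegral_mono fun y => ?_)
  · rw [lintegral_const]
    exact ENNReal.mul_ne_top (ENNReal.add_ne_top.2 ⟨hc, C.volD⟩) (measure_ne_top σ _)
  · refine le_trans ?_ (h y D C.hDo.measurableSet)
    rw [← lintegral_indicator C.hDo.measurableSet]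
    refine lintegral_mono fun x => ?_
    by_cases hx : x ∈ D
    · rw [indicator_of_mem hx, riesz_symm n α y x]; exact green_le x y
    · rw [green_off hx]; exact zero_le

lemma Ctx.local_null (K : Kit n α) (C : Ctx n α D ε) (μ ω : Measure (Rn n)) [IsFiniteMeasure μ]
    [IsFiniteMeasure ω] (hμ : ∀ᵐ y ∂μ, y ∈ D) (hω : ∀ᵐ y ∂ω, y ∈ D)
    (heq : ∀ᵐ x, potential (green n α D ε) μ x = potential (green n α D ε) ω x)
    {x₀ : Rn n} {δ : ℝ} (hδ : 0 < δ) (hb : Metric.ball x₀ (2 * δ) ⊆ D)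
    (hμb : ∀ᵐ z ∂μ, z ∉ Metric.ball x₀ (2 * δ)) : ω (Metric.ball x₀ δ) = 0 := by
  set U := Metric.ball x₀ δ with hU
  have hUo : IsOpen U := Metric.isOpen_ball
  set w : Rn n → ℝ≥0∞ := U.indicator fun _ => 1 with hwdef
  have hw : Measurable w := measurable_const.indicator hUo.measurableSet
  obtain ⟨c, hc, hcb⟩ := riesz_int_bound C.hn C.h0 C.hαn
  set R : ℝ≥0∞ := c + volume U with hR
  have hRt : R ≠ ⊤ := ENNReal.add_ne_top.2 ⟨hc, measure_ball_lt_top.ne⟩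
  have hRb : ∀ z, ∫⁻ x, riesz n α z x * w x ≤ R := by
    intro z
    refine le_trans (le_of_eq ?_) (hcb z U hUo.measurableSet)
    rw [← lintegral_indicator hUo.measurableSet]
    apply lintegral_congr; intro x
    by_cases hx : x ∈ U <;> simp [hwdef, hx]
  have hdist : ∀ z, z ∉ Metric.ball x₀ (2 * δ) → ∀ x, w x ≠ 0 → δ ≤ dist z x := by
    intro z hz x hx
    have hx' : x ∈ U := by by_contra h; exact hx (indicator_of_notMem h _)
    rw [hU, Metric.mem_ball] at hx'
    rw [Metric.mem_ball, not_lt] at hz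
    have := dist_triangle z x x₀
    linarith
  set a : ℕ → ℝ≥0∞ := fun j => K.e j * ENNReal.ofReal (δ ^ (-2:ℝ)) with ha
  have hal : Tendsto a atTop (𝓝 0) := by
    have := ENNReal.Tendsto.mul_const K.e_lim (b := ENNReal.ofReal (δ ^ (-2:ℝ))) (Or.inr ENNReal.ofReal_ne_top)
    rwa [zero_mul] at this
  have h1 : ∀ j, ∫⁻ z, K.Hop j w z ∂μ ≤ a j * R * μ univ := by
    intro j
    rw [← lintegral_const]
    refine lintegral_mono_ae ?_
    filter_upwards [hμb] with z hz
    exact (K.Hfar j hw z hδ (hdist z hz)).trans (mul_le_mul_right (hRb z) _)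
  have h2 : ∀ j, ∫⁻ y, (∫⁻ z, K.Hop j w z ∂ε y) ∂ω ≤ a j * R * ω univ := by
    intro j
    rw [← lintegral_const]
    refine lintegral_mono_ae ?_
    filter_upwards [hω] with y hy
    have := C.reg hy
    have hm : Measurable fun z => ∫⁻ x, riesz n α z x * w x :=
      Measurable.lintegral_prod_right' (ν := volume) (f := fun p : Rn n × Rn n => riesz n α p.1 p.2 * w p.2)
        ((riesz_meas n α).fun_mul (hw.comp measurable_snd))
    calc ∫⁻ z, K.Hop j w z ∂ε y ≤ ∫⁻ z, a j * (∫⁻ x, riesz n α z x * w x) ∂ε y := by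
          refine lintegral_mono_ae ?_
          filter_upwards [C.conc K hy] with z hz
          exact K.Hfar j hw z hδ (hdist z fun h => hz (hb h))
      _ = a j * ∫⁻ z, (∫⁻ x, riesz n α z x * w x) ∂ε y := lintegral_const_mul _ hm
      _ ≤ a j * R := by
          refine mul_le_mul_right ?_ _
          rw [lintegral_lintegral_swap]
          · refine le_trans (lintegral_mono fun x => ?_) (hRb y)
            rw [lintegral_mul_const _ (riesz_measL x)]
            refine mul_le_mul_left ?_ _
            rw [Ctx.int_riesz, riesz_symm n α y x]
            exact C.M4 K hy x
          · exact ((riesz_meas n α).fun_mul (hw.comp measurable_snd)).aemeasurable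
  have h3 : ∀ j, ∫⁻ z, K.Hop j w z ∂ω ≤ a j * R * μ univ + a j * R * ω univ := by
    intro j
    have s1 := C.starM K μ hμ j hw
    have s2 := C.starM K ω hω j hw
    have e1 : ∫⁻ x, w x * potential (green n α D ε) μ x = ∫⁻ x, w x * potential (green n α D ε) ω x := by
      apply lintegral_congr_ae
      filter_upwards [heq] with x hx
      rw [hx]
    have e2 : ∫⁻ x, w x * K.Jop j (potential (green n α D ε) μ) x =
        ∫⁻ x, w x * K.Jop j (potential (green n α D ε) ω) x := by
      apply lintegral_congr; intro x
      rw [K.Jop_congr j heq x]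
    rw [e1, e2] at s1
    have hfin : ∫⁻ x, w x * K.Jop j (potential (green n α D ε) ω) x ≠ ⊤ := by
      rw [K.Jop_symm j (C.pot_meas K ω) hw]
      refine ne_top_of_le_ne_top (ENNReal.mul_ne_top (C.pot_int K ω) (K.m_top j)) ?_
      rw [← lintegral_mul_const _ (C.pot_meas K ω)]
      exact lintegral_mono fun x => mul_le_mul_right
        (K.Jop_le_const j (fun x => indicator_le_self' (fun _ _ => zero_le) x) x) _
    have h4 : (∫⁻ x, w x * K.Jop j (potential (green n α D ε) ω) x) + ∫⁻ z, K.Hop j w z ∂ω ≤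
        (∫⁻ x, w x * K.Jop j (potential (green n α D ε) ω) x) +
          ((∫⁻ z, K.Hop j w z ∂μ) + ∫⁻ y, (∫⁻ z, K.Hop j w z ∂ε y) ∂ω) := by
      rw [← s2, ← add_assoc, ← s1]
      exact add_le_add_left le_self_add _
    exact ((ENNReal.add_le_add_iff_left hfin).1 h4).trans (add_le_add (h1 j) (h2 j))
  have h4 : K.Θ univ * ω U ≤ 0 := by
    calc K.Θ univ * ω U = ∫⁻ x, U.indicator (fun _ => K.Θ univ) x ∂ω := by
          rw [lintegral_indicator_const hUo.measurableSet]
      _ ≤ ∫⁻ x, liminf (fun j => K.Hop j w x) atTop ∂ω := lintegral_mono fun x => K.Hliminf_open hUo x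
      _ ≤ liminf (fun j => ∫⁻ x, K.Hop j w x ∂ω) atTop := lintegral_liminf_le fun j => K.Hop_meas j hw
      _ ≤ liminf (fun j => a j * R * μ univ + a j * R * ω univ) atTop :=
          liminf_le_liminf (Eventually.of_forall h3)
      _ = 0 := by
          have t1 := ENNReal.Tendsto.mul_const hal (b := R) (Or.inr hRt)
          have t2 := ENNReal.Tendsto.mul_const t1 (b := μ univ) (Or.inr (measure_ne_top μ _))
          have t3 := ENNReal.Tendsto.mul_const t1 (b := ω univ) (Or.inr (measure_ne_top ω _))
          have t4 := t2.add t3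
          simp only [zero_mul, add_zero] at t4
          exact t4.liminf_eq
  rcases mul_eq_zero.1 (le_antisymm h4 zero_le) with h | h
  · exact absurd h K.c_pos
  · exact h
end

/-- For the α-Green kernel of a bounded `C^{1,1}` open set `D ⊆ ℝⁿ`,
`1 < α < 2`, and `F` relatively closed in `D`: the balayage of an admissible nonzero
measure `ω` concentrated on `Δ = D ∖ F` satisfies `ω^F_{g_α}(F) < ω(Δ)`. -/
theorem green_balayage_strict_mass_inequality
    (n : ℕ) (hn : 2 ≤ n) (α : ℝ) (hα1 : 1 < α) (hα2 : α < 2)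
    (D : Set (Rn n)) (hDo : IsOpen D) (hDb : Bornology.IsBounded D) (hD11 : C11 n D)
    (εDc : Rn n → Measure (Rn n))
    (hεDc : ∀ y ∈ D, IsInnerBalayage (riesz n α) Dᶜ (Measure.dirac y) (εDc y))
    (F : Set (Rn n)) (hFD : F ⊆ D) (hFcl : ∃ C : Set (Rn n), IsClosed C ∧ F = C ∩ D)
    (hcap : 0 < innerCap (green n α D εDc) F)
    (ω : Measure (Rn n)) (hωR : IsRadon ω) (hω0 : ω ≠ 0) (hconc : ω (D \ F)ᶜ = 0)
    (hfin : ω (D \ F) < ⊤ ∨ FiniteEnergy (green n α D εDc) ω)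
    (ωF : Measure (Rn n)) (hωF : IsInnerBalayage (green n α D εDc) F ω ωF) :
    ωF F < ω (D \ F) := by
  have hn2 : (2:ℝ) ≤ n := by exact_mod_cast hn
  obtain ⟨K⟩ := exists_kit (α := α) n (by omega) (by linarith) hα2 (by linarith)
  have C : Ctx n α D εDc := ⟨by omega, by linarith, by linarith, hDo, hDb, hεDc⟩
  have hωR' : ω.Regular := hωR
  have hωFR : ωF.Regular := hωF.1.1.1
  obtain ⟨Z, hZ, hFZ⟩ := hFcl
  have hFm : MeasurableSet F := by rw [hFZ]; exact hZ.measurableSet.inter hDo.measurableSet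
  have hΔo : IsOpen (D \ F) := by
    have : D \ F = D ∩ Zᶜ := by
      ext x; rw [hFZ]; simp only [Set.mem_sdiff, mem_inter_iff, mem_compl_iff]; tauto
    rw [this]; exact hDo.inter hZ.isOpen_compl
  have hcomp : IsCompact (closure D) := hDb.isCompact_closure
  have hωΔ : ∀ᵐ y ∂ω, y ∈ D \ F := hconc
  have hωD : ∀ᵐ y ∂ω, y ∈ D := by filter_upwards [hωΔ] with y hy using hy.1
  have hωu : ω univ = ω (D \ F) := by
    rw [← measure_add_measure_compl hΔo.measurableSet, hconc, add_zero]
  have : IsFiniteMeasure ω := ⟨by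
    rw [hωu]
    exact lt_of_le_of_lt (measure_mono (sdiff_subset.trans subset_closure)) hcomp.measure_lt_top⟩
  set μ := ωF.restrict F with hμdef
  have hμu : μ univ = ωF F := by rw [hμdef, Measure.restrict_apply_univ]
  have : IsFiniteMeasure μ := ⟨by
    rw [hμu]
    exact lt_of_le_of_lt (measure_mono (hFD.trans subset_closure)) hcomp.measure_lt_top⟩
  have hμF : ∀ᵐ y ∂μ, y ∈ F := ae_restrict_mem hFm
  have hμD : ∀ᵐ y ∂μ, y ∈ D := by filter_upwards [hμF] with y hy using hFD hy
  have hpl : ∀ x, potential (green n α D εDc) μ x ≤ potential (green n α D εDc) ωF x :=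
    fun x => setLIntegral_le_lintegral _ _
  have hE : energy (green n α D εDc) μ μ ≠ ⊤ := by
    refine ne_top_of_le_ne_top hωF.1.1.2.ne ?_
    exact (lintegral_mono hpl).trans (setLIntegral_le_lintegral _ _)
  have hle : ∀ᵐ x ∂μ, potential (green n α D εDc) μ x ≤ potential (green n α D εDc) ω x := by
    have h1 : MeasurableSet {x ∈ F | potential (green n α D εDc) ωF x ≠ potential (green n α D εDc) ω x} :=
      hFm.inter (measurableSet_eq_fun (C.pot_meas K ωF) (C.pot_meas K ω)).compl
    have h2 := cap_null _ ωF hωFR hωF.1.1.2 _ h1 hωF.2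
    have h3 : ∀ᵐ x ∂ωF, ¬ (x ∈ {x ∈ F | potential (green n α D εDc) ωF x ≠ potential (green n α D εDc) ω x}) :=
      measure_eq_zero_iff_ae_notMem.1 h2
    filter_upwards [hμF, ae_restrict_of_ae h3] with x hx hx3
    have : potential (green n α D εDc) ωF x = potential (green n α D εDc) ω x := by
      by_contra hne; exact hx3 ⟨hx, hne⟩
    exact this ▸ hpl x
  have hdom := C.Gdom2 K μ ω hμD hωD hE hle
  by_contra hcon
  rw [not_lt, ← hωu, ← hμu] at hcon
  have heq := C.pot_eq K hD11 μ ω hμD hωD hdom hcon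
  have hnull : ω (D \ F) = 0 := by
    apply measure_null_of_locally_null
    intro x hx
    obtain ⟨r, hr, hb⟩ := Metric.isOpen_iff.1 hΔo x hx
    have h2 : 2 * (r / 2) = r := by ring
    refine ⟨Metric.ball x (r / 2), mem_nhdsWithin_of_mem_nhds (Metric.ball_mem_nhds x (half_pos hr)), ?_⟩
    refine C.local_null K μ ω hμD hωD heq (half_pos hr) ?_ ?_
    · rw [h2]; exact hb.trans sdiff_subset
    · rw [h2]
      filter_upwards [hμF] with z hz h
      exact (hb h).2 hz
  apply hω0
  rw [← Measure.measure_univ_eq_zero, hωu, hnull]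

end Balayage
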